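/- arXiv:1805.06955 — 3 statements merged into one kernel-verified Lean document; each statement's English description precedes it below -/
import Mathlib

section
/- Let 𝒪 ⊂ ℝ^d be a bounded domain and p ∈ [1,2]. Suppose that for every α, β and x ∈ 𝒪 the Lévy measure decomposes as μ_x^{αβ} = μ̂_x^{αβ} + μ̃_x^{αβ} + μ̌_x^{αβ}, where μ̂_x^{αβ} is supported in a neighborhood of the origin contained in B₁, μ̃_x^{αβ} is a bounded measure supported in B₁, and μ̌_x^{αβ} is the restriction of μ_x^{αβ} to ℝ^d∖B₁. Suppose Assumptions A–E hold with the measures μ̂_x^{αβ} in place of the restriction to B₁, and that there are L₁, L₂ ≥ 0 with μ̃_x^{αβ}(B₁) ≤ L₁ for all x ∈ 𝒪, α, β, and ∫_{ℝ^d} |z| d|μ̃_x^{αβ} − μ̃_y^{αβ}|(z) ≤ L₂|x−y| for all x, y ∈ 𝒪, α, β. Then the comparison principle holds for (E): if u is a viscosity subsolution and v a viscosity supersolution of (E) with u ≤ v outside 𝒪, then u ≤ v in 𝒪. -/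
open MeasureTheory Set Metric Filter
open scoped ENNReal NNReal

noncomputable section

abbrev Euc (d : ℕ) := EuclideanSpace ℝ (Fin d)

variable {d : ℕ} {A B : Type*}

/-- `μ ∈ 𝕃_p(ℝ^d)`: a positive Borel measure on `ℝ^d ∖ {0}` (modeled as a measure on `ℝ^d`
vanishing on `{0}`) with `N_p(μ) = ∫ min(1,|z|^p) dμ < ∞`. -/
def IsLevyLp (p : ℝ) (μ : Measure (Euc d)) : Prop :=
  μ {0} = 0 ∧ ∫⁻ z, ENNReal.ofReal (min 1 (‖z‖ ^ p)) ∂μ < ⊤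

/-- `μ ∈ 𝕃_p(Ω)`: member of `𝕃_p(ℝ^d)` giving no mass to the complement of `Ω`. -/
def IsLevyLpOn (p : ℝ) (Ω : Set (Euc d)) (μ : Measure (Euc d)) : Prop :=
  IsLevyLp p μ ∧ μ Ωᶜ = 0

/-- `μ ∈ M_p(ℝ^d)`: Lévy measure with finite `p`-moment. -/
def IsMp (p : ℝ) (μ : Measure (Euc d)) : Prop :=
  IsLevyLp p μ ∧ ∫⁻ z, ENNReal.ofReal (‖z‖ ^ p) ∂μ < ⊤

/-- Admissible transport plans between `μ₁` and `μ₂`: positive Borel measures on `ℝ^d × ℝ^d`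
with no mass at `(0,0)` whose marginals, restricted to `ℝ^d ∖ {0}`, are `μ₁` and `μ₂`. -/
def AdmPlan (μ₁ μ₂ : Measure (Euc d)) : Set (Measure (Euc d × Euc d)) :=
  {γ | γ {((0 : Euc d), (0 : Euc d))} = 0 ∧
       (γ.map Prod.fst).restrict {(0 : Euc d)}ᶜ = μ₁ ∧
       (γ.map Prod.snd).restrict {(0 : Euc d)}ᶜ = μ₂}

/-- The transport cost functional `J_p(γ) = ∫ |x-y|^p dγ`. -/
def Jp (p : ℝ) (γ : Measure (Euc d × Euc d)) : ℝ≥0∞ :=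
  ∫⁻ q, ENNReal.ofReal (‖q.1 - q.2‖ ^ p) ∂γ

/-- `d_{𝕃_p}(μ,ν)^p` as an extended nonnegative real. -/
def dLpPow (p : ℝ) (μ ν : Measure (Euc d)) : ℝ≥0∞ :=
  ⨅ γ ∈ AdmPlan μ ν, Jp p γ

/-- The transport distance `d_{𝕃_p}`. -/
def dLp (p : ℝ) (μ ν : Measure (Euc d)) : ℝ :=
  (dLpPow p μ ν).toReal ^ (1 / p)

/-- Total variation distance `|μ - ν|(X)` between two positive measures. -/
def dTV {X : Type*} [MeasurableSpace X] (μ ν : Measure X) : ℝ≥0∞ :=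
  (⨆ (s : Set X) (_ : MeasurableSet s), μ s - ν s) +
  (⨆ (s : Set X) (_ : MeasurableSet s), ν s - μ s)

/-- A modulus of continuity. -/
def IsModulus (θ : ℝ → ℝ) : Prop :=
  (∀ r, 0 ≤ θ r) ∧ Monotone θ ∧ Tendsto θ (nhdsWithin 0 (Ioi 0)) (nhds 0)

/-- Bounded uniformly continuous functions on `ℝ^d`. -/
def IsBUC (u : Euc d → ℝ) : Prop :=
  (∃ M, ∀ x, |u x| ≤ M) ∧ UniformContinuous u

/-- The Lévy operator `L_μ(φ,x) = ∫ [φ(x+z) - φ(x) - χ_{B₁}(z) Dφ(x)·z] dμ(z)`. -/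
def Lop (μ : Measure (Euc d)) (φ : Euc d → ℝ) (x : Euc d) : ℝ :=
  ∫ z, (φ (x + z) - φ x -
    (ball (0 : Euc d) 1).indicator (fun w => fderiv ℝ φ x w) z) ∂μ

/-- The operator `I(φ,x) = sup_α inf_β { -L^{αβ}(φ,x) + c_{αβ}(x) φ(x) + f_{αβ}(x) }`. -/
def Iop (μf : Euc d → A → B → Measure (Euc d)) (c f : A → B → Euc d → ℝ)
    (φ : Euc d → ℝ) (x : Euc d) : ℝ :=
  ⨆ α : A, ⨅ β : B, (-(Lop (μf x α β) φ x) + c α β x * φ x + f α β x)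

/-- Viscosity subsolution of `J(u,x) = 0` in `O`. -/
def IsSubsolution (O : Set (Euc d)) (J : (Euc d → ℝ) → Euc d → ℝ) (u : Euc d → ℝ) : Prop :=
  ∀ φ : Euc d → ℝ, ContDiff ℝ 2 φ → (∃ M, ∀ x, |φ x| ≤ M) →
    ∀ x ∈ O, (∀ y, u y - φ y ≤ u x - φ x) → φ x = u x → J φ x ≤ 0

/-- Viscosity supersolution of `J(u,x) = 0` in `O`. -/
def IsSupersolution (O : Set (Euc d)) (J : (Euc d → ℝ) → Euc d → ℝ) (u : Euc d → ℝ) : Prop :=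
  ∀ φ : Euc d → ℝ, ContDiff ℝ 2 φ → (∃ M, ∀ x, |φ x| ≤ M) →
    ∀ x ∈ O, (∀ y, u x - φ x ≤ u y - φ y) → φ x = u x → 0 ≤ J φ x

/-- Assumption A, stated for a family `νhat` (the parts of the Lévy measures near the origin):
Lipschitz continuity in the transport metric `d_{𝕃_p}`. -/
def AssumptionA (O : Set (Euc d)) (p : ℝ) (νhat : Euc d → A → B → Measure (Euc d)) : Prop :=
  ∃ C : ℝ, 0 ≤ C ∧ ∀ x ∈ O, ∀ y ∈ O, ∀ (α : A) (β : B),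
    dLp p (νhat x α β) (νhat y α β) ≤ C * ‖x - y‖

/-- Assumption A1: `s`-Hölder continuity in the transport metric `d_{𝕃_p}`. -/
def AssumptionA1 (O : Set (Euc d)) (p s : ℝ) (νhat : Euc d → A → B → Measure (Euc d)) : Prop :=
  ∃ C : ℝ, 0 < C ∧ ∀ x ∈ O, ∀ y ∈ O, ∀ (α : A) (β : B),
    dLp p (νhat x α β) (νhat y α β) ≤ C * ‖x - y‖ ^ s

/-- Assumption B: continuity in total variation of the tails. -/
def AssumptionB (O : Set (Euc d)) (νcheck : Euc d → A → B → Measure (Euc d)) : Prop :=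
  ∃ θ : ℝ → ℝ, IsModulus θ ∧ ∀ x ∈ O, ∀ y ∈ O, ∀ (α : A) (β : B),
    dTV (νcheck x α β) (νcheck y α β) ≤ ENNReal.ofReal (θ ‖x - y‖)

/-- Assumption C: equicontinuity and uniform boundedness of `f_{αβ}`. -/
def AssumptionC (O : Set (Euc d)) (f : A → B → Euc d → ℝ) : Prop :=
  ∃ θ : ℝ → ℝ, IsModulus θ ∧ ∃ C : ℝ, 0 ≤ C ∧
    (∀ x ∈ O, ∀ y ∈ O, ∀ (α : A) (β : B), |f α β x - f α β y| ≤ θ ‖x - y‖) ∧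
    (∀ x ∈ O, ∀ (α : A) (β : B), |f α β x| ≤ C)

/-- Assumption D: `0 < λ ≤ c_{αβ} ≤ λ₁` and equicontinuity of `c_{αβ}`. -/
def AssumptionD (O : Set (Euc d)) (c : A → B → Euc d → ℝ) : Prop :=
  ∃ lam lam1 : ℝ, 0 < lam ∧ lam ≤ lam1 ∧
    (∀ x ∈ O, ∀ (α : A) (β : B), lam ≤ c α β x ∧ c α β x ≤ lam1) ∧
    ∃ θ : ℝ → ℝ, IsModulus θ ∧
      ∀ x ∈ O, ∀ y ∈ O, ∀ (α : A) (β : B), |c α β x - c α β y| ≤ θ ‖x - y‖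

/-- Assumption E: uniform integrability of the Lévy measures. -/
def AssumptionE (O : Set (Euc d)) (p : ℝ) (μf : Euc d → A → B → Measure (Euc d)) : Prop :=
  (∃ θ : ℝ → ℝ, IsModulus θ ∧ ∀ r : ℝ, 0 < r → ∀ x ∈ O, ∀ (α : A) (β : B),
      ∫⁻ z in ball (0 : Euc d) r, ENNReal.ofReal (‖z‖ ^ p) ∂(μf x α β) ≤ ENNReal.ofReal (θ r)) ∧
  (∃ Λ : ℝ, 0 ≤ Λ ∧ ∀ x ∈ O, ∀ (α : A) (β : B),
      ∫⁻ z, ENNReal.ofReal (min 1 (‖z‖ ^ p)) ∂(μf x α β) ≤ ENNReal.ofReal Λ)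

/-- The smooth approximation `ψ_κ(x) = (κ + |x|²)^{p/2} - κ^{p/2}` of `|x|^p`. -/
def psiK (p κ : ℝ) (x : Euc d) : ℝ := (κ + ‖x‖ ^ 2) ^ (p / 2) - κ ^ (p / 2)

/-- `u` is pointwise-`C^{1,1}` at `x₀`. -/
def PointwiseC11 (u : Euc d → ℝ) (x₀ : Euc d) : Prop :=
  DifferentiableAt ℝ u x₀ ∧ ∃ C : ℝ, 0 < C ∧ ∀ᶠ x in nhds x₀,
    |u x - u x₀ - fderiv ℝ u x₀ (x - x₀)| ≤ C * ‖x - x₀‖ ^ 2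

/-- Sup-convolution `u^δ`. -/
def supConv (δ : ℝ) (u : Euc d → ℝ) (x : Euc d) : ℝ :=
  ⨆ y : Euc d, (u y - ‖x - y‖ ^ 2 / δ)

/-- Inf-convolution `v_δ`. -/
def infConv (δ : ℝ) (v : Euc d → ℝ) (x : Euc d) : ℝ :=
  ⨅ y : Euc d, (v y + ‖x - y‖ ^ 2 / δ)

/-- `(φ,ψ) ∈ Adm^p`, the admissible pairs for the dual problem. -/
def AdmPair (p : ℝ) (μ₁ μ₂ : Measure (Euc d)) (φ ψ : Euc d → ℝ) : Prop :=
  Integrable φ μ₁ ∧ Integrable ψ μ₂ ∧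
  UpperSemicontinuous φ ∧ UpperSemicontinuous ψ ∧
  φ 0 = 0 ∧ ψ 0 = 0 ∧ ∀ x y : Euc d, φ x + ψ y ≤ ‖x - y‖ ^ p

theorem rpow_le_tangent {s t q : ℝ} (hs : 0 < s) (ht : 0 ≤ t) (hq0 : 0 ≤ q) (hq1 : q ≤ 1) :
    t ^ q ≤ s ^ q + q * s ^ (q - 1) * (t - s) := by
  have h1 : -1 ≤ t / s - 1 := by linarith [div_nonneg ht hs.le]
  have h2 := rpow_one_add_le_one_add_mul_self h1 hq0 hq1
  have h3 : 1 + (t / s - 1) = t / s := by ring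
  rw [h3, Real.div_rpow ht hs.le, div_le_iff₀ (Real.rpow_pos_of_pos hs q)] at h2
  refine h2.trans (le_of_eq ?_)
  rw [Real.rpow_sub_one hs.ne']
  field_simp

theorem psiK_zero (p κ : ℝ) : psiK p κ (0 : Euc d) = 0 := by simp [psiK]

theorem norm_rpow_le_psiK_add {p κ : ℝ} (hp : 0 ≤ p) (hκ : 0 ≤ κ) (x : Euc d) :
    ‖x‖ ^ p ≤ psiK p κ x + κ ^ (p / 2) := by
  have h : ‖x‖ ^ p = (‖x‖ ^ 2) ^ (p / 2) := by
    rw [← Real.rpow_natCast, ← Real.rpow_mul (norm_nonneg x)]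
    congr 1
    push_cast
    ring
  rw [h, psiK, sub_add_cancel]
  exact Real.rpow_le_rpow (by positivity) (by linarith) (by linarith)

theorem contDiff_psiK (p : ℝ) {κ : ℝ} (hκ : 0 < κ) : ContDiff ℝ 2 (psiK p κ : Euc d → ℝ) := by
  unfold psiK
  refine ContDiff.sub (ContDiff.rpow_const_of_ne ?_ ?_) contDiff_const
  · exact contDiff_const.add (contDiff_norm_sq ℝ)
  · intro x
    positivity

theorem hasFDerivAt_psiK (p : ℝ) {κ : ℝ} (hκ : 0 < κ) (a : Euc d) :
    HasFDerivAt (psiK p κ : Euc d → ℝ)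
      ((p * (κ + ‖a‖ ^ 2) ^ (p / 2 - 1)) • innerSL ℝ a) a := by
  have h1 : HasFDerivAt (fun x : Euc d => κ + ‖x‖ ^ 2) (2 • innerSL ℝ a) a :=
    (hasStrictFDerivAt_norm_sq a).hasFDerivAt.const_add κ
  have h2 := (h1.rpow_const (p := p / 2) (Or.inl (by positivity))).sub_const (κ ^ (p / 2))
  unfold psiK
  refine h2.congr_fderiv ?_
  ext v
  simp
  ring

theorem psiK_taylor_quadratic {p κ : ℝ} (hp0 : 0 ≤ p) (hp2 : p ≤ 2) (hκ : 0 < κ) (a h : Euc d) :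
    psiK p κ (a + h) - psiK p κ a - fderiv ℝ (psiK p κ) a h
      ≤ p / 2 * (κ + ‖a‖ ^ 2) ^ (p / 2 - 1) * ‖h‖ ^ 2 := by
  have ht := rpow_le_tangent (s := κ + ‖a‖ ^ 2) (t := κ + ‖a + h‖ ^ 2) (q := p / 2)
    (by positivity) (by positivity) (by linarith) (by linarith)
  rw [(hasFDerivAt_psiK p hκ a).fderiv]
  have hn := norm_add_sq_real a h
  simp only [smul_apply, innerSL_apply_apply, smul_eq_mul, psiK]
  rw [hn] at ht ⊢
  nlinarith [ht]

theorem psiK_taylor_rpow {p κ : ℝ} (hp1 : 1 ≤ p) (hp2 : p ≤ 2) (hκ : 0 < κ) (a h : Euc d) :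
    psiK p κ (a + h) - psiK p κ a - fderiv ℝ (psiK p κ) a h ≤ 6 * ‖h‖ ^ p := by
  set s := κ + ‖a‖ ^ 2 with hs
  have hs0 : 0 < s := by positivity
  have hpow : ‖h‖ ^ p = (‖h‖ ^ 2) ^ (p / 2) := by
    rw [← Real.rpow_natCast, ← Real.rpow_mul (norm_nonneg h)]
    congr 1
    push_cast
    ring
  rcases eq_or_ne h 0 with rfl | hh
  · simp
    positivity
  have hh0 : 0 < ‖h‖ ^ 2 := by positivity
  have hhn : 0 < ‖h‖ := by positivity
  have hpp : 0 ≤ ‖h‖ ^ p := by positivity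
  rcases le_total (‖h‖ ^ 2) s with hle | hle
  · refine (psiK_taylor_quadratic (by linarith) hp2 hκ a h).trans ?_
    rw [← hs]
    have h1 : s ^ (p / 2 - 1) ≤ (‖h‖ ^ 2) ^ (p / 2 - 1) :=
      Real.rpow_le_rpow_of_nonpos hh0 hle (by linarith)
    have h2 : (‖h‖ ^ 2) ^ (p / 2 - 1) * ‖h‖ ^ 2 = ‖h‖ ^ p := by
      rw [hpow, Real.rpow_sub_one hh0.ne']
      field_simp
    have h3 : 0 ≤ s ^ (p / 2 - 1) := by positivity
    calc p / 2 * s ^ (p / 2 - 1) * ‖h‖ ^ 2 ≤ 1 * (‖h‖ ^ 2) ^ (p / 2 - 1) * ‖h‖ ^ 2 := by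
          gcongr
          linarith
      _ ≤ 6 * ‖h‖ ^ p := by linarith
  · rw [(hasFDerivAt_psiK p hκ a).fderiv, ← hs]
    simp only [smul_apply, innerSL_apply_apply, smul_eq_mul, psiK, ← hs]
    have hinner : -(‖a‖ * ‖h‖) ≤ inner ℝ a h := (abs_le.1 (abs_real_inner_le_norm a h)).1
    have hah : ‖a‖ ≤ ‖h‖ := by
      refine abs_le_of_sq_le_sq' ?_ hhn.le |>.2
      linarith
    have hsq : 0 < Real.sqrt s := Real.sqrt_pos.2 hs0
    have hasq : ‖a‖ ≤ Real.sqrt s := Real.le_sqrt_of_sq_le (by linarith)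
    have e1 : s ^ (p / 2 - 1) * Real.sqrt s = s ^ ((p - 1) / 2) := by
      rw [Real.sqrt_eq_rpow, ← Real.rpow_add hs0]
      congr 1
      ring
    have e2 : s ^ ((p - 1) / 2) ≤ (‖h‖ ^ 2) ^ ((p - 1) / 2) :=
      Real.rpow_le_rpow hs0.le hle (by linarith)
    have e3 : (‖h‖ ^ 2) ^ ((p - 1) / 2) * ‖h‖ = ‖h‖ ^ p := by
      rw [← Real.rpow_natCast, ← Real.rpow_mul hhn.le, ← Real.rpow_add_one hhn.ne']
      congr 1
      push_cast
      ring
    have hb : s ^ (p / 2 - 1) * (‖a‖ * ‖h‖) ≤ ‖h‖ ^ p := by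
      calc s ^ (p / 2 - 1) * (‖a‖ * ‖h‖) ≤ s ^ (p / 2 - 1) * (Real.sqrt s * ‖h‖) := by gcongr
        _ = s ^ ((p - 1) / 2) * ‖h‖ := by rw [← e1]; ring
        _ ≤ (‖h‖ ^ 2) ^ ((p - 1) / 2) * ‖h‖ := by gcongr
        _ = ‖h‖ ^ p := e3
    have hd : -(2 * ‖h‖ ^ p) ≤ p * s ^ (p / 2 - 1) * inner ℝ a h := by
      have : p * (s ^ (p / 2 - 1) * -(‖a‖ * ‖h‖)) ≤ p * (s ^ (p / 2 - 1) * inner ℝ a h) := by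
        gcongr
      nlinarith
    have hm : (κ + ‖a + h‖ ^ 2) ^ (p / 2) ≤ s ^ (p / 2) + 3 * ‖h‖ ^ p := by
      have h1 : κ + ‖a + h‖ ^ 2 ≤ s + 3 * ‖h‖ ^ 2 := by
        have h4 := norm_add_le a h
        have h5 : ‖a + h‖ ^ 2 ≤ (‖a‖ + ‖h‖) ^ 2 := by gcongr
        nlinarith
      have h6 : (3 : ℝ) ^ (p / 2) ≤ 3 ^ (1 : ℝ) :=
        Real.rpow_le_rpow_of_exponent_le (by norm_num) (by linarith)
      rw [Real.rpow_one] at h6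
      calc (κ + ‖a + h‖ ^ 2) ^ (p / 2) ≤ (s + 3 * ‖h‖ ^ 2) ^ (p / 2) :=
            Real.rpow_le_rpow (by positivity) h1 (by linarith)
        _ ≤ s ^ (p / 2) + (3 * ‖h‖ ^ 2) ^ (p / 2) :=
            Real.rpow_add_le_add_rpow hs0.le (by positivity) (by linarith) (by linarith)
        _ = s ^ (p / 2) + 3 ^ (p / 2) * ‖h‖ ^ p := by
            rw [Real.mul_rpow (by norm_num) (by positivity), hpow]
        _ ≤ s ^ (p / 2) + 3 * ‖h‖ ^ p := by gcongr
    linarith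

theorem norm_fderiv_psiK_mul_norm_le {p κ : ℝ} (hp0 : 0 ≤ p) (hp2 : p ≤ 2) (hκ : 0 < κ)
    (a : Euc d) :
    ‖fderiv ℝ (psiK p κ) a‖ * ‖a‖ ≤ 2 * (psiK p κ a + κ ^ (p / 2)) := by
  have hs0 : 0 < κ + ‖a‖ ^ 2 := by positivity
  rw [(hasFDerivAt_psiK p hκ a).fderiv, norm_smul, innerSL_apply_norm, psiK, sub_add_cancel,
    Real.norm_of_nonneg (by positivity)]
  have h1 : (κ + ‖a‖ ^ 2) ^ (p / 2 - 1) * (κ + ‖a‖ ^ 2) = (κ + ‖a‖ ^ 2) ^ (p / 2) := by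
    rw [Real.rpow_sub_one hs0.ne']
    field_simp
  have h2 : 0 < (κ + ‖a‖ ^ 2) ^ (p / 2 - 1) := by positivity
  calc p * (κ + ‖a‖ ^ 2) ^ (p / 2 - 1) * ‖a‖ * ‖a‖
      = p * ((κ + ‖a‖ ^ 2) ^ (p / 2 - 1) * ‖a‖ ^ 2) := by ring
    _ ≤ 2 * ((κ + ‖a‖ ^ 2) ^ (p / 2 - 1) * (κ + ‖a‖ ^ 2)) := by
        gcongr
        linarith
    _ = 2 * (κ + ‖a‖ ^ 2) ^ (p / 2) := by rw [h1]

theorem psiK_nonneg {p κ : ℝ} (hp : 0 ≤ p) (hκ : 0 ≤ κ) (x : Euc d) : 0 ≤ psiK p κ x :=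
  sub_nonneg.2 (Real.rpow_le_rpow hκ (by nlinarith [norm_nonneg x]) (by linarith))

theorem exists_doubling_max {O : Set (Euc d)} (hO : Bornology.IsBounded O) {p : ℝ} (hp1 : 1 ≤ p)
    (hp2 : p ≤ 2) {u v : Euc d → ℝ} (hu : IsBUC u) (hv : IsBUC v) (hbc : ∀ x ∉ O, u x ≤ v x)
    {m : ℝ} (hm : 0 < m) {x₀ : Euc d} (hx₀ : u x₀ - v x₀ = m) (hmax : ∀ x, u x - v x ≤ m)
    {τ : ℝ} (hτ : 0 < τ) :
    ∃ (ψ : Euc d → ℝ) (x y : Euc d) (K C : ℝ), ContDiff ℝ 2 ψ ∧ x ∈ O ∧ y ∈ O ∧ 0 ≤ K ∧ 0 ≤ C ∧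
      (∀ x' y', u x' - v y' - ψ (x' - y') ≤ u x - v y - ψ (x - y)) ∧
      (∀ h, ψ (x - y + h) - ψ (x - y) - fderiv ℝ ψ (x - y) h ≤ K * ‖h‖ ^ p) ∧
      (∀ h, ψ (x - y + h) - ψ (x - y) - fderiv ℝ ψ (x - y) h ≤ C * ‖h‖ ^ 2) ∧
      K * ‖x - y‖ ^ p ≤ τ ∧ ‖fderiv ℝ ψ (x - y)‖ * ‖x - y‖ ≤ τ ∧ ‖x - y‖ ≤ τ ∧
      m ≤ u x - v y := by
  obtain ⟨⟨M₁, hM₁⟩, huc⟩ := hu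
  obtain ⟨⟨M₂, hM₂⟩, hvc⟩ := hv
  have hp0 : 0 < p := by linarith
  have hM₁0 : 0 ≤ M₁ := (abs_nonneg _).trans (hM₁ 0)
  have hM₂0 : 0 ≤ M₂ := (abs_nonneg _).trans (hM₂ 0)
  obtain ⟨τ', hτ'0, hτ'τ, hτ'm⟩ : ∃ τ' : ℝ, 0 < τ' ∧ 12 * τ' ≤ τ ∧ τ' < m :=
    ⟨min (τ / 12) (m / 2), by positivity, by linarith [min_le_left (τ / 12) (m / 2)],
      by linarith [min_le_right (τ / 12) (m / 2)]⟩
  obtain ⟨ρ₁, hρ₁, huρ⟩ := Metric.uniformContinuous_iff.1 huc τ' hτ'0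
  obtain ⟨ρ₂, hρ₂, hvρ⟩ := Metric.uniformContinuous_iff.1 hvc τ' hτ'0
  obtain ⟨ρ, hρ0, hρτ, hρu, hρv⟩ : ∃ ρ : ℝ, 0 < ρ ∧ ρ ≤ τ ∧ ρ ≤ ρ₁ ∧ ρ ≤ ρ₂ :=
    ⟨min τ (min ρ₁ ρ₂), by positivity, min_le_left _ _,
      (min_le_right _ _).trans (min_le_left _ _), (min_le_right _ _).trans (min_le_right _ _)⟩
  have hρp : 0 < ρ ^ p := Real.rpow_pos_of_pos hρ0 p
  set ε : ℝ := ρ ^ p / (2 * (M₁ + M₂ + 1)) with hε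
  have hε0 : 0 < ε := by positivity
  obtain ⟨s, hs0, hsρ, hsε⟩ : ∃ s : ℝ, 0 < s ∧ s ≤ ρ ^ p / 2 ∧ s ≤ ε * τ' :=
    ⟨min (ρ ^ p / 2) (ε * τ'), by positivity, min_le_left _ _, min_le_right _ _⟩
  obtain ⟨κ, hκ0, hκs⟩ : ∃ κ : ℝ, 0 < κ ∧ κ ^ (p / 2) = s := by
    refine ⟨s ^ (2 / p), Real.rpow_pos_of_pos hs0 _, ?_⟩
    rw [← Real.rpow_mul hs0.le, show 2 / p * (p / 2) = 1 by field_simp, Real.rpow_one]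
  set ψ : Euc d → ℝ := fun z => ε⁻¹ * psiK p κ z with hψ
  have hψ0 : ∀ z, 0 ≤ ψ z := fun z => mul_nonneg (by positivity) (psiK_nonneg hp0.le hκ0.le z)
  have hψd : ∀ z h, fderiv ℝ ψ z h = ε⁻¹ * fderiv ℝ (psiK p κ) z h := by
    intro z h
    rw [hψ, fderiv_const_mul (hasFDerivAt_psiK p hκ0 z).differentiableAt]
    rfl
  have hfar : ∀ z, ρ ≤ ‖z‖ → M₁ + M₂ + 1 ≤ ψ z := by
    intro z hz
    have h1 := norm_rpow_le_psiK_add hp0.le hκ0.le z (p := p)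
    have h2 : ρ ^ p ≤ ‖z‖ ^ p := Real.rpow_le_rpow hρ0.le hz hp0.le
    simp only [hψ]
    rw [← div_eq_inv_mul, le_div_iff₀ hε0, hε]
    field_simp
    linarith
  have hneg : ∀ x' y', ρ ≤ ‖x' - y'‖ → u x' - v y' - ψ (x' - y') < m := by
    intro x' y' h
    linarith [hfar _ h, (abs_le.1 (hM₁ x')).2, (abs_le.1 (hM₂ y')).1]
  have hout : ∀ x' y', (x' ∉ O ∨ y' ∉ O) → u x' - v y' - ψ (x' - y') < m := by
    intro x' y' h
    rcases le_or_gt ρ ‖x' - y'‖ with hle | hlt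
    · exact hneg _ _ hle
    · rcases h with h | h
      · have h2 := hvρ (a := x') (b := y') (by rw [dist_eq_norm]; linarith)
        rw [Real.dist_eq] at h2
        linarith [hbc x' h, (abs_lt.1 h2).2, hψ0 (x' - y')]
      · have h2 := huρ (a := x') (b := y') (by rw [dist_eq_norm]; linarith)
        rw [Real.dist_eq] at h2
        linarith [hbc y' h, (abs_lt.1 h2).2, hψ0 (x' - y')]
  have hψC : ContDiff ℝ 2 ψ := contDiff_const.mul (contDiff_psiK p hκ0)
  have hx₀O : x₀ ∈ O := by
    by_contra h
    linarith [hbc x₀ h]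
  have hval₀ : u x₀ - v x₀ - ψ (x₀ - x₀) = m := by
    simp [hψ, psiK_zero, hx₀]
  have hcomp : IsCompact (closure O ×ˢ closure O) := hO.isCompact_closure.prod hO.isCompact_closure
  have hcont : Continuous fun q : Euc d × Euc d => u q.1 - v q.2 - ψ (q.1 - q.2) :=
    ((huc.continuous.comp continuous_fst).sub (hvc.continuous.comp continuous_snd)).sub
      (hψC.continuous.comp (continuous_fst.sub continuous_snd))
  obtain ⟨⟨x, y⟩, -, hxy⟩ := hcomp.exists_isMaxOn
    ⟨(x₀, x₀), subset_closure hx₀O, subset_closure hx₀O⟩ hcont.continuousOn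
  have hvalm : m ≤ u x - v y - ψ (x - y) := by
    rw [← hval₀]
    exact hxy (show (x₀, x₀) ∈ closure O ×ˢ closure O from
      ⟨subset_closure hx₀O, subset_closure hx₀O⟩)
  have hglob : ∀ x' y', u x' - v y' - ψ (x' - y') ≤ u x - v y - ψ (x - y) := by
    intro x' y'
    by_cases h : x' ∈ O ∧ y' ∈ O
    · exact hxy (show (x', y') ∈ closure O ×ˢ closure O from
        ⟨subset_closure h.1, subset_closure h.2⟩)
    · exact ((hout x' y' (by tauto)).le).trans hvalm
  have hxO : x ∈ O := by
    by_contra h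
    exact absurd (hout x y (Or.inl h)) (not_lt.2 hvalm)
  have hyO : y ∈ O := by
    by_contra h
    exact absurd (hout x y (Or.inr h)) (not_lt.2 hvalm)
  have hclose : ‖x - y‖ < ρ := by
    by_contra h
    exact absurd (hneg x y (not_lt.1 h)) (not_lt.2 hvalm)
  have hψa : ψ (x - y) ≤ τ' := by
    have h2 := hvρ (a := x) (b := y) (by rw [dist_eq_norm]; linarith)
    rw [Real.dist_eq] at h2
    linarith [(abs_lt.1 h2).2, hmax x]
  have hT : psiK p κ (x - y) + κ ^ (p / 2) ≤ ε * (2 * τ') := by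
    simp only [hψ] at hψa
    rw [← div_eq_inv_mul, div_le_iff₀ hε0] at hψa
    rw [hκs]
    linarith
  refine ⟨ψ, x, y, ε⁻¹ * 6, ε⁻¹ * (p / 2 * (κ + ‖x - y‖ ^ 2) ^ (p / 2 - 1)), hψC, hxO, hyO,
    by positivity, by positivity, hglob, ?_, ?_, ?_, ?_, by linarith, by linarith [hψ0 (x - y)]⟩
  · intro h
    rw [hψd, hψ]
    have := mul_le_mul_of_nonneg_left (psiK_taylor_rpow hp1 hp2 hκ0 (x - y) h)
      (inv_pos.2 hε0).le
    linarith
  · intro h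
    rw [hψd, hψ]
    have := mul_le_mul_of_nonneg_left (psiK_taylor_quadratic hp0.le hp2 hκ0 (x - y) h)
      (inv_pos.2 hε0).le
    linarith
  · have h1 := (norm_rpow_le_psiK_add hp0.le hκ0.le (x - y) (p := p)).trans hT
    calc ε⁻¹ * 6 * ‖x - y‖ ^ p ≤ ε⁻¹ * 6 * (ε * (2 * τ')) := by gcongr
      _ = 12 * τ' := by field_simp; ring
      _ ≤ τ := hτ'τ
  · have h1 := norm_fderiv_psiK_mul_norm_le hp0.le hp2 hκ0 (x - y)
    have h2 : ‖fderiv ℝ ψ (x - y)‖ = ε⁻¹ * ‖fderiv ℝ (psiK p κ) (x - y)‖ := by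
      rw [hψ, fderiv_const_mul (hasFDerivAt_psiK p hκ0 _).differentiableAt, norm_smul,
        Real.norm_of_nonneg (inv_pos.2 hε0).le]
    rw [h2, mul_assoc]
    calc ε⁻¹ * (‖fderiv ℝ (psiK p κ) (x - y)‖ * ‖x - y‖) ≤ ε⁻¹ * (2 * (ε * (2 * τ'))) :=
          mul_le_mul_of_nonneg_left (by linarith) (inv_pos.2 hε0).le
      _ = 4 * τ' := by field_simp; ring
      _ ≤ τ := by linarith

theorem lintegral_le_lintegral_add_of_dTV {X : Type*} [MeasurableSpace X] {μ ν : Measure X}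
    {D : ℝ≥0∞} (h : dTV μ ν ≤ D) {k : X → ℝ} (hk : Measurable k) {K : ℝ} (hk0 : ∀ x, 0 ≤ k x)
    (hkK : ∀ x, k x ≤ K) :
    ∫⁻ x, ENNReal.ofReal (k x) ∂μ ≤ ∫⁻ x, ENNReal.ofReal (k x) ∂ν + D * ENNReal.ofReal K := by
  have hset : ∀ s, MeasurableSet s → μ s ≤ ν s + D := by
    intro s hs
    have h1 : μ s - ν s ≤ D := by
      refine le_trans ?_ h
      refine le_trans ?_ le_self_add
      exact le_iSup₂ (f := fun (s : Set X) (_ : MeasurableSet s) => μ s - ν s) s hs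
    exact tsub_le_iff_left.1 h1
  rw [lintegral_eq_lintegral_meas_lt μ (ae_of_all _ hk0) hk.aemeasurable,
    lintegral_eq_lintegral_meas_lt ν (ae_of_all _ hk0) hk.aemeasurable]
  have hle : ∀ t : ℝ, μ {a | t < k a} ≤ ν {a | t < k a} + (Iio K).indicator (fun _ => D) t := by
    intro t
    by_cases ht : t < K
    · rw [indicator_of_mem (show t ∈ Iio K from ht)]
      exact hset _ (measurableSet_lt measurable_const hk)
    · have : {a | t < k a} = ∅ := by
        ext a
        simp only [mem_ofPred_eq, mem_empty_iff_false, iff_false, not_lt]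
        exact (hkK a).trans (not_lt.1 ht)
      simp [this]
  calc ∫⁻ t in Ioi 0, μ {a | t < k a}
      ≤ ∫⁻ t in Ioi 0, (ν {a | t < k a} + (Iio K).indicator (fun _ => D) t) :=
        lintegral_mono fun t => hle t
    _ = (∫⁻ t in Ioi 0, ν {a | t < k a}) + ∫⁻ t in Ioi 0, (Iio K).indicator (fun _ => D) t :=
        lintegral_add_right _ (measurable_const.indicator measurableSet_Iio)
    _ = (∫⁻ t in Ioi 0, ν {a | t < k a}) + D * ENNReal.ofReal K := by
        rw [lintegral_indicator_const measurableSet_Iio, Measure.restrict_apply measurableSet_Iio,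
          inter_comm, Ioi_inter_Iio, Real.volume_Ioo, sub_zero]

theorem dTV_comm {X : Type*} [MeasurableSpace X] (μ ν : Measure X) : dTV μ ν = dTV ν μ :=
  add_comm _ _

theorem integrable_of_abs_le {X : Type*} [MeasurableSpace X] {μ : Measure X} [IsFiniteMeasure μ]
    {k : X → ℝ} (hk : Measurable k) {K : ℝ} (hb : ∀ x, |k x| ≤ K) : Integrable k μ :=
  (integrable_const K).mono' hk.aestronglyMeasurable (ae_of_all _ hb)

theorem integral_le_integral_add_of_dTV {X : Type*} [MeasurableSpace X] {μ ν : Measure X}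
    [IsFiniteMeasure μ] [IsFiniteMeasure ν] {D K : ℝ} (hD : 0 ≤ D) (hK : 0 ≤ K)
    (h : dTV μ ν ≤ ENNReal.ofReal D) {k : X → ℝ} (hk : Measurable k) (hb : ∀ x, |k x| ≤ K) :
    ∫ x, k x ∂μ ≤ ∫ x, k x ∂ν + 2 * (K * D) := by
  have key : ∀ {μ ν : Measure X} [IsFiniteMeasure μ] [IsFiniteMeasure ν] {k : X → ℝ},
      dTV μ ν ≤ ENNReal.ofReal D → Measurable k → (∀ x, 0 ≤ k x) → (∀ x, k x ≤ K) →
      ∫ x, k x ∂μ ≤ ∫ x, k x ∂ν + K * D := by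
    intro μ ν _ _ k h hk h0 hK'
    have h1 := lintegral_le_lintegral_add_of_dTV h hk h0 hK'
    have hi : ∀ ρ : Measure X, [IsFiniteMeasure ρ] → Integrable k ρ := fun ρ _ =>
      integrable_of_abs_le hk fun x => by rw [abs_of_nonneg (h0 x)]; exact hK' x
    rw [← ofReal_integral_eq_lintegral_ofReal (hi μ) (ae_of_all _ h0),
      ← ofReal_integral_eq_lintegral_ofReal (hi ν) (ae_of_all _ h0),
      ← ENNReal.ofReal_mul hD, ← ENNReal.ofReal_add (integral_nonneg h0) (by positivity)] at h1
    rw [mul_comm K D]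
    exact (ENNReal.ofReal_le_ofReal_iff (add_nonneg (integral_nonneg h0) (by positivity))).1 h1
  have hpos := key (k := fun x => max (k x) 0) h (hk.max measurable_const)
    (fun x => le_max_right _ _) (fun x => max_le ((le_abs_self _).trans (hb x)) hK)
  have hneg := key (k := fun x => max (-k x) 0) (by rwa [dTV_comm] : dTV ν μ ≤ _)
    (hk.neg.max measurable_const)
    (fun x => le_max_right _ _) (fun x => max_le ((neg_le_abs _).trans (hb x)) hK)
  have hsplit : ∀ ρ : Measure X, [IsFiniteMeasure ρ] →
      ∫ x, k x ∂ρ = ∫ x, max (k x) 0 ∂ρ - ∫ x, max (-k x) 0 ∂ρ := by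
    intro ρ _
    have hi := integrable_of_abs_le (μ := ρ) hk hb
    rw [← integral_sub hi.pos_part hi.neg_part]
    congr 1
    ext x
    rcases le_total 0 (k x) with h | h
    · simp [h]
    · simp [h]
  rw [hsplit μ, hsplit ν]
  linarith

theorem integral_le_integral_add_of_weighted_dTV {μ ν : Measure (Euc d)}
    [IsFiniteMeasure μ] [IsFiniteMeasure ν] (hμ : μ (ball (0 : Euc d) 1)ᶜ = 0)
    (hν : ν (ball (0 : Euc d) 1)ᶜ = 0) {D L η K : ℝ} (hD : 0 ≤ D) (hη : 0 < η) (hK : 0 ≤ K)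
    (hL : 0 ≤ L)
    (h : dTV (μ.withDensity (fun z => ENNReal.ofReal ‖z‖))
      (ν.withDensity (fun z => ENNReal.ofReal ‖z‖)) ≤ ENNReal.ofReal D)
    (hμL : μ (ball (0 : Euc d) 1) ≤ ENNReal.ofReal L)
    (hνL : ν (ball (0 : Euc d) 1) ≤ ENNReal.ofReal L)
    {k : Euc d → ℝ} (hk : Measurable k) (hb : ∀ z, |k z| ≤ η + K * ‖z‖) :
    ∫ z, k z ∂μ ≤ ∫ z, k z ∂ν + 2 * (η * L) + 2 * (K * D) := by
  have hden : ∀ z : Euc d, 0 < η + K * ‖z‖ := fun z => by positivity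
  set k₁ : Euc d → ℝ := fun z => k z * (η / (η + K * ‖z‖)) with hk₁
  set k₂ : Euc d → ℝ := fun z => k z * (K / (η + K * ‖z‖)) with hk₂
  have hk₁m : Measurable k₁ := by fun_prop
  have hk₂m : Measurable k₂ := by fun_prop
  have hk₁b : ∀ z, |k₁ z| ≤ η := by
    intro z
    rw [hk₁, abs_mul, abs_of_nonneg (div_nonneg hη.le (hden z).le), ← mul_div_assoc,
      div_le_iff₀ (hden z), mul_comm η]
    exact mul_le_mul_of_nonneg_right (hb z) hη.le
  have hk₂b : ∀ z, |k₂ z| ≤ K := by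
    intro z
    rw [hk₂, abs_mul, abs_of_nonneg (div_nonneg hK (hden z).le), ← mul_div_assoc,
      div_le_iff₀ (hden z), mul_comm K]
    exact mul_le_mul_of_nonneg_right (hb z) hK
  have hsum : ∀ z, k z = k₁ z + ‖z‖ * k₂ z := by
    intro z
    have := (hden z).ne'
    simp only [hk₁, hk₂]
    field_simp
  have hae : ∀ {ρ : Measure (Euc d)}, ρ (ball (0 : Euc d) 1)ᶜ = 0 → ∀ᵐ z ∂ρ, ‖z‖ < 1 := by
    intro ρ hρ
    have h1 : ∀ᵐ z ∂ρ, z ∈ ball (0 : Euc d) 1 := measure_eq_zero_iff_ae_notMem.1 hρ |>.mono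
      fun z hz => by simpa using hz
    exact h1.mono fun z hz => by simpa using hz
  have hfin : ∀ {ρ : Measure (Euc d)} [IsFiniteMeasure ρ], ρ (ball (0 : Euc d) 1)ᶜ = 0 →
      IsFiniteMeasure (ρ.withDensity (fun z => ENNReal.ofReal ‖z‖)) := by
    intro ρ _ hρ
    refine isFiniteMeasure_withDensity (ne_of_lt ?_)
    calc ∫⁻ z, ENNReal.ofReal ‖z‖ ∂ρ ≤ ∫⁻ _, 1 ∂ρ :=
          lintegral_mono_ae ((hae hρ).mono fun z hz => by
            rw [← ENNReal.ofReal_one]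
            exact ENNReal.ofReal_le_ofReal hz.le)
      _ < ⊤ := by simp [measure_lt_top]
  have hball : ∀ {ρ : Measure (Euc d)} [IsFiniteMeasure ρ], ρ (ball (0 : Euc d) 1)ᶜ = 0 →
      ∫ z, k z ∂ρ = ∫ z, k₁ z ∂ρ +
        ∫ z, k₂ z ∂(ρ.withDensity (fun z => ENNReal.ofReal ‖z‖)) := by
    intro ρ _ hρ
    have hi₂ : Integrable (fun z => ‖z‖ * k₂ z) ρ := by
      refine (integrable_const K).mono' (by fun_prop) ((hae hρ).mono fun z hz => ?_)
      rw [norm_mul, norm_norm]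
      exact (mul_le_of_le_one_left (norm_nonneg _) hz.le).trans (hk₂b z)
    rw [integral_congr_ae (ae_of_all _ hsum), integral_add (integrable_of_abs_le hk₁m hk₁b) hi₂,
      integral_withDensity_eq_integral_toReal_smul (by fun_prop) (by simp)]
    simp
  have hmass : ∀ {ρ : Measure (Euc d)} [IsFiniteMeasure ρ], ρ (ball (0 : Euc d) 1)ᶜ = 0 →
      ρ (ball (0 : Euc d) 1) ≤ ENNReal.ofReal L → |∫ z, k₁ z ∂ρ| ≤ η * L := by
    intro ρ _ hρ hρL
    have h1 : ‖∫ z, k₁ z ∂ρ‖ ≤ η * ρ.real univ :=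
      norm_integral_le_of_norm_le_const (ae_of_all _ hk₁b)
    refine h1.trans (mul_le_mul_of_nonneg_left ?_ hη.le)
    have h2 : ρ univ ≤ ENNReal.ofReal L := by
      rw [← union_compl_self (ball (0 : Euc d) 1)]
      exact (measure_union_le _ _).trans (by rw [hρ, add_zero]; exact hρL)
    exact ENNReal.toReal_le_of_le_ofReal hL h2
  have := hfin hμ
  have := hfin hν
  have hk₂le := integral_le_integral_add_of_dTV hD hK h hk₂m hk₂b
  rw [hball hμ, hball hν]
  have h1 := (abs_le.1 (hmass hμ hμL)).2
  have h2 := (abs_le.1 (hmass hν hνL)).1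
  linarith

theorem integral_sub_integral_le_of_admPlan {p : ℝ} {μ ν : Measure (Euc d)}
    {γ : Measure (Euc d × Euc d)} (hγ : γ ∈ AdmPlan μ ν) {J : ℝ} (hJ0 : 0 ≤ J)
    (hJ : Jp p γ ≤ ENNReal.ofReal J) {G H E : Euc d → ℝ} {K : ℝ} (hK : 0 ≤ K)
    (hG0 : G 0 = 0) (hH0 : H 0 = 0) (hE0 : E 0 = 0) (hGm : Measurable G) (hHm : Measurable H)
    (hEm : Measurable E)
    (hG : Integrable G μ) (hH : Integrable H ν) (hEμ : Integrable E μ) (hEν : Integrable E ν)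
    (hle : ∀ z w, G z - H w ≤ K * ‖z - w‖ ^ p + E z + E w) :
    ∫ z, G z ∂μ - ∫ w, H w ∂ν ≤ K * J + ∫ z, E z ∂μ + ∫ w, E w ∂ν := by
  obtain ⟨-, h1, h2⟩ := hγ
  have hs : MeasurableSet ({0}ᶜ : Set (Euc d)) := (measurableSet_singleton 0).compl
  have key : ∀ (T : Euc d × Euc d → Euc d), Measurable T → ∀ {ρ : Measure (Euc d)},
      (γ.map T).restrict {(0 : Euc d)}ᶜ = ρ → ∀ {F : Euc d → ℝ}, F 0 = 0 → Measurable F →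
      Integrable F ρ → Integrable (fun q => F (T q)) γ ∧ ∫ q, F (T q) ∂γ = ∫ z, F z ∂ρ := by
    intro T hT ρ hρ F hF0 hFm hF
    have hsup : Function.support F ⊆ ({0}ᶜ : Set (Euc d)) := by
      intro z hz h0
      rw [mem_singleton_iff] at h0
      exact hz (by rw [h0, hF0])
    have hi : Integrable F (γ.map T) := by
      rw [← integrableOn_iff_integrable_of_support_subset hsup, IntegrableOn, hρ]
      exact hF
    refine ⟨(integrable_map_measure hFm.aestronglyMeasurable hT.aemeasurable).1 hi, ?_⟩
    rw [← integral_map hT.aemeasurable hFm.aestronglyMeasurable, ← hρ,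
      setIntegral_eq_integral_of_forall_compl_eq_zero]
    intro z hz
    have : z = 0 := by simpa using hz
    rw [this, hF0]
  obtain ⟨iG, eG⟩ := key _ measurable_fst h1 hG0 hGm hG
  obtain ⟨iH, eH⟩ := key _ measurable_snd h2 hH0 hHm hH
  obtain ⟨iE₁, eE₁⟩ := key _ measurable_fst h1 hE0 hEm hEμ
  obtain ⟨iE₂, eE₂⟩ := key _ measurable_snd h2 hE0 hEm hEν
  have hcm : Measurable fun q : Euc d × Euc d => ‖q.1 - q.2‖ ^ p := by fun_prop
  have hc0 : ∀ q : Euc d × Euc d, 0 ≤ ‖q.1 - q.2‖ ^ p := fun q => by positivity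
  have ic : Integrable (fun q : Euc d × Euc d => ‖q.1 - q.2‖ ^ p) γ := by
    refine ⟨hcm.aestronglyMeasurable, ?_⟩
    rw [hasFiniteIntegral_iff_ofReal (ae_of_all _ hc0)]
    exact hJ.trans_lt ENNReal.ofReal_lt_top
  have ec : ∫ q, ‖q.1 - q.2‖ ^ p ∂γ ≤ J := by
    rw [integral_eq_lintegral_of_nonneg_ae (ae_of_all _ hc0) hcm.aestronglyMeasurable]
    exact ENNReal.toReal_le_of_le_ofReal hJ0 hJ
  rw [← eG, ← eH, ← eE₁, ← eE₂, ← integral_sub iG iH]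
  calc ∫ q, (G q.1 - H q.2) ∂γ ≤ ∫ q, (K * ‖q.1 - q.2‖ ^ p + E q.1 + E q.2) ∂γ :=
        integral_mono (iG.sub iH) (((ic.const_mul K).add iE₁).add iE₂) fun q => hle q.1 q.2
    _ = ∫ q, (K * ‖q.1 - q.2‖ ^ p + E q.1) ∂γ + ∫ q, E q.2 ∂γ :=
        integral_add ((ic.const_mul K).add iE₁) iE₂
    _ = K * ∫ q, ‖q.1 - q.2‖ ^ p ∂γ + ∫ q, E q.1 ∂γ + ∫ q, E q.2 ∂γ := by
        rw [integral_add (ic.const_mul K) iE₁, integral_const_mul]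
    _ ≤ _ := by gcongr

theorem exists_levy_integrand_bound {φ : Euc d → ℝ} (hφ : ContDiff ℝ 2 φ)
    (hb : ∃ M, ∀ x, |φ x| ≤ M) {p : ℝ} (hp0 : 0 < p) (hp2 : p ≤ 2) (x : Euc d) :
    ∃ C : ℝ, 0 ≤ C ∧ ∀ z, |φ (x + z) - φ x -
      (ball (0 : Euc d) 1).indicator (fun w => fderiv ℝ φ x w) z| ≤ C * min 1 (‖z‖ ^ p) := by
  obtain ⟨M, hM⟩ := hb
  have hM0 : 0 ≤ M := (abs_nonneg _).trans (hM 0)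
  have hd : ContDiff ℝ 1 (fderiv ℝ φ) := hφ.fderiv_right (by norm_num)
  obtain ⟨K, t, ht, hK⟩ := hd.contDiffAt (x := x) |>.exists_lipschitzOnWith
  obtain ⟨ρ', hρ'0, hρ't⟩ := Metric.mem_nhds_iff.1 ht
  obtain ⟨ρ, hρ0, hρ1, hρρ'⟩ : ∃ ρ : ℝ, 0 < ρ ∧ ρ ≤ 1 ∧ ρ ≤ ρ' :=
    ⟨min 1 ρ', by positivity, min_le_left _ _, min_le_right _ _⟩
  have hρp : 0 < ρ ^ p := Real.rpow_pos_of_pos hρ0 p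
  set N := 2 * M + ‖fderiv ℝ φ x‖ with hN
  have hN0 : 0 ≤ N := by positivity
  refine ⟨K + N / ρ ^ p, by positivity, fun z => ?_⟩
  have hm0 : 0 ≤ min 1 (‖z‖ ^ p) := le_min zero_le_one (by positivity)
  rcases lt_or_ge ‖z‖ ρ with hz | hz
  · have hz1 : ‖z‖ ≤ 1 := by linarith
    rw [indicator_of_mem (by simpa using by linarith)]
    have hmv : ‖φ (x + z) - φ x - fderiv ℝ φ x (x + z - x)‖ ≤ (K * ‖z‖) * ‖x + z - x‖ := by
      refine Convex.norm_image_sub_le_of_norm_hasFDerivWithin_le' (f' := fderiv ℝ φ)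
        (s := closedBall x ‖z‖) (fun w _ => ?_) (fun w hw => ?_) (convex_closedBall x ‖z‖)
        (by simp) (by simp)
      · exact (hφ.differentiable (by norm_num) w).hasFDerivAt.hasFDerivWithinAt
      · have hwt : w ∈ t := hρ't (by
          rw [mem_ball]
          rw [mem_closedBall] at hw
          linarith)
        have := hK.dist_le_mul w hwt x (mem_of_mem_nhds ht)
        rw [← dist_eq_norm]
        refine this.trans ?_
        gcongr
        exact hw
    rw [add_sub_cancel_left, Real.norm_eq_abs] at hmv
    have hsq : ‖z‖ * ‖z‖ ≤ min 1 (‖z‖ ^ p) := by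
      refine le_min (by nlinarith [norm_nonneg z]) ?_
      rw [← sq, ← Real.rpow_natCast]
      exact Real.rpow_le_rpow_of_exponent_ge_of_imp (norm_nonneg z) hz1 (by exact_mod_cast hp2)
        (fun _ h => absurd h (by norm_num))
    calc _ ≤ (K * ‖z‖) * ‖z‖ := hmv
      _ = K * (‖z‖ * ‖z‖) := by ring
      _ ≤ K * min 1 (‖z‖ ^ p) := by gcongr
      _ ≤ (K + N / ρ ^ p) * min 1 (‖z‖ ^ p) := by
        gcongr
        linarith [div_nonneg hN0 hρp.le]
  · have hmin : ρ ^ p ≤ min 1 (‖z‖ ^ p) :=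
      le_min (Real.rpow_le_one hρ0.le hρ1 hp0.le) (Real.rpow_le_rpow hρ0.le hz hp0.le)
    have hind : |(ball (0 : Euc d) 1).indicator (fun w => fderiv ℝ φ x w) z| ≤ ‖fderiv ℝ φ x‖ := by
      by_cases hz1 : z ∈ ball (0 : Euc d) 1
      · rw [indicator_of_mem hz1, ← Real.norm_eq_abs]
        exact (ContinuousLinearMap.le_opNorm _ _).trans
          (mul_le_of_le_one_right (norm_nonneg _) (by simpa using (mem_ball_zero_iff.1 hz1).le))
      · rw [indicator_of_notMem hz1]
        simp
    have h1 : |φ (x + z) - φ x -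
        (ball (0 : Euc d) 1).indicator (fun w => fderiv ℝ φ x w) z| ≤ N := by
      refine (abs_sub _ _).trans ?_
      have h2 := (abs_sub (φ (x + z)) (φ x))
      linarith [hM (x + z), hM x]
    calc _ ≤ N := h1
      _ = N / ρ ^ p * ρ ^ p := by field_simp
      _ ≤ N / ρ ^ p * min 1 (‖z‖ ^ p) := by gcongr
      _ ≤ (K + N / ρ ^ p) * min 1 (‖z‖ ^ p) := by
        gcongr
        simp

theorem integrable_of_abs_le_mul_min {p : ℝ} {μ : Measure (Euc d)}
    (hμ : ∫⁻ z, ENNReal.ofReal (min 1 (‖z‖ ^ p)) ∂μ < ⊤) {F : Euc d → ℝ} (hF : Measurable F) {C : ℝ}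
    (hb : ∀ z, |F z| ≤ C * min 1 (‖z‖ ^ p)) : Integrable F μ := by
  have h0 : ∀ z : Euc d, 0 ≤ min 1 (‖z‖ ^ p) := fun z => le_min zero_le_one (by positivity)
  have hi : Integrable (fun z : Euc d => min 1 (‖z‖ ^ p)) μ := by
    refine ⟨Measurable.aestronglyMeasurable (by fun_prop), ?_⟩
    rw [hasFiniteIntegral_iff_ofReal (ae_of_all _ h0)]
    exact hμ
  exact (hi.const_mul C).mono' hF.aestronglyMeasurable (ae_of_all _ hb)

theorem measurable_levy_integrand {φ : Euc d → ℝ} (hφ : ContDiff ℝ 2 φ) (x : Euc d) :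
    Measurable fun z => φ (x + z) - φ x -
      (ball (0 : Euc d) 1).indicator (fun w => fderiv ℝ φ x w) z := by
  have h1 : Measurable fun z => φ (x + z) :=
    (hφ.continuous.comp (continuous_const.add continuous_id)).measurable
  have h2 : Measurable ((ball (0 : Euc d) 1).indicator (fun w => fderiv ℝ φ x w)) :=
    (fderiv ℝ φ x).continuous.measurable.indicator measurableSet_ball
  exact (h1.sub_const _).sub h2

theorem integrable_levy_integrand {φ : Euc d → ℝ} (hφ : ContDiff ℝ 2 φ)
    (hb : ∃ M, ∀ x, |φ x| ≤ M) {p : ℝ} (hp0 : 0 < p) (hp2 : p ≤ 2) (x : Euc d)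
    {μ : Measure (Euc d)} (hμ : ∫⁻ z, ENNReal.ofReal (min 1 (‖z‖ ^ p)) ∂μ < ⊤) :
    Integrable (fun z => φ (x + z) - φ x -
      (ball (0 : Euc d) 1).indicator (fun w => fderiv ℝ φ x w) z) μ := by
  obtain ⟨C, -, hC⟩ := exists_levy_integrand_bound hφ hb hp0 hp2 x
  exact integrable_of_abs_le_mul_min hμ (measurable_levy_integrand hφ x) hC

theorem exists_abs_Lop_le {φ : Euc d → ℝ} (hφ : ContDiff ℝ 2 φ)
    (hb : ∃ M, ∀ x, |φ x| ≤ M) {p : ℝ} (hp0 : 0 < p) (hp2 : p ≤ 2) (x : Euc d) {Λ : ℝ}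
    (hΛ : 0 ≤ Λ) :
    ∃ N : ℝ, ∀ μ : Measure (Euc d),
      ∫⁻ z, ENNReal.ofReal (min 1 (‖z‖ ^ p)) ∂μ ≤ ENNReal.ofReal Λ → |Lop μ φ x| ≤ N := by
  obtain ⟨C, hC0, hC⟩ := exists_levy_integrand_bound hφ hb hp0 hp2 x
  refine ⟨C * Λ, fun μ hμ => ?_⟩
  have h0 : ∀ z : Euc d, 0 ≤ min 1 (‖z‖ ^ p) := fun z => le_min zero_le_one (by positivity)
  have hi : Integrable (fun z : Euc d => min 1 (‖z‖ ^ p)) μ :=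
    integrable_of_abs_le_mul_min (C := 1) (hμ.trans_lt ENNReal.ofReal_lt_top) (by fun_prop)
      fun z => by rw [abs_of_nonneg (h0 z), one_mul]
  have h1 : ∫ z, min 1 (‖z‖ ^ p) ∂μ ≤ Λ := by
    rw [integral_eq_lintegral_of_nonneg_ae (ae_of_all _ h0) hi.aestronglyMeasurable]
    exact ENNReal.toReal_le_of_le_ofReal hΛ hμ
  calc |Lop μ φ x| ≤ ∫ z, C * min 1 (‖z‖ ^ p) ∂μ := by
        rw [Lop, ← Real.norm_eq_abs]
        exact norm_integral_le_of_norm_le (hi.const_mul C) (ae_of_all _ hC)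
    _ = C * ∫ z, min 1 (‖z‖ ^ p) ∂μ := integral_const_mul _ _
    _ ≤ C * Λ := by gcongr

theorem exists_test_function {u φ : Euc d → ℝ} (hu : IsBUC u) (hφ : ContDiff ℝ 2 φ)
    (hle : ∀ y, u y ≤ φ y) (x : Euc d) {r δ : ℝ} (hr : 0 < r) (hδ : 0 < δ) :
    ∃ Φ : Euc d → ℝ, ContDiff ℝ 2 Φ ∧ (∃ M, ∀ y, |Φ y| ≤ M) ∧ (∀ y, u y ≤ Φ y) ∧
      Φ x = φ x ∧ fderiv ℝ Φ x = fderiv ℝ φ x ∧ (∀ y, Φ y ≤ φ y + δ) ∧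
      (∀ y, ‖y - x‖ < r / 2 → Φ y = φ y) ∧ ∀ y, r ≤ ‖y - x‖ → Φ y ≤ u y + δ := by
  obtain ⟨⟨M, hM⟩, huc⟩ := hu
  obtain ⟨g, hgC, hg⟩ := huc.exists_contDiff_dist_le (half_pos hδ)
  let χ : ContDiffBump x := ⟨r / 2, r, half_pos hr, half_lt_self hr⟩
  have hg' : ∀ y, u y - δ / 2 ≤ g y ∧ g y ≤ u y + δ / 2 := by
    intro y
    have h := abs_le.1 ((Real.dist_eq _ _).symm.le.trans (hg y).le)
    constructor <;> linarith [h.1, h.2]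
  have hχ0 : ∀ y, 0 ≤ χ y := fun y => χ.nonneg
  have hχ1 : ∀ y, χ y ≤ 1 := fun y => χ.le_one
  have hχC : ContDiff ℝ 2 χ := χ.contDiff
  set Φ : Euc d → ℝ := fun y => χ y * φ y + (1 - χ y) * (g y + δ / 2) with hΦ
  have hin : ∀ y, ‖y - x‖ < r / 2 → Φ y = φ y := by
    intro y hy
    have : χ y = 1 := χ.one_of_mem_closedBall (by
      rw [mem_closedBall, dist_eq_norm]
      exact hy.le)
    simp [hΦ, this]
  have hout : ∀ y, r ≤ ‖y - x‖ → χ y = 0 := fun y hy => χ.zero_of_le_dist (by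
      rw [dist_eq_norm]
      exact hy)
  have hup : ∀ y, Φ y ≤ φ y + δ := by
    intro y
    have h1 : (1 - χ y) * (g y + δ / 2) ≤ (1 - χ y) * (φ y + δ) :=
      mul_le_mul_of_nonneg_left (by linarith [(hg' y).2, hle y]) (by linarith [hχ1 y])
    have h2 := mul_nonneg (hχ0 y) hδ.le
    simp only [hΦ]
    linarith
  have hlow : ∀ y, u y ≤ Φ y := by
    intro y
    have h1 : (1 - χ y) * u y ≤ (1 - χ y) * (g y + δ / 2) :=
      mul_le_mul_of_nonneg_left (by linarith [(hg' y).1]) (by linarith [hχ1 y])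
    have h2 := mul_le_mul_of_nonneg_left (hle y) (hχ0 y)
    simp only [hΦ]
    linarith
  refine ⟨Φ, ?_, ?_, hlow, hin x (by simpa using hr), ?_, hup, hin, ?_⟩
  · exact (hχC.mul hφ).add ((contDiff_const.sub hχC).mul
      ((contDiff_infty.1 hgC 2).add contDiff_const))
  · obtain ⟨N, hN⟩ := (isCompact_closedBall x r).exists_bound_of_continuousOn
      hφ.continuous.continuousOn
    refine ⟨M + (|N| + δ), fun y => abs_le.2 ⟨?_, ?_⟩⟩
    · linarith [hlow y, (abs_le.1 (hM y)).1, abs_nonneg N]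
    · rcases le_or_gt r ‖y - x‖ with h | h
      · simp only [hΦ, hout y h]
        linarith [(hg' y).2, (abs_le.1 (hM y)).2, abs_nonneg N]
      · have h1 := hN y (by rw [mem_closedBall, dist_eq_norm]; exact h.le)
        linarith [hup y, (le_abs_self _).trans h1, le_abs_self N, (abs_nonneg _).trans (hM y)]
  · refine Filter.EventuallyEq.fderiv_eq ?_
    filter_upwards [ball_mem_nhds x (half_pos hr)] with y hy
    exact hin y (by rwa [mem_ball, dist_eq_norm] at hy)
  · intro y hy
    simp only [hΦ, hout y hy]
    linarith [(hg' y).2]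

theorem dLpPow_lt_top {p : ℝ} {μ ν : Measure (Euc d)} (hμ0 : μ {0} = 0) (hν0 : ν {0} = 0)
    (hμ : ∫⁻ z, ENNReal.ofReal (‖z‖ ^ p) ∂μ < ⊤) (hν : ∫⁻ z, ENNReal.ofReal (‖z‖ ^ p) ∂ν < ⊤) :
    dLpPow p μ ν < ⊤ := by
  have hl : Measurable fun z : Euc d => (z, (0 : Euc d)) := by fun_prop
  have hr : Measurable fun z : Euc d => ((0 : Euc d), z) := by fun_prop
  have hs : MeasurableSet ({0}ᶜ : Set (Euc d)) := (measurableSet_singleton 0).compl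
  have hconst : ∀ ρ : Measure (Euc d),
      (ρ.map fun _ => (0 : Euc d)).restrict {(0 : Euc d)}ᶜ = 0 := by
    intro ρ
    rw [Measure.restrict_eq_zero, Measure.map_apply measurable_const hs]
    simp
  have hid : ∀ ρ : Measure (Euc d), ρ {0} = 0 → ρ.restrict {(0 : Euc d)}ᶜ = ρ := by
    intro ρ hρ
    refine Measure.restrict_eq_self_of_ae_mem ?_
    exact measure_eq_zero_iff_ae_notMem.1 hρ
  set γ : Measure (Euc d × Euc d) :=
    μ.map (fun z => (z, (0 : Euc d))) + ν.map (fun z => ((0 : Euc d), z)) with hγ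
  have hadm : γ ∈ AdmPlan μ ν := by
    refine ⟨?_, ?_, ?_⟩
    · rw [hγ, Measure.add_apply, Measure.map_apply hl (measurableSet_singleton _),
        Measure.map_apply hr (measurableSet_singleton _)]
      have h1 : (fun z : Euc d => (z, (0 : Euc d))) ⁻¹' {(0, 0)} = {0} := by
        ext z
        simp
      have h2 : (fun z : Euc d => ((0 : Euc d), z)) ⁻¹' {(0, 0)} = {0} := by
        ext z
        simp
      rw [h1, h2, hμ0, hν0, add_zero]
    · rw [hγ, Measure.map_add _ _ measurable_fst, Measure.map_map measurable_fst hl,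
        Measure.map_map measurable_fst hr, Measure.restrict_add]
      change (μ.map id).restrict _ + (ν.map fun _ => (0 : Euc d)).restrict _ = μ
      rw [Measure.map_id, hconst, hid μ hμ0, add_zero]
    · rw [hγ, Measure.map_add _ _ measurable_snd, Measure.map_map measurable_snd hl,
        Measure.map_map measurable_snd hr, Measure.restrict_add]
      change (μ.map fun _ => (0 : Euc d)).restrict _ + (ν.map id).restrict _ = ν
      rw [Measure.map_id, hconst, hid ν hν0, zero_add]
  refine (iInf₂_le γ hadm).trans_lt ?_
  rw [Jp, hγ, lintegral_add_measure, lintegral_map (by fun_prop) hl, lintegral_map (by fun_prop) hr]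
  simp only [sub_zero, zero_sub, norm_neg]
  exact ENNReal.add_lt_top.2 ⟨hμ, hν⟩

theorem exists_admPlan_of_dLp_le {p : ℝ} (hp : 0 < p) {μ ν : Measure (Euc d)}
    (hfin : dLpPow p μ ν < ⊤) {R t : ℝ} (ht : 0 < t) (h : dLp p μ ν ≤ R) :
    ∃ γ ∈ AdmPlan μ ν, Jp p γ ≤ ENNReal.ofReal (R ^ p + t) := by
  have h0 : 0 ≤ dLp p μ ν := Real.rpow_nonneg ENNReal.toReal_nonneg _
  have hR : 0 ≤ R := h0.trans h
  have h1 : (dLpPow p μ ν).toReal ≤ R ^ p := by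
    have h2 := Real.rpow_le_rpow h0 h hp.le
    rwa [dLp, ← Real.rpow_mul ENNReal.toReal_nonneg, one_div, inv_mul_cancel₀ hp.ne',
      Real.rpow_one] at h2
  have h3 : dLpPow p μ ν < ENNReal.ofReal (R ^ p + t) := by
    rw [← ENNReal.ofReal_toReal hfin.ne]
    exact (ENNReal.ofReal_lt_ofReal_iff (by positivity)).2 (by linarith)
  obtain ⟨γ, hγ⟩ := iInf_lt_iff.1 h3
  obtain ⟨hadm, hγ⟩ := iInf_lt_iff.1 hγ
  exact ⟨γ, hadm, hγ.le⟩

/-- The remainder left by replacing `C²` functions with their touching test functions: quadratic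
near the origin and a small constant away from it. -/
def levyErr (C r δ : ℝ) (z : Euc d) : ℝ :=
  (ball (0 : Euc d) (2 * r)).indicator (fun z => C * ‖z‖ ^ 2) z +
    (ball (0 : Euc d) (r / 2))ᶜ.indicator (fun _ => δ) z

theorem levyErr_of_lt {C r δ : ℝ} {z : Euc d} (h : ‖z‖ < 2 * r) :
    levyErr C r δ z = C * ‖z‖ ^ 2 + (ball (0 : Euc d) (r / 2))ᶜ.indicator (fun _ => δ) z := by
  rw [levyErr, indicator_of_mem (by simpa using h)]

theorem le_levyErr {C r δ : ℝ} (hC : 0 ≤ C) {z : Euc d} (h : r / 2 ≤ ‖z‖) :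
    δ ≤ levyErr C r δ z := by
  rw [levyErr, indicator_of_mem (s := (ball (0 : Euc d) (r / 2))ᶜ) (by simpa using h)]
  have : 0 ≤ (ball (0 : Euc d) (2 * r)).indicator (fun z => C * ‖z‖ ^ 2) z :=
    indicator_nonneg (fun z _ => by positivity) z
  linarith

theorem levyErr_nonneg {C r δ : ℝ} (hC : 0 ≤ C) (hδ : 0 ≤ δ) (z : Euc d) :
    0 ≤ levyErr C r δ z :=
  add_nonneg (indicator_nonneg (fun z _ => by positivity) z) (indicator_nonneg (fun _ _ => hδ) z)

theorem levyErr_zero {C r δ : ℝ} (hr : 0 < r) : levyErr C r δ (0 : Euc d) = 0 := by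
  rw [levyErr_of_lt (by simpa using hr), indicator_of_notMem (by simpa using hr)]
  simp

theorem measurable_levyErr (C r δ : ℝ) : Measurable (levyErr C r δ : Euc d → ℝ) := by
  unfold levyErr
  exact (Measurable.indicator (by fun_prop) measurableSet_ball).add
    (measurable_const.indicator measurableSet_ball.compl)

theorem sub_le_of_doubling {p K C r δ : ℝ} (hp0 : 0 < p) (hp2 : p ≤ 2) (hK : 0 ≤ K)
    (hC : 0 ≤ C) (hr : 0 < r) {g h G H : Euc d → ℝ} (hg0 : g 0 = 0) (hh0 : h 0 = 0)
    (hgh : ∀ z w, g z - h w ≤ K * ‖z - w‖ ^ p)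
    (hG₁ : ∀ z, G z ≤ C * ‖z‖ ^ 2 + δ) (hG₂ : ∀ z, ‖z‖ < r / 2 → G z ≤ C * ‖z‖ ^ 2)
    (hG₃ : ∀ z, r ≤ ‖z‖ → G z ≤ g z + δ)
    (hH₁ : ∀ w, -H w ≤ C * ‖w‖ ^ 2 + δ) (hH₂ : ∀ w, ‖w‖ < r / 2 → -H w ≤ C * ‖w‖ ^ 2)
    (hH₃ : ∀ w, r ≤ ‖w‖ → h w - δ ≤ H w) (z w : Euc d) :
    G z - H w ≤ 4 * K * ‖z - w‖ ^ p + levyErr C r δ z + levyErr C r δ w := by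
  have near : ∀ {F : Euc d → ℝ} (_ : ∀ z, F z ≤ C * ‖z‖ ^ 2 + δ)
      (_ : ∀ z, ‖z‖ < r / 2 → F z ≤ C * ‖z‖ ^ 2) {z : Euc d}, ‖z‖ < 2 * r →
      F z ≤ levyErr C r δ z := by
    intro F h₁ h₂ z hz
    rw [levyErr_of_lt hz]
    by_cases hz' : ‖z‖ < r / 2
    · rw [indicator_of_notMem (by simpa using hz'), add_zero]
      exact h₂ z hz'
    · rw [indicator_of_mem (by simpa using hz')]
      exact h₁ z
  have far : ∀ {z w : Euc d}, 2 * r ≤ ‖z‖ → ‖w‖ < r →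
      K * ‖z‖ ^ p ≤ 4 * K * ‖z - w‖ ^ p := by
    intro z w hz hw
    have h1 : ‖z‖ ≤ 2 * ‖z - w‖ := by linarith [norm_sub_norm_le z w]
    have h2 : (2 : ℝ) ^ p ≤ 4 := by
      calc (2 : ℝ) ^ p ≤ 2 ^ (2 : ℝ) := Real.rpow_le_rpow_of_exponent_le (by norm_num) hp2
        _ = 4 := by norm_num
    calc K * ‖z‖ ^ p ≤ K * (2 * ‖z - w‖) ^ p := by gcongr
      _ = K * (2 ^ p * ‖z - w‖ ^ p) := by rw [Real.mul_rpow (by norm_num) (norm_nonneg _)]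
      _ ≤ K * (4 * ‖z - w‖ ^ p) := by gcongr
      _ = 4 * K * ‖z - w‖ ^ p := by ring
  have hpos : 0 ≤ K * ‖z - w‖ ^ p := by positivity
  rcases lt_or_ge ‖z‖ (2 * r) with hz | hz
  · rcases lt_or_ge ‖w‖ (2 * r) with hw | hw
    · have h1 := near hG₁ hG₂ hz
      have h2 := near (F := fun w => -H w) hH₁ hH₂ hw
      linarith
    · rcases lt_or_ge ‖z‖ r with hz' | hz'
      · have h1 := near hG₁ hG₂ hz
        have h2 := hH₃ w (by linarith)
        have h3 := hgh 0 w
        have h4 := far hw hz'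
        have h5 := le_levyErr (δ := δ) hC (show r / 2 ≤ ‖w‖ by linarith)
        rw [norm_sub_rev] at h4
        rw [hg0, zero_sub, zero_sub, norm_neg] at h3
        linarith
      · have h1 := hG₃ z hz'
        have h2 := hH₃ w (by linarith)
        have h3 := le_levyErr (δ := δ) hC (show r / 2 ≤ ‖z‖ by linarith)
        have h4 := le_levyErr (δ := δ) hC (show r / 2 ≤ ‖w‖ by linarith)
        linarith [hgh z w]
  · rcases lt_or_ge ‖w‖ r with hw | hw
    · have h1 := hG₃ z (by linarith)
      have h2 := near (F := fun w => -H w) hH₁ hH₂ (show ‖w‖ < 2 * r by linarith)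
      have h3 := hgh z 0
      have h4 := far hz hw
      have h5 := le_levyErr (δ := δ) hC (show r / 2 ≤ ‖z‖ by linarith)
      rw [hh0, sub_zero, sub_zero] at h3
      linarith
    · have h1 := hG₃ z (by linarith)
      have h2 := hH₃ w hw
      have h3 := le_levyErr (δ := δ) hC (show r / 2 ≤ ‖z‖ by linarith)
      have h4 := le_levyErr (δ := δ) hC (show r / 2 ≤ ‖w‖ by linarith)
      linarith [hgh z w]

theorem exists_levyErr_integral_le {ι : Type*} {p : ℝ} (hp0 : 0 < p) (hp2 : p ≤ 2)
    {μ : ι → Measure (Euc d)} {θ : ℝ → ℝ} (hθ : IsModulus θ)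
    (hμθ : ∀ r : ℝ, 0 < r → ∀ i,
      ∫⁻ z in ball (0 : Euc d) r, ENNReal.ofReal (‖z‖ ^ p) ∂(μ i) ≤ ENNReal.ofReal (θ r))
    {Λ : ℝ} (hΛ : 0 ≤ Λ)
    (hμΛ : ∀ i, ∫⁻ z, ENNReal.ofReal (min 1 (‖z‖ ^ p)) ∂(μ i) ≤ ENNReal.ofReal Λ)
    {C η : ℝ} (hC : 0 ≤ C) (hη : 0 < η) :
    ∃ r δ : ℝ, 0 < r ∧ r ≤ 1 ∧ 0 < δ ∧ δ ≤ η ∧ C * r ^ 2 ≤ η ∧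
      ∀ i, Integrable (levyErr C r δ) (μ i) ∧ ∫ z, levyErr C r δ z ∂(μ i) ≤ η := by
  obtain ⟨hθ0, hθm, hθt⟩ := hθ
  obtain ⟨r, hr0, hr1, hrC, hrθ⟩ : ∃ r : ℝ, 0 < r ∧ 2 * r ≤ 1 ∧ C * r ^ 2 ≤ η ∧
      C * θ (2 * r) ≤ η / 2 := by
    have h1 : ∀ᶠ s in nhdsWithin (0 : ℝ) (Ioi 0), C * θ s < η / 2 := by
      have := hθt.const_mul C
      rw [mul_zero] at this
      exact this.eventually (gt_mem_nhds (half_pos hη))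
    have h2 : ∀ᶠ s in nhdsWithin (0 : ℝ) (Ioi 0), C * (s / 2) ^ 2 < η := by
      have : Tendsto (fun s : ℝ => C * (s / 2) ^ 2) (nhds 0) (nhds (C * (0 / 2) ^ 2)) :=
        Continuous.tendsto (by fun_prop) 0
      rw [show C * (0 / 2 : ℝ) ^ 2 = 0 by simp] at this
      exact (this.mono_left nhdsWithin_le_nhds).eventually (gt_mem_nhds hη)
    have h3 : ∀ᶠ s in nhdsWithin (0 : ℝ) (Ioi 0), s < 1 :=
      nhdsWithin_le_nhds (gt_mem_nhds one_pos)
    obtain ⟨s, ⟨⟨hs1, hs2⟩, hs3⟩, hs0⟩ :=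
      (((h1.and h2).and h3).and self_mem_nhdsWithin).exists
    have hs0 : 0 < s := hs0
    refine ⟨s / 2, by linarith, by linarith, hs2.le, ?_⟩
    rw [mul_div_cancel₀ s two_ne_zero]
    exact hs1.le
  have hq : 0 < (r / 2) ^ p := Real.rpow_pos_of_pos (half_pos hr0) p
  obtain ⟨δ, hδ0, hδη, hδ⟩ : ∃ δ : ℝ, 0 < δ ∧ δ ≤ η ∧ δ / (r / 2) ^ p * Λ ≤ η / 2 := by
    refine ⟨min η (η / 2 * (r / 2) ^ p / (Λ + 1)), by positivity, min_le_left _ _, ?_⟩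
    have h1 : min η (η / 2 * (r / 2) ^ p / (Λ + 1)) * (Λ + 1) ≤ η / 2 * (r / 2) ^ p := by
      rw [← le_div_iff₀ (by positivity)]
      exact min_le_right _ _
    have h2 : 0 < min η (η / 2 * (r / 2) ^ p / (Λ + 1)) := by positivity
    rw [div_mul_eq_mul_div, div_le_iff₀ hq]
    nlinarith
  refine ⟨r, δ, hr0, by linarith, hδ0, hδη, hrC, fun i => ?_⟩
  have hle : ∀ z : Euc d, ENNReal.ofReal (levyErr C r δ z) ≤
      ENNReal.ofReal C * (ball (0 : Euc d) (2 * r)).indicator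
        (fun z => ENNReal.ofReal (‖z‖ ^ p)) z +
      ENNReal.ofReal (δ / (r / 2) ^ p) * ENNReal.ofReal (min 1 (‖z‖ ^ p)) := by
    intro z
    refine ENNReal.ofReal_add_le.trans (add_le_add ?_ ?_)
    · by_cases hz : z ∈ ball (0 : Euc d) (2 * r)
      · rw [indicator_of_mem hz, indicator_of_mem hz, ← ENNReal.ofReal_mul hC]
        have hz1 : ‖z‖ ≤ 1 := (mem_ball_zero_iff.1 hz).le.trans hr1
        refine ENNReal.ofReal_le_ofReal (mul_le_mul_of_nonneg_left ?_ hC)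
        rw [← Real.rpow_natCast]
        exact Real.rpow_le_rpow_of_exponent_ge_of_imp (norm_nonneg z) hz1 (by exact_mod_cast hp2)
          (fun _ h => absurd h (by norm_num))
      · simp [indicator_of_notMem hz]
    · by_cases hz : z ∈ (ball (0 : Euc d) (r / 2))ᶜ
      · rw [indicator_of_mem hz, ← ENNReal.ofReal_mul (by positivity)]
        refine ENNReal.ofReal_le_ofReal ?_
        have hz' : r / 2 ≤ ‖z‖ := by simpa using hz
        have hmin : (r / 2) ^ p ≤ min 1 (‖z‖ ^ p) :=
          le_min (Real.rpow_le_one (by positivity) (by linarith) hp0.le)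
            (Real.rpow_le_rpow (by positivity) hz' hp0.le)
        calc δ = δ / (r / 2) ^ p * (r / 2) ^ p := by field_simp
          _ ≤ _ := by gcongr
      · rw [indicator_of_notMem hz]
        simp
  have hE0 : ∀ z : Euc d, 0 ≤ levyErr C r δ z := levyErr_nonneg hC hδ0.le
  have hlint : ∫⁻ z, ENNReal.ofReal (levyErr C r δ z) ∂(μ i) ≤ ENNReal.ofReal η := by
    calc _ ≤ ∫⁻ z, (ENNReal.ofReal C * (ball (0 : Euc d) (2 * r)).indicator
          (fun z => ENNReal.ofReal (‖z‖ ^ p)) z +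
          ENNReal.ofReal (δ / (r / 2) ^ p) * ENNReal.ofReal (min 1 (‖z‖ ^ p))) ∂(μ i) :=
          lintegral_mono hle
      _ = ENNReal.ofReal C * ∫⁻ z in ball (0 : Euc d) (2 * r), ENNReal.ofReal (‖z‖ ^ p) ∂(μ i) +
          ENNReal.ofReal (δ / (r / 2) ^ p) * ∫⁻ z, ENNReal.ofReal (min 1 (‖z‖ ^ p)) ∂(μ i) := by
          rw [lintegral_add_right _ (by fun_prop),
            lintegral_const_mul _ (Measurable.indicator (by fun_prop) measurableSet_ball),
            lintegral_const_mul _ (by fun_prop), lintegral_indicator measurableSet_ball]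
      _ ≤ ENNReal.ofReal C * ENNReal.ofReal (θ (2 * r)) +
          ENNReal.ofReal (δ / (r / 2) ^ p) * ENNReal.ofReal Λ := by
          gcongr
          · exact hμθ _ (by positivity) i
          · exact hμΛ i
      _ = ENNReal.ofReal (C * θ (2 * r) + δ / (r / 2) ^ p * Λ) := by
          rw [← ENNReal.ofReal_mul hC, ← ENNReal.ofReal_mul (by positivity),
            ← ENNReal.ofReal_add (mul_nonneg hC (hθ0 _)) (by positivity)]
      _ ≤ ENNReal.ofReal η := ENNReal.ofReal_le_ofReal (by linarith)
  refine ⟨⟨(measurable_levyErr C r δ).aestronglyMeasurable, ?_⟩, ?_⟩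
  · rw [hasFiniteIntegral_iff_ofReal (ae_of_all _ hE0)]
    exact hlint.trans_lt ENNReal.ofReal_lt_top
  · rw [integral_eq_lintegral_of_nonneg_ae (ae_of_all _ hE0)
      (measurable_levyErr C r δ).aestronglyMeasurable]
    exact ENNReal.toReal_le_of_le_ofReal hη.le hlint

/-- The compensated increment `φ(x+z) - φ(x) - Dφ(x)·z`. -/
def levyInc (φ : Euc d → ℝ) (x z : Euc d) : ℝ := φ (x + z) - φ x - fderiv ℝ φ x z

theorem levyInc_zero (φ : Euc d → ℝ) (x : Euc d) : levyInc φ x 0 = 0 := by simp [levyInc]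

theorem measurable_levyInc {φ : Euc d → ℝ} (hφ : Continuous φ) (x : Euc d) :
    Measurable (levyInc φ x) := by
  have h1 : Continuous fun z => φ (x + z) := hφ.comp (continuous_const.add continuous_id)
  exact ((h1.sub continuous_const).sub (fderiv ℝ φ x).continuous).measurable

/-- A Lévy measure split into a part near the origin, a finite part on the unit ball, and its
restriction to the complement of the unit ball. -/
structure IsLevySplit (p : ℝ) (μ μh μt : Measure (Euc d)) : Prop where
  levy : IsLevyLp p μ
  eq : μ = μh + μt + μ.restrict (ball (0 : Euc d) 1)ᶜ
  hat_supp : μh (ball (0 : Euc d) 1)ᶜ = 0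
  tilde_supp : μt (ball (0 : Euc d) 1)ᶜ = 0
  tilde_fin : μt univ < ⊤

namespace IsLevySplit

variable {p : ℝ} {μ μh μt : Measure (Euc d)}

theorem hat_le (h : IsLevySplit p μ μh μt) : μh ≤ μ := by
  conv_rhs => rw [h.eq, add_assoc]
  exact Measure.le_add_right le_rfl

theorem tilde_le (h : IsLevySplit p μ μh μt) : μt ≤ μ := by
  conv_rhs => rw [h.eq]
  exact Measure.le_add_right (Measure.le_add_left le_rfl)

theorem tail_le_lintegral (hp0 : 0 ≤ p) :
    μ (ball (0 : Euc d) 1)ᶜ ≤ ∫⁻ z, ENNReal.ofReal (min 1 (‖z‖ ^ p)) ∂μ := by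
  rw [← lintegral_indicator_one measurableSet_ball.compl]
  refine lintegral_mono fun z => ?_
  by_cases hz : z ∈ (ball (0 : Euc d) 1)ᶜ
  · have hz1 : 1 ≤ ‖z‖ := by simpa using hz
    rw [indicator_of_mem hz, min_eq_left (Real.one_le_rpow hz1 hp0)]
    simp
  · rw [indicator_of_notMem hz]
    exact zero_le

theorem lintegral_hat_lt_top (hp0 : 0 ≤ p) (h : IsLevySplit p μ μh μt) :
    ∫⁻ z, ENNReal.ofReal (‖z‖ ^ p) ∂μh < ⊤ := by
  refine lt_of_le_of_lt ?_ h.levy.2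
  calc ∫⁻ z, ENNReal.ofReal (‖z‖ ^ p) ∂μh = ∫⁻ z, ENNReal.ofReal (min 1 (‖z‖ ^ p)) ∂μh := by
        refine lintegral_congr_ae ?_
        filter_upwards [measure_eq_zero_iff_ae_notMem.1 h.hat_supp] with z hz
        have hz1 : ‖z‖ < 1 := by simpa using hz
        rw [min_eq_right (Real.rpow_le_one (norm_nonneg z) hz1.le hp0)]
    _ ≤ _ := lintegral_mono' h.hat_le le_rfl

theorem Lop_eq (hp0 : 0 < p) (hp2 : p ≤ 2) (h : IsLevySplit p μ μh μt) {φ : Euc d → ℝ}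
    (hφ : ContDiff ℝ 2 φ) (hb : ∃ M, ∀ x, |φ x| ≤ M) (x : Euc d) :
    Integrable (levyInc φ x) μh ∧ Integrable (levyInc φ x) μt ∧
      Lop μ φ x = ∫ z, levyInc φ x z ∂μh + ∫ z, levyInc φ x z ∂μt +
        ∫ z in (ball (0 : Euc d) 1)ᶜ, (φ (x + z) - φ x) ∂μ := by
  have hi := integrable_levy_integrand hφ hb hp0 hp2 x h.levy.2
  have hae : ∀ {m : Measure (Euc d)}, m (ball (0 : Euc d) 1)ᶜ = 0 →
      (fun z => φ (x + z) - φ x -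
        (ball (0 : Euc d) 1).indicator (fun w => fderiv ℝ φ x w) z) =ᵐ[m] levyInc φ x := by
    intro m hm
    filter_upwards [measure_eq_zero_iff_ae_notMem.1 hm] with z hz
    rw [indicator_of_mem (by simpa using hz), levyInc]
  have hih := hi.mono_measure h.hat_le
  have hit := hi.mono_measure h.tilde_le
  have hir := hi.mono_measure (Measure.restrict_le_self (s := (ball (0 : Euc d) 1)ᶜ))
  refine ⟨hih.congr (hae h.hat_supp), hit.congr (hae h.tilde_supp), ?_⟩
  rw [← integral_congr_ae (hae h.hat_supp), ← integral_congr_ae (hae h.tilde_supp)]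
  have htail : ∫ z in (ball (0 : Euc d) 1)ᶜ, (φ (x + z) - φ x) ∂μ =
      ∫ z in (ball (0 : Euc d) 1)ᶜ, (φ (x + z) - φ x -
        (ball (0 : Euc d) 1).indicator (fun w => fderiv ℝ φ x w) z) ∂μ := by
    refine setIntegral_congr_fun measurableSet_ball.compl fun z hz => ?_
    simp only [indicator_of_notMem hz, sub_zero]
  rw [htail, ← integral_add_measure hih hit, ← integral_add_measure (hih.add_measure hit) hir,
    ← h.eq, Lop]

end IsLevySplit

/-- Comparison of the Lévy operators of two split measures, applied to two functions whose
increments are controlled as in the doubling of variables. -/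
theorem Lop_sub_Lop_le {p : ℝ} (hp0 : 0 < p) (hp2 : p ≤ 2) {μ μh μt ν νh νt : Measure (Euc d)}
    (hμ : IsLevySplit p μ μh μt) (hν : IsLevySplit p ν νh νt) {Φ Θ : Euc d → ℝ}
    (hΦ : ContDiff ℝ 2 Φ) (hΦb : ∃ M, ∀ x, |Φ x| ≤ M) (hΘ : ContDiff ℝ 2 Θ)
    (hΘb : ∃ M, ∀ x, |Θ x| ≤ M) {x y : Euc d} {γ : Measure (Euc d × Euc d)}
    (hγ : γ ∈ AdmPlan μh νh) {J : ℝ} (hJ0 : 0 ≤ J) (hJ : Jp p γ ≤ ENNReal.ofReal J)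
    {K : ℝ} (hK : 0 ≤ K) {E : Euc d → ℝ} (hEm : Measurable E) (hE : ∀ z, 0 ≤ E z)
    (hE0 : E 0 = 0) {e : ℝ} (hEμ : Integrable E μ ∧ ∫ z, E z ∂μ ≤ e)
    (hEν : Integrable E ν ∧ ∫ z, E z ∂ν ≤ e)
    (hle : ∀ z w, levyInc Φ x z - levyInc Θ y w ≤ K * ‖z - w‖ ^ p + E z + E w)
    {η N₁ D₁ L : ℝ} (hη : 0 < η) (hN₁ : 0 ≤ N₁) (hD₁ : 0 ≤ D₁) (hL : 0 ≤ L)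
    (hΘ₁ : ∀ z, |levyInc Θ y z| ≤ η + N₁ * ‖z‖)
    (hTV₁ : dTV (μt.withDensity fun z => ENNReal.ofReal ‖z‖)
      (νt.withDensity fun z => ENNReal.ofReal ‖z‖) ≤ ENNReal.ofReal D₁)
    (hμL : μt (ball (0 : Euc d) 1) ≤ ENNReal.ofReal L)
    (hνL : νt (ball (0 : Euc d) 1) ≤ ENNReal.ofReal L)
    {δ N₂ D₂ Λ : ℝ} (hδ : 0 ≤ δ) (hN₂ : 0 ≤ N₂) (hD₂ : 0 ≤ D₂) (hΛ : 0 ≤ Λ)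
    (htail : ∀ z, 1 ≤ ‖z‖ → Φ (x + z) - Φ x - (Θ (y + z) - Θ y) ≤ δ)
    (hΘ₂ : ∀ z, 1 ≤ ‖z‖ → |Θ (y + z) - Θ y| ≤ N₂)
    (hTV₂ : dTV (μ.restrict (ball (0 : Euc d) 1)ᶜ) (ν.restrict (ball (0 : Euc d) 1)ᶜ)
      ≤ ENNReal.ofReal D₂)
    (hμΛ : ∫⁻ z, ENNReal.ofReal (min 1 (‖z‖ ^ p)) ∂μ ≤ ENNReal.ofReal Λ) :
    Lop μ Φ x - Lop ν Θ y ≤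
      K * J + 4 * e + 2 * (η * L) + 2 * (N₁ * D₁) + δ * Λ + 2 * (N₂ * D₂) := by
  obtain ⟨hGh, hGt, hLμ⟩ := hμ.Lop_eq hp0 hp2 hΦ hΦb x
  obtain ⟨hHh, hHt, hLν⟩ := hν.Lop_eq hp0 hp2 hΘ hΘb y
  have hGm := measurable_levyInc hΦ.continuous x
  have hHm := measurable_levyInc hΘ.continuous y
  have hmono : ∀ {m m' : Measure (Euc d)}, m' ≤ m → Integrable E m ∧ ∫ z, E z ∂m ≤ e →
      ∫ z, E z ∂m' ≤ e := fun h h' =>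
    (integral_mono_measure h (ae_of_all _ hE) h'.1).trans h'.2
  have hhat : ∫ z, levyInc Φ x z ∂μh - ∫ z, levyInc Θ y z ∂νh ≤ K * J + e + e :=
    (integral_sub_integral_le_of_admPlan hγ hJ0 hJ hK (levyInc_zero _ _) (levyInc_zero _ _) hE0
      hGm hHm hEm hGh hHh (hEμ.1.mono_measure hμ.hat_le) (hEν.1.mono_measure hν.hat_le)
      hle).trans (by
        have h1 := hmono hμ.hat_le hEμ
        have h2 := hmono hν.hat_le hEν
        linarith)
  have : IsFiniteMeasure μt := ⟨hμ.tilde_fin⟩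
  have : IsFiniteMeasure νt := ⟨hν.tilde_fin⟩
  have htilde : ∫ z, levyInc Φ x z ∂μt - ∫ z, levyInc Θ y z ∂νt ≤
      2 * e + 2 * (η * L) + 2 * (N₁ * D₁) := by
    have hEt := hEμ.1.mono_measure hμ.tilde_le
    have hk := (hμ.Lop_eq hp0 hp2 hΘ hΘb y).2.1
    have h1 : ∫ z, levyInc Φ x z ∂μt ≤ ∫ z, (levyInc Θ y z + 2 * E z) ∂μt := by
      refine integral_mono hGt (hk.add (hEt.const_mul 2)) fun z => ?_
      have := hle z z
      rw [sub_self, norm_zero, Real.zero_rpow hp0.ne', mul_zero] at this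
      simp only
      linarith
    rw [integral_add hk (hEt.const_mul 2), integral_const_mul] at h1
    have h2 := integral_le_integral_add_of_weighted_dTV hμ.tilde_supp hν.tilde_supp hD₁ hη hN₁ hL
      hTV₁ hμL hνL hHm hΘ₁
    have h3 := hmono hμ.tilde_le hEμ
    linarith
  have hfin : ∀ {m : Measure (Euc d)}, IsLevyLp p m →
      IsFiniteMeasure (m.restrict (ball (0 : Euc d) 1)ᶜ) := fun hm => ⟨by
    rw [Measure.restrict_apply_univ]
    exact (IsLevySplit.tail_le_lintegral hp0.le).trans_lt hm.2⟩
  have := hfin hμ.levy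
  have := hfin hν.levy
  set T : Set (Euc d) := (ball (0 : Euc d) 1)ᶜ with hT
  have hTm : MeasurableSet T := measurableSet_ball.compl
  have htail' : ∫ z in T, (Φ (x + z) - Φ x) ∂μ - ∫ z in T, (Θ (y + z) - Θ y) ∂ν ≤
      δ * Λ + 2 * (N₂ * D₂) := by
    have hm : ∀ {φ : Euc d → ℝ} (_ : Continuous φ) (a : Euc d),
        Measurable fun z => φ (a + z) - φ a := fun hφ a =>
      ((hφ.comp (continuous_const.add continuous_id)).sub continuous_const).measurable
    have hkm : Measurable (T.indicator fun z => Θ (y + z) - Θ y) :=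
      (hm hΘ.continuous y).indicator hTm
    have hkb : ∀ z, |T.indicator (fun z => Θ (y + z) - Θ y) z| ≤ N₂ := by
      intro z
      by_cases hz : z ∈ T
      · rw [indicator_of_mem hz]
        exact hΘ₂ z (by simpa [hT] using hz)
      · rwa [indicator_of_notMem hz, abs_zero]
    have hind : ∀ m : Measure (Euc d), ∫ z in T, T.indicator (fun z => Θ (y + z) - Θ y) z ∂m =
        ∫ z in T, (Θ (y + z) - Θ y) ∂m := fun m =>
      setIntegral_congr_fun hTm fun z hz => indicator_of_mem hz _
    have h1 := integral_le_integral_add_of_dTV hD₂ hN₂ hTV₂ hkm hkb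
    rw [hind, hind] at h1
    have hbd : ∀ {φ : Euc d → ℝ} (_ : Continuous φ) (_ : ∃ M, ∀ x, |φ x| ≤ M) (a : Euc d),
        Integrable (fun z => φ (a + z) - φ a) (μ.restrict T) := by
      rintro φ hφ ⟨M, hM⟩ a
      refine integrable_of_abs_le (K := M + M) (hm hφ a) fun z => ?_
      exact (abs_sub _ _).trans (add_le_add (hM _) (hM _))
    have hΘi := hbd hΘ.continuous hΘb y
    have h2 : ∫ z in T, (Φ (x + z) - Φ x) ∂μ ≤ ∫ z in T, ((Θ (y + z) - Θ y) + δ) ∂μ := by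
      refine setIntegral_mono_on (hbd hΦ.continuous hΦb x) (hΘi.add (integrable_const δ)) hTm
        fun z hz => ?_
      have := htail z (by simpa [hT] using hz)
      linarith
    rw [integral_add hΘi (integrable_const δ), integral_const, smul_eq_mul] at h2
    have h3 : (μ.restrict T).real univ ≤ Λ := by
      rw [measureReal_def, Measure.restrict_apply_univ]
      exact ENNReal.toReal_le_of_le_ofReal hΛ
        ((IsLevySplit.tail_le_lintegral hp0.le).trans hμΛ)
    have h4 := mul_le_mul_of_nonneg_left h3 hδ
    linarith
  rw [hLμ, hLν]
  linarith

theorem exists_lt_of_iSup_iInf_nonpos {A B : Type*} [Nonempty B] {V : A → B → ℝ} {N : ℝ}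
    (hN : ∀ α β, |V α β| ≤ N) (h : ⨆ α, ⨅ β, V α β ≤ 0) {η : ℝ} (hη : 0 < η) (α : A) :
    ∃ β, V α β < η := by
  have hlow : ∀ α, BddBelow (range (V α)) := fun α =>
    ⟨-N, by rintro _ ⟨β, rfl⟩; exact (abs_le.1 (hN α β)).1⟩
  have hup : BddAbove (range fun α => ⨅ β, V α β) := by
    refine ⟨N, ?_⟩
    rintro _ ⟨α, rfl⟩
    exact (ciInf_le (hlow α) (Classical.arbitrary B)).trans (abs_le.1 (hN α _)).2
  exact exists_lt_of_ciInf_lt (((le_ciSup hup α).trans h).trans_lt hη)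

theorem exists_forall_lt_of_iSup_iInf_nonneg {A B : Type*} [Nonempty A] {V : A → B → ℝ}
    {N : ℝ} (hN : ∀ α β, |V α β| ≤ N) (h : 0 ≤ ⨆ α, ⨅ β, V α β) {η : ℝ} (hη : 0 < η) :
    ∃ α, ∀ β, -η < V α β := by
  obtain ⟨α, hα⟩ := exists_lt_of_lt_ciSup (show -η < ⨆ α, ⨅ β, V α β by linarith)
  refine ⟨α, fun β => hα.trans_le (ciInf_le ⟨-N, ?_⟩ β)⟩
  rintro _ ⟨β, rfl⟩
  exact (abs_le.1 (hN α β)).1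

/-- Almost optimal indices for the inf-sup operator at a subsolution test point and a
supersolution test point. -/
theorem exists_index_of_Iop {A B : Type*} [Nonempty A] [Nonempty B]
    {μf : Euc d → A → B → Measure (Euc d)} {c f : A → B → Euc d → ℝ} {p : ℝ} (hp0 : 0 < p)
    (hp2 : p ≤ 2) {Φ Θ : Euc d → ℝ} (hΦ : ContDiff ℝ 2 Φ) (hΦb : ∃ M, ∀ x, |Φ x| ≤ M)
    (hΘ : ContDiff ℝ 2 Θ) (hΘb : ∃ M, ∀ x, |Θ x| ≤ M) {O : Set (Euc d)} {Λ c₁ f₁ : ℝ}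
    (hΛ : 0 ≤ Λ)
    (hμΛ : ∀ x ∈ O, ∀ α β,
      ∫⁻ z, ENNReal.ofReal (min 1 (‖z‖ ^ p)) ∂(μf x α β) ≤ ENNReal.ofReal Λ)
    (hc : ∀ x ∈ O, ∀ α β, |c α β x| ≤ c₁) (hf : ∀ x ∈ O, ∀ α β, |f α β x| ≤ f₁)
    {x y : Euc d} (hx : x ∈ O) (hy : y ∈ O) (h₁ : Iop μf c f Φ x ≤ 0) (h₂ : 0 ≤ Iop μf c f Θ y)
    {η : ℝ} (hη : 0 < η) :
    ∃ α β, -(Lop (μf x α β) Φ x) + c α β x * Φ x + f α β x < η ∧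
      -η < -(Lop (μf y α β) Θ y) + c α β y * Θ y + f α β y := by
  have hbd : ∀ {φ : Euc d → ℝ}, ContDiff ℝ 2 φ → (∃ M, ∀ x, |φ x| ≤ M) → ∀ {a}, a ∈ O →
      ∃ N, ∀ α β, |-(Lop (μf a α β) φ a) + c α β a * φ a + f α β a| ≤ N := by
    intro φ hφ hb a ha
    obtain ⟨N, hN⟩ := exists_abs_Lop_le hφ hb hp0 hp2 a hΛ
    refine ⟨N + c₁ * |φ a| + f₁, fun α β => ?_⟩
    have h1 := hN _ (hμΛ a ha α β)
    have h2 : |c α β a * φ a| ≤ c₁ * |φ a| := by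
      rw [abs_mul]
      exact mul_le_mul_of_nonneg_right (hc a ha α β) (abs_nonneg _)
    refine (abs_add_three _ _ _).trans ?_
    rw [abs_neg]
    exact add_le_add (add_le_add h1 h2) (hf a ha α β)
  obtain ⟨N, hN⟩ := hbd hΦ hΦb hx
  obtain ⟨N', hN'⟩ := hbd hΘ hΘb hy
  obtain ⟨α, hα⟩ := exists_forall_lt_of_iSup_iInf_nonneg hN' h₂ hη
  obtain ⟨β, hβ⟩ := exists_lt_of_iSup_iInf_nonpos hN h₁ hη α
  exact ⟨α, β, hβ, hα β⟩

/-- Bounded `C²` test functions touching `u` from above at `x` and `v` from below at `y`, where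
`(x, y)` maximizes `u x - v y - ψ (x - y)`. -/
theorem exists_test_pair {p : ℝ} (hp0 : 0 < p) (hp2 : p ≤ 2) {u v : Euc d → ℝ} (hu : IsBUC u)
    (hv : IsBUC v) {ψ : Euc d → ℝ} (hψ : ContDiff ℝ 2 ψ) {x y : Euc d} {K C : ℝ} (hK : 0 ≤ K)
    (hC : 0 ≤ C)
    (hmax : ∀ x' y', u x' - v y' - ψ (x' - y') ≤ u x - v y - ψ (x - y))
    (hψp : ∀ h, ψ (x - y + h) - ψ (x - y) - fderiv ℝ ψ (x - y) h ≤ K * ‖h‖ ^ p)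
    (hψ2 : ∀ h, ψ (x - y + h) - ψ (x - y) - fderiv ℝ ψ (x - y) h ≤ C * ‖h‖ ^ 2)
    {r δ : ℝ} (hr : 0 < r) (hδ : 0 < δ) :
    ∃ Φ Θ : Euc d → ℝ, ContDiff ℝ 2 Φ ∧ (∃ M, ∀ x, |Φ x| ≤ M) ∧ ContDiff ℝ 2 Θ ∧
      (∃ M, ∀ x, |Θ x| ≤ M) ∧ Φ x = u x ∧ (∀ z, u z ≤ Φ z) ∧ Θ y = v y ∧ (∀ z, Θ z ≤ v z) ∧
      (∀ z w, levyInc Φ x z - levyInc Θ y w ≤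
        4 * K * ‖z - w‖ ^ p + levyErr C r δ z + levyErr C r δ w) ∧
      (∀ z, r ≤ ‖z‖ → Φ (x + z) ≤ u (x + z) + δ) ∧ (∀ z, r ≤ ‖z‖ → v (y + z) - δ ≤ Θ (y + z)) ∧
      fderiv ℝ Θ y = fderiv ℝ ψ (x - y) ∧ ∀ z, -(C * ‖z‖ ^ 2 + δ) ≤ levyInc Θ y z := by
  set P := fderiv ℝ ψ (x - y) with hP
  have hψd : HasFDerivAt ψ P (x - y) := (hψ.differentiable (by norm_num) _).hasFDerivAt
  obtain ⟨Φ, hΦ, hΦb, hΦu, hΦx, hΦd, hΦ₁, hΦ₂, hΦ₃⟩ := exists_test_function hu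
    (φ := fun x' => u x + ψ (x' - y) - ψ (x - y))
    ((contDiff_const.add (hψ.comp (contDiff_id.sub contDiff_const))).sub contDiff_const)
    (fun x' => by linarith [hmax x' y]) x hr hδ
  have hv' : IsBUC fun y => -v y :=
    ⟨hv.1.imp fun M hM z => by rw [abs_neg]; exact hM z, hv.2.neg⟩
  obtain ⟨Θ, hΘ, hΘb, hΘv, hΘy, hΘd, hΘ₁, hΘ₂, hΘ₃⟩ := exists_test_function hv'
    (φ := fun y' => -v y + ψ (x - y') - ψ (x - y))
    ((contDiff_const.add (hψ.comp (contDiff_const.sub contDiff_id))).sub contDiff_const)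
    (fun y' => by linarith [hmax x y']) y hr hδ
  have hΦd' : fderiv ℝ Φ x = P := by
    rw [hΦd]
    have h1 : HasFDerivAt (fun x' => ψ (x' - y)) (P.comp (ContinuousLinearMap.id ℝ (Euc d))) x :=
      hψd.comp x ((hasFDerivAt_id x).sub_const y)
    rw [ContinuousLinearMap.comp_id] at h1
    exact ((h1.const_add (u x)).sub_const (ψ (x - y))).fderiv
  have hΘd' : fderiv ℝ Θ y = -P := by
    rw [hΘd]
    have h1 : HasFDerivAt (fun y' => ψ (x - y'))
        (P.comp (-ContinuousLinearMap.id ℝ (Euc d))) y :=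
      hψd.comp y ((hasFDerivAt_id y).const_sub x)
    have h2 := ((h1.const_add (-v y)).sub_const (ψ (x - y))).fderiv
    rw [h2]
    ext z
    simp
  have hΘn : fderiv ℝ (fun z => -Θ z) y = P := by
    rw [fderiv_fun_neg, hΘd', neg_neg]
  have hΦx' : Φ x = u x := by rw [hΦx]; ring
  have hΘy' : Θ y = -v y := by rw [hΘy]; ring
  have hG : ∀ z, levyInc Φ x z = Φ (x + z) - u x - P z := fun z => by
    rw [levyInc, hΦd', hΦx']
  have hH : ∀ z, levyInc (fun z => -Θ z) y z = -Θ (y + z) - v y - P z := fun z => by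
    rw [levyInc, hΘn, hΘy', neg_neg]
  have hqx : ∀ z, u x + ψ (x + z - y) - ψ (x - y) - u x - P z ≤ C * ‖z‖ ^ 2 := fun z => by
    have := hψ2 z
    rw [show x - y + z = x + z - y by abel] at this
    linarith
  have hqy : ∀ z, -v y + ψ (x - (y + z)) - ψ (x - y) + v y + P z ≤ C * ‖z‖ ^ 2 := fun z => by
    have := hψ2 (-z)
    rw [show x - y + -z = x - (y + z) by abel, norm_neg, map_neg] at this
    linarith
  have hH₁ : ∀ z, -levyInc (fun z => -Θ z) y z ≤ C * ‖z‖ ^ 2 + δ := fun z => by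
    rw [hH]
    linarith [hqy z, hΘ₁ (y + z)]
  refine ⟨Φ, fun z => -Θ z, hΦ, hΦb, hΘ.neg, hΘb.imp fun M hM z => by rw [abs_neg]; exact hM z,
    hΦx', hΦu, by simp only [hΘy', neg_neg], fun z => by linarith [hΘv z], ?_, ?_, ?_, hΘn, ?_⟩
  · refine sub_le_of_doubling hp0 hp2 hK hC hr (g := fun z => u (x + z) - u x - P z)
      (h := fun w => v (y + w) - v y - P w) (by simp) (by simp) (fun z w => ?_) (fun z => ?_)
      (fun z hz => ?_) (fun z hz => ?_) hH₁ (fun w hw => ?_) (fun w hw => ?_)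
    · have h1 := hψp (z - w)
      have h2 := hmax (x + z) (y + w)
      rw [show x - y + (z - w) = x + z - (y + w) by abel, map_sub] at h1
      linarith
    · rw [hG]
      linarith [hqx z, hΦ₁ (x + z)]
    · rw [hG, hΦ₂ (x + z) (by rwa [add_sub_cancel_left])]
      linarith [hqx z]
    · rw [hG]
      linarith [hΦ₃ (x + z) (by rwa [add_sub_cancel_left])]
    · rw [hH, hΘ₂ (y + w) (by rwa [add_sub_cancel_left])]
      linarith [hqy w]
    · rw [hH]
      linarith [hΘ₃ (y + w) (by rwa [add_sub_cancel_left])]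
  · intro z hz
    exact hΦ₃ (x + z) (by rwa [add_sub_cancel_left])
  · intro z hz
    linarith [hΘ₃ (y + z) (by rwa [add_sub_cancel_left])]
  · intro z
    linarith [hH₁ z]

theorem exists_abs_sub_le_add_mul_norm {v : Euc d → ℝ} (hv : IsBUC v) {η : ℝ} (hη : 0 < η) :
    ∃ C : ℝ, 0 ≤ C ∧ ∀ y z, |v (y + z) - v y| ≤ η + C * ‖z‖ := by
  obtain ⟨⟨M, hM⟩, hc⟩ := hv
  have hM0 : 0 ≤ M := (abs_nonneg _).trans (hM 0)
  obtain ⟨ρ, hρ, h⟩ := Metric.uniformContinuous_iff.1 hc η hη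
  refine ⟨2 * M / ρ, by positivity, fun y z => ?_⟩
  rcases lt_or_ge ‖z‖ ρ with hz | hz
  · have h1 := h (a := y + z) (b := y) (by rwa [dist_eq_norm, add_sub_cancel_left])
    rw [Real.dist_eq] at h1
    have : 0 ≤ 2 * M / ρ * ‖z‖ := by positivity
    linarith
  · have h1 := (abs_sub (v (y + z)) (v y)).trans (add_le_add (hM _) (hM _))
    have h2 : 2 * M ≤ 2 * M / ρ * ‖z‖ := by
      rw [div_mul_eq_mul_div, le_div_iff₀ hρ]
      gcongr
    linarith

/-- The Lévy operators of the test functions produced by the doubling of variables differ by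
little. -/
theorem Lop_sub_Lop_le_of_test_pair {p : ℝ} (hp0 : 0 < p) (hp2 : p ≤ 2)
    {μ μh μt ν νh νt : Measure (Euc d)} (hμ : IsLevySplit p μ μh μt)
    (hν : IsLevySplit p ν νh νt) {u v Φ Θ : Euc d → ℝ}
    (hΦ : ContDiff ℝ 2 Φ) (hΦb : ∃ M, ∀ x, |Φ x| ≤ M) (hΘ : ContDiff ℝ 2 Θ)
    (hΘb : ∃ M, ∀ x, |Θ x| ≤ M) {x y : Euc d} {P : Euc d →L[ℝ] ℝ} (hΘd : fderiv ℝ Θ y = P)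
    (hΦx : Φ x = u x) (hΘy : Θ y = v y) (hΘv : ∀ z, Θ z ≤ v z) {M : ℝ} (hvM : ∀ z, |v z| ≤ M)
    (hmax : ∀ z, u (x + z) - v (y + z) ≤ u x - v y)
    {K C r δ η N : ℝ} (hK : 0 ≤ K) (hC : 0 ≤ C) (hr : 0 < r) (hr1 : r ≤ 1) (hδ : 0 < δ)
    (hδη : δ ≤ η) (hη1 : η ≤ 1) (hCr : C * r ^ 2 ≤ η) (hN : 0 ≤ N)
    (hvN : ∀ z, |v (y + z) - v y| ≤ η + N * ‖z‖)
    (hle : ∀ z w, levyInc Φ x z - levyInc Θ y w ≤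
        4 * K * ‖z - w‖ ^ p + levyErr C r δ z + levyErr C r δ w)
    (hΦu : ∀ z, r ≤ ‖z‖ → Φ (x + z) ≤ u (x + z) + δ)
    (hΘr : ∀ z, r ≤ ‖z‖ → v (y + z) - δ ≤ Θ (y + z))
    (hΘl : ∀ z, -(C * ‖z‖ ^ 2 + δ) ≤ levyInc Θ y z)
    (hEμ : Integrable (levyErr C r δ) μ ∧ ∫ z, levyErr C r δ z ∂μ ≤ η)
    (hEν : Integrable (levyErr C r δ) ν ∧ ∫ z, levyErr C r δ z ∂ν ≤ η)
    {γ : Measure (Euc d × Euc d)} (hγ : γ ∈ AdmPlan μh νh) {J : ℝ} (hJ0 : 0 ≤ J)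
    (hJ : Jp p γ ≤ ENNReal.ofReal J) {D₁ L D₂ Λ : ℝ} (hD₁ : 0 ≤ D₁) (hL : 0 ≤ L)
    (hTV₁ : dTV (μt.withDensity fun z => ENNReal.ofReal ‖z‖)
      (νt.withDensity fun z => ENNReal.ofReal ‖z‖) ≤ ENNReal.ofReal D₁)
    (hμL : μt (ball (0 : Euc d) 1) ≤ ENNReal.ofReal L)
    (hνL : νt (ball (0 : Euc d) 1) ≤ ENNReal.ofReal L) (hD₂ : 0 ≤ D₂) (hΛ : 0 ≤ Λ)
    (hTV₂ : dTV (μ.restrict (ball (0 : Euc d) 1)ᶜ) (ν.restrict (ball (0 : Euc d) 1)ᶜ)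
      ≤ ENNReal.ofReal D₂)
    (hμΛ : ∫⁻ z, ENNReal.ofReal (min 1 (‖z‖ ^ p)) ∂μ ≤ ENNReal.ofReal Λ) :
    Lop μ Φ x - Lop ν Θ y ≤ 4 * K * J + 4 * η + 4 * (η * L) + 2 * ((N + ‖P‖) * D₁) +
      2 * (η * Λ) + 2 * ((2 * M + 1) * D₂) := by
  have hη : 0 < η := hδ.trans_le hδη
  have hM0 : 0 ≤ M := (abs_nonneg _).trans (hvM 0)
  have hinc : ∀ z, levyInc Θ y z = Θ (y + z) - v y - P z := fun z => by
    rw [levyInc, hΘd, hΘy]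
  have hPz : ∀ z, |P z| ≤ ‖P‖ * ‖z‖ := fun z => P.le_opNorm z
  have hΘ₁ : ∀ z, |levyInc Θ y z| ≤ 2 * η + (N + ‖P‖) * ‖z‖ := by
    intro z
    have h1 := abs_le.1 (hvN z)
    have h2 := abs_le.1 (hPz z)
    have h3 : 0 ≤ (N + ‖P‖) * ‖z‖ := by positivity
    refine abs_le.2 ⟨?_, ?_⟩
    · rcases le_or_gt r ‖z‖ with hz | hz
      · rw [hinc]
        linarith [hΘr z hz]
      · have h4 : C * ‖z‖ ^ 2 ≤ C * r ^ 2 := by gcongr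
        linarith [hΘl z]
    · rw [hinc]
      linarith [hΘv (y + z)]
  have hΘ₂ : ∀ z, 1 ≤ ‖z‖ → |Θ (y + z) - Θ y| ≤ 2 * M + 1 := by
    intro z hz
    have h1 := abs_le.1 (hvM (y + z))
    have h2 := abs_le.1 (hvM y)
    rw [hΘy]
    exact abs_le.2 ⟨by linarith [hΘr z (hr1.trans hz)], by linarith [hΘv (y + z)]⟩
  have htail : ∀ z, 1 ≤ ‖z‖ → Φ (x + z) - Φ x - (Θ (y + z) - Θ y) ≤ 2 * δ := by
    intro z hz
    rw [hΦx, hΘy]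
    linarith [hΦu z (hr1.trans hz), hΘr z (hr1.trans hz), hmax z]
  have h := Lop_sub_Lop_le hp0 hp2 hμ hν hΦ hΦb hΘ hΘb hγ hJ0 hJ
    (show 0 ≤ 4 * K by positivity) (measurable_levyErr C r δ) (levyErr_nonneg hC hδ.le)
    (levyErr_zero hr) hEμ hEν hle (show 0 < 2 * η by positivity)
    (show 0 ≤ N + ‖P‖ by positivity) hD₁ hL hΘ₁ hTV₁ hμL hνL (show 0 ≤ 2 * δ by positivity)
    (show 0 ≤ 2 * M + 1 by positivity) hD₂ hΛ htail hΘ₂ hTV₂ hμΛ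
  have h1 : δ * Λ ≤ η * Λ := by gcongr
  linarith

theorem IsModulus.eventually_le {θ : ℝ → ℝ} (hθ : IsModulus θ) {η : ℝ} (hη : 0 < η) :
    ∀ᶠ s in nhdsWithin (0 : ℝ) (Ioi 0), θ s ≤ η :=
  (hθ.2.2.eventually (gt_mem_nhds hη)).mono fun _ h => h.le

theorem exists_pos_max {u v : Euc d → ℝ} (hu : IsBUC u) (hv : IsBUC v) {O : Set (Euc d)}
    (hO : Bornology.IsBounded O) (hbc : ∀ x ∉ O, u x ≤ v x) {x : Euc d} (hx : x ∈ O)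
    (hlt : v x < u x) :
    ∃ x₀, 0 < u x₀ - v x₀ ∧ ∀ x, u x - v x ≤ u x₀ - v x₀ := by
  obtain ⟨x₀, -, hx₀⟩ := hO.isCompact_closure.exists_isMaxOn ⟨x, subset_closure hx⟩
    (hu.2.continuous.sub hv.2.continuous).continuousOn
  have h1 : u x - v x ≤ u x₀ - v x₀ := hx₀ (subset_closure hx)
  refine ⟨x₀, by linarith, fun z => ?_⟩
  by_cases hz : z ∈ O
  · exact hx₀ (subset_closure hz)
  · linarith [hbc z hz]

/-- Theorem 5.1 (variant of the comparison principle): with a three-part decomposition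
`μ_x^{αβ} = μ̂_x^{αβ} + μ̃_x^{αβ} + μ̌_x^{αβ}` where `μ̂` is supported in a neighborhood of the
origin contained in `B₁`, `μ̃` is a bounded measure supported in `B₁`, and `μ̌` is the
restriction to `ℝ^d ∖ B₁`, if Assumptions A–E hold for the new `μ̂` and the `μ̃` satisfy the
uniform mass bound and the weighted total-variation Lipschitz estimate, then comparison
holds for equation (E). -/
theorem comparison_principle_variant
    {d : ℕ} {A B : Type*} [Nonempty A] [Nonempty B]
    (O : Set (Euc d)) (hOopen : IsOpen O) (hObdd : Bornology.IsBounded O)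
    (hOconn : IsConnected O)
    (p : ℝ) (hp1 : 1 ≤ p) (hp2 : p ≤ 2)
    (μf μhat μtilde : Euc d → A → B → Measure (Euc d)) (c f : A → B → Euc d → ℝ)
    (hLevy : ∀ x ∈ O, ∀ (α : A) (β : B), IsLevyLp p (μf x α β))
    (hdecomp : ∀ x ∈ O, ∀ (α : A) (β : B),
      μf x α β = μhat x α β + μtilde x α β + (μf x α β).restrict (ball (0 : Euc d) 1)ᶜ)
    (hhat_supp : ∀ x ∈ O, ∀ (α : A) (β : B),
      ∃ U : Set (Euc d), U ∈ nhds (0 : Euc d) ∧ U ⊆ ball (0 : Euc d) 1 ∧ μhat x α β Uᶜ = 0)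
    (htilde_supp : ∀ x ∈ O, ∀ (α : A) (β : B), μtilde x α β (ball (0 : Euc d) 1)ᶜ = 0)
    (htilde_fin : ∀ x ∈ O, ∀ (α : A) (β : B), μtilde x α β univ < ⊤)
    (hA : AssumptionA O p μhat)
    (hB : AssumptionB O (fun x α β => (μf x α β).restrict (ball (0 : Euc d) 1)ᶜ))
    (hC : AssumptionC O f) (hD : AssumptionD O c) (hE : AssumptionE O p μf)
    (L₁ L₂ : ℝ) (hL₁ : 0 ≤ L₁) (hL₂ : 0 ≤ L₂)
    (hmutilde1 : ∀ x ∈ O, ∀ (α : A) (β : B),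
      μtilde x α β (ball (0 : Euc d) 1) ≤ ENNReal.ofReal L₁)
    (hmutilde2 : ∀ x ∈ O, ∀ y ∈ O, ∀ (α : A) (β : B),
      dTV ((μtilde x α β).withDensity (fun z => ENNReal.ofReal ‖z‖))
          ((μtilde y α β).withDensity (fun z => ENNReal.ofReal ‖z‖))
        ≤ ENNReal.ofReal (L₂ * ‖x - y‖))
    (u v : Euc d → ℝ) (hu : IsBUC u) (hv : IsBUC v)
    (hsub : IsSubsolution O (Iop μf c f) u)
    (hsup : IsSupersolution O (Iop μf c f) v)
    (hbc : ∀ x ∉ O, u x ≤ v x) :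
    ∀ x ∈ O, u x ≤ v x := by
  intro x' hx'
  by_contra! hlt
  have hp0 : 0 < p := one_pos.trans_le hp1
  obtain ⟨x₀, hm, hmax⟩ := exists_pos_max hu hv hObdd hbc hx' hlt
  set m := u x₀ - v x₀ with hm_def
  obtain ⟨CA, hCA0, hCA⟩ := hA
  obtain ⟨θB, hθB, hB⟩ := hB
  obtain ⟨θC, hθC, f₁, hf₁, hC, hf⟩ := hC
  obtain ⟨lam, lam₁, hlam, -, hcb, θD, hθD, hD⟩ := hD
  obtain ⟨⟨θE, hθE, hE⟩, Λ, hΛ, hμΛ⟩ := hE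
  obtain ⟨M, hvM⟩ := hv.1
  have hM0 : 0 ≤ M := (abs_nonneg _).trans (hvM 0)
  have hsplit : ∀ x ∈ O, ∀ α β, IsLevySplit p (μf x α β) (μhat x α β) (μtilde x α β) := by
    intro x hx α β
    obtain ⟨U, -, hU, hU0⟩ := hhat_supp x hx α β
    exact ⟨hLevy x hx α β, hdecomp x hx α β,
      measure_mono_null (compl_subset_compl.2 hU) hU0, htilde_supp x hx α β,
      htilde_fin x hx α β⟩
  obtain ⟨η, hη, hη1, hηm⟩ : ∃ η : ℝ, 0 < η ∧ η ≤ 1 ∧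
      η * (M + 13 + 4 * CA ^ p + 4 * L₁ + 2 * L₂ + 2 * Λ + 2 * (2 * M + 1)) < lam * m := by
    have hS : 0 < M + 13 + 4 * CA ^ p + 4 * L₁ + 2 * L₂ + 2 * Λ + 2 * (2 * M + 1) := by positivity
    set S := M + 13 + 4 * CA ^ p + 4 * L₁ + 2 * L₂ + 2 * Λ + 2 * (2 * M + 1)
    have hlm : 0 < lam * m := mul_pos hlam hm
    refine ⟨min 1 (lam * m / (2 * S)), by positivity, min_le_left _ _, ?_⟩
    calc min 1 (lam * m / (2 * S)) * S ≤ lam * m / (2 * S) * S := by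
          gcongr
          exact min_le_right _ _
      _ = lam * m / 2 := by field_simp
      _ < lam * m := half_lt_self hlm
  obtain ⟨N, hN, hvN⟩ := exists_abs_sub_le_add_mul_norm hv hη
  obtain ⟨τ, hτ, hτη, hτN, hτB, hτC, hτD⟩ : ∃ τ : ℝ, 0 < τ ∧ τ ≤ η ∧ N * (L₂ * τ) ≤ η ∧
      θB τ ≤ η ∧ θC τ ≤ η ∧ θD τ ≤ η := by
    have h0 : ∀ᶠ s in nhdsWithin (0 : ℝ) (Ioi 0), 0 < s := self_mem_nhdsWithin
    have h1 : ∀ᶠ s in nhdsWithin (0 : ℝ) (Ioi 0), s < η := nhdsWithin_le_nhds (gt_mem_nhds hη)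
    have h2 : ∀ᶠ s in nhdsWithin (0 : ℝ) (Ioi 0), N * (L₂ * s) < η := by
      have : Tendsto (fun s : ℝ => N * (L₂ * s)) (nhds 0) (nhds (N * (L₂ * 0))) :=
        Continuous.tendsto (by fun_prop) 0
      rw [mul_zero, mul_zero] at this
      exact (this.mono_left nhdsWithin_le_nhds).eventually (gt_mem_nhds hη)
    obtain ⟨s, hs0, hs1, hs2, hs3, hs4, hs5⟩ :=
      (h0.and (h1.and (h2.and ((hθB.eventually_le hη).and
        ((hθC.eventually_le hη).and (hθD.eventually_le hη)))))).exists
    exact ⟨s, hs0, hs1.le, hs2.le, hs3, hs4, hs5⟩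
  obtain ⟨ψ, x, y, K, C, hψ, hx, hy, hK, hC0, hdbl, hψp, hψ2, hKτ, hPτ, hxyτ, hmxy⟩ :=
    exists_doubling_max hObdd hp1 hp2 hu hv hbc hm hm_def.symm hmax hτ
  obtain ⟨r, δ, hr, hr1, hδ, hδη, hCr, hErr⟩ := exists_levyErr_integral_le (ι := O × A × B)
    (μ := fun i => μf i.1 i.2.1 i.2.2) hp0 hp2 hθE
    (fun r hr i => hE r hr i.1 i.1.2 i.2.1 i.2.2) hΛ
    (fun i => hμΛ i.1 i.1.2 i.2.1 i.2.2) hC0 hη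
  obtain ⟨Φ, Θ, hΦ, hΦb, hΘ, hΘb, hΦx, hΦu, hΘy, hΘv, hle, hΦr, hΘr, hΘd, hΘl⟩ :=
    exists_test_pair hp0 hp2 hu hv hψ hK hC0 hdbl hψp hψ2 hr hδ
  have hI₁ : Iop μf c f Φ x ≤ 0 :=
    hsub Φ hΦ hΦb x hx (fun z => by linarith [hΦu z]) hΦx
  have hI₂ : 0 ≤ Iop μf c f Θ y :=
    hsup Θ hΘ hΘb y hy (fun z => by linarith [hΘv z]) hΘy
  obtain ⟨α, β, hα, hβ⟩ := exists_index_of_Iop hp0 hp2 hΦ hΦb hΘ hΘb hΛ hμΛ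
    (fun x hx α β => by
      rw [abs_of_nonneg (hlam.le.trans (hcb x hx α β).1)]
      exact (hcb x hx α β).2) hf hx hy hI₁ hI₂ hη
  have hsx := hsplit x hx α β
  have hsy := hsplit y hy α β
  have hfin : dLpPow p (μhat x α β) (μhat y α β) < ⊤ :=
    dLpPow_lt_top (Measure.absolutelyContinuous_of_le hsx.hat_le hsx.levy.1)
      (Measure.absolutelyContinuous_of_le hsy.hat_le hsy.levy.1)
      (hsx.lintegral_hat_lt_top hp0.le) (hsy.lintegral_hat_lt_top hp0.le)
  obtain ⟨γ, hγ, hJ⟩ := exists_admPlan_of_dLp_le hp0 hfin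
    (show 0 < η / (K + 1) by positivity) (hCA x hx y hy α β)
  have hL := Lop_sub_Lop_le_of_test_pair hp0 hp2 hsx hsy hΦ hΦb hΘ hΘb hΘd hΦx hΘy hΘv hvM
    (fun z => by
      have := hdbl (x + z) (y + z)
      rw [add_sub_add_right_eq_sub] at this
      linarith) hK hC0 hr hr1 hδ hδη hη1 hCr hN (hvN y) hle hΦr hΘr hΘl
    (hErr (⟨x, hx⟩, α, β)) (hErr (⟨y, hy⟩, α, β)) hγ (by positivity) hJ
    (by positivity) hL₁ (hmutilde2 x hx y hy α β) (hmutilde1 x hx α β) (hmutilde1 y hy α β)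
    (hθB.1 _) hΛ (hB x hx y hy α β) (hμΛ x hx α β)
  have hJ' : 4 * K * ((CA * ‖x - y‖) ^ p + η / (K + 1)) ≤ 4 * CA ^ p * η + 4 * η := by
    rw [Real.mul_rpow hCA0 (norm_nonneg _)]
    have h1 : K * (η / (K + 1)) ≤ η := by
      rw [mul_div_assoc', div_le_iff₀ (by positivity)]
      nlinarith
    have h2 : CA ^ p * (K * ‖x - y‖ ^ p) ≤ CA ^ p * η := by
      gcongr
      exact hKτ.trans hτη
    linarith
  have hD₁ : (N + ‖fderiv ℝ ψ (x - y)‖) * (L₂ * ‖x - y‖) ≤ η + L₂ * η := by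
    have h1 : N * (L₂ * ‖x - y‖) ≤ η :=
      (by gcongr : N * (L₂ * ‖x - y‖) ≤ N * (L₂ * τ)).trans hτN
    have h2 : L₂ * (‖fderiv ℝ ψ (x - y)‖ * ‖x - y‖) ≤ L₂ * η := by
      gcongr
      exact hPτ.trans hτη
    linarith
  have hD₂ : (2 * M + 1) * θB ‖x - y‖ ≤ (2 * M + 1) * η := by
    gcongr
    exact (hθB.2.1 hxyτ).trans hτB
  have hf' := (abs_le.1 ((hC x hx y hy α β).trans ((hθC.2.1 hxyτ).trans hτC))).1
  have hc' : -(η * M) ≤ (c α β x - c α β y) * v y := by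
    refine (abs_le.1 ?_).1
    rw [abs_mul]
    exact mul_le_mul ((hD x hx y hy α β).trans ((hθD.2.1 hxyτ).trans hτD)) (hvM y)
      (abs_nonneg _) hη.le
  have hcm : lam * m ≤ c α β x * (u x - v y) :=
    mul_le_mul (hcb x hx α β).1 hmxy hm.le (hlam.le.trans (hcb x hx α β).1)
  rw [hΦx] at hα
  rw [hΘy] at hβ
  linarith
end
end

section
/- For every p ∈ [1,2], d_{𝕃_p} defines a metric on M_p(ℝ^d): d_{𝕃_p}(μ,ν) ≥ 0 with equality if and only if μ = ν, d_{𝕃_p}(μ,ν) = d_{𝕃_p}(ν,μ), and d_{𝕃_p}(μ₁,μ₃) ≤ d_{𝕃_p}(μ₁,μ₂) + d_{𝕃_p}(μ₂,μ₃) for all μ₁, μ₂, μ₃ ∈ M_p(ℝ^d). -/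
open MeasureTheory Set Metric Filter
open scoped ENNReal NNReal

noncomputable section

variable {d : ℕ} {A B : Type*}

/-! ### Densities and push-forwards -/

theorem map_withDensity_comp {X Y : Type*} [MeasurableSpace X] [MeasurableSpace Y]
    {μ : Measure X} {f : X → Y} (hf : Measurable f) {g : Y → ℝ≥0∞} (hg : Measurable g) :
    (μ.withDensity (g ∘ f)).map f = (μ.map f).withDensity g := by
  ext s hs
  rw [Measure.map_apply hf hs, withDensity_apply _ (hf hs), withDensity_apply _ hs,
    setLIntegral_map hs hg hf]
  rfl

/-! ### Gluing of measures along a common marginal -/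

open ProbabilityTheory in
theorem exists_gluing_of_isFiniteMeasure {X Y Z : Type*} [MeasurableSpace X] [MeasurableSpace Y]
    [MeasurableSpace Z] [StandardBorelSpace X] [StandardBorelSpace Z] [Nonempty X] [Nonempty Z]
    (ρ : Measure (Y × X)) (σ : Measure (Y × Z)) [IsFiniteMeasure ρ] [IsFiniteMeasure σ]
    (h : ρ.fst = σ.fst) :
    ∃ π : Measure (Y × X × Z),
      π.map (fun q => (q.1, q.2.1)) = ρ ∧ π.map (fun q => (q.1, q.2.2)) = σ := by
  refine ⟨ρ.fst ⊗ₘ (ρ.condKernel ×ₖ σ.condKernel), ?_, ?_⟩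
  · have := Measure.compProd_map (μ := ρ.fst) (κ := ρ.condKernel ×ₖ σ.condKernel)
      (measurable_fst (α := X) (β := Z))
    rw [← Kernel.fst_eq, Kernel.fst_prod, ρ.disintegrate ρ.condKernel] at this
    exact this.symm
  · have := Measure.compProd_map (μ := ρ.fst) (κ := ρ.condKernel ×ₖ σ.condKernel)
      (measurable_snd (α := X) (β := Z))
    rw [← Kernel.snd_eq, Kernel.snd_prod, h, σ.disintegrate σ.condKernel] at this
    rw [h]
    exact this.symm

theorem isFiniteMeasure_withDensity_fst {Y T : Type*} [MeasurableSpace Y] [MeasurableSpace T]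
    {τ : Measure (Y × T)} {w : Y → ℝ≥0∞} (hw : Measurable w) (hwi : ∫⁻ y, w y ∂τ.fst ≠ ⊤) :
    IsFiniteMeasure (τ.withDensity (w ∘ Prod.fst)) := by
  refine isFiniteMeasure_withDensity ?_
  rwa [Measure.fst, lintegral_map hw measurable_fst] at hwi

theorem withDensity_fst_inv_same {Y T : Type*} [MeasurableSpace Y] [MeasurableSpace T]
    {τ : Measure (Y × T)} {w : Y → ℝ≥0∞} (hw : Measurable w)
    (hw0 : ∀ᵐ y ∂τ.fst, w y ≠ 0) (hwt : ∀ y, w y ≠ ⊤) :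
    (τ.withDensity (w ∘ Prod.fst)).withDensity (w⁻¹ ∘ Prod.fst) = τ :=
  withDensity_inv_same (hw.comp measurable_fst)
    (ae_of_ae_map measurable_fst.aemeasurable hw0) (ae_of_all _ fun _ => hwt _)

/-- Gluing of possibly infinite measures whose common marginal admits a positive integrable
weight `w`. -/
theorem exists_gluing {X Y Z : Type*} [MeasurableSpace X] [MeasurableSpace Y]
    [MeasurableSpace Z] [StandardBorelSpace X] [StandardBorelSpace Z] [Nonempty X] [Nonempty Z]
    (ρ : Measure (Y × X)) (σ : Measure (Y × Z)) (h : ρ.fst = σ.fst)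
    {w : Y → ℝ≥0∞} (hw : Measurable w) (hw0 : ∀ᵐ y ∂ρ.fst, w y ≠ 0) (hwt : ∀ y, w y ≠ ⊤)
    (hwi : ∫⁻ y, w y ∂ρ.fst ≠ ⊤) :
    ∃ π : Measure (Y × X × Z),
      π.map (fun q => (q.1, q.2.1)) = ρ ∧ π.map (fun q => (q.1, q.2.2)) = σ := by
  have hwσ0 := h ▸ hw0
  have := isFiniteMeasure_withDensity_fst hw hwi
  have := isFiniteMeasure_withDensity_fst hw (h ▸ hwi)
  obtain ⟨π, hπ₁, hπ₂⟩ := exists_gluing_of_isFiniteMeasure (ρ.withDensity (w ∘ Prod.fst))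
    (σ.withDensity (w ∘ Prod.fst)) (by
      rw [Measure.fst, Measure.fst, map_withDensity_comp measurable_fst hw,
        map_withDensity_comp measurable_fst hw]
      exact congrArg (·.withDensity w) h)
  refine ⟨π.withDensity (w⁻¹ ∘ Prod.fst), ?_, ?_⟩
  · have := map_withDensity_comp (μ := π) (f := fun q : Y × X × Z => (q.1, q.2.1))
      (by fun_prop) (hw.inv.comp measurable_fst)
    rw [hπ₁, withDensity_fst_inv_same hw hw0 hwt] at this
    exact this
  · have := map_withDensity_comp (μ := π) (f := fun q : Y × X × Z => (q.1, q.2.2))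
      (by fun_prop) (hw.inv.comp measurable_fst)
    rw [hπ₂, withDensity_fst_inv_same hw hwσ0 hwt] at this
    exact this

/-! ### Transport plans -/

theorem ofReal_norm_rpow {E : Type*} [SeminormedAddCommGroup E] {p : ℝ} (hp : 0 ≤ p) (x : E) :
    ENNReal.ofReal (‖x‖ ^ p) = ‖x‖ₑ ^ p := by
  rw [← ENNReal.ofReal_rpow_of_nonneg (norm_nonneg x) hp, ofReal_norm]

theorem Jp_eq_lintegral_enorm {p : ℝ} (hp : 0 ≤ p) (γ : Measure (Euc d × Euc d)) :
    Jp p γ = ∫⁻ q, ‖q.1 - q.2‖ₑ ^ p ∂γ := by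
  simp only [Jp, ofReal_norm_rpow hp]

theorem Jp_map {X : Type*} [MeasurableSpace X] {p : ℝ} (hp : 0 ≤ p) (μ : Measure X)
    {f : X → Euc d × Euc d} (hf : Measurable f) :
    Jp p (μ.map f) = ∫⁻ x, ‖(f x).1 - (f x).2‖ₑ ^ p ∂μ := by
  rw [Jp_eq_lintegral_enorm hp, lintegral_map (by fun_prop) hf]

theorem Jp_restrict_compl_zero {p : ℝ} (hp : 0 < p) (γ : Measure (Euc d × Euc d)) :
    Jp p (γ.restrict {0}ᶜ) = Jp p γ := by
  refine setLIntegral_eq_of_support_subset ?_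
  rintro q hq rfl
  simp [hp.ne'] at hq

theorem restrict_map_restrict_compl_zero {X Y : Type*} [MeasurableSpace X] [MeasurableSpace Y]
    [Zero X] [Zero Y] [MeasurableSingletonClass Y] {f : X → Y} (hf : Measurable f)
    (hf0 : f 0 = 0) (μ : Measure X) :
    ((μ.restrict {0}ᶜ).map f).restrict {0}ᶜ = (μ.map f).restrict {0}ᶜ := by
  have hs : MeasurableSet ({0}ᶜ : Set Y) := (measurableSet_singleton 0).compl
  rw [Measure.restrict_map hf hs, Measure.restrict_map hf hs, Measure.restrict_restrict (hf hs),
    inter_eq_left.2]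
  rintro x hx rfl
  exact hx hf0

theorem restrict_mem_AdmPlan {μ₁ μ₂ : Measure (Euc d)} {γ : Measure (Euc d × Euc d)}
    (h₁ : (γ.map Prod.fst).restrict {0}ᶜ = μ₁) (h₂ : (γ.map Prod.snd).restrict {0}ᶜ = μ₂) :
    γ.restrict {0}ᶜ ∈ AdmPlan μ₁ μ₂ := by
  refine ⟨?_, ?_, ?_⟩
  · change γ.restrict {0}ᶜ {0} = 0
    rw [Measure.restrict_apply (measurableSet_singleton 0)]
    simp
  · rw [restrict_map_restrict_compl_zero measurable_fst rfl, h₁]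
  · rw [restrict_map_restrict_compl_zero measurable_snd rfl, h₂]

theorem dLpPow_le_of_marginals {p : ℝ} (hp : 0 < p) {μ₁ μ₂ : Measure (Euc d)}
    {γ : Measure (Euc d × Euc d)}
    (h₁ : (γ.map Prod.fst).restrict {0}ᶜ = μ₁) (h₂ : (γ.map Prod.snd).restrict {0}ᶜ = μ₂) :
    dLpPow p μ₁ μ₂ ≤ Jp p γ :=
  (iInf₂_le _ (restrict_mem_AdmPlan h₁ h₂)).trans_eq (Jp_restrict_compl_zero hp γ)

theorem AdmPlan.swap {μ₁ μ₂ : Measure (Euc d)} {γ : Measure (Euc d × Euc d)}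
    (h : γ ∈ AdmPlan μ₁ μ₂) : γ.map Prod.swap ∈ AdmPlan μ₂ μ₁ := by
  refine ⟨?_, ?_, ?_⟩
  · rw [Measure.map_apply measurable_swap (measurableSet_singleton _), ← h.1]
    congr 1
    ext ⟨x, y⟩
    simp [and_comm]
  · rw [Measure.map_map measurable_fst measurable_swap]
    exact h.2.2
  · rw [Measure.map_map measurable_snd measurable_swap]
    exact h.2.1

theorem dLpPow_comm {p : ℝ} (hp : 0 ≤ p) (μ₁ μ₂ : Measure (Euc d)) :
    dLpPow p μ₁ μ₂ = dLpPow p μ₂ μ₁ := by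
  have key (μ ν : Measure (Euc d)) : dLpPow p μ ν ≤ dLpPow p ν μ := by
    refine le_iInf₂ fun γ hγ => (iInf₂_le _ (AdmPlan.swap hγ)).trans_eq ?_
    rw [Jp_map hp _ measurable_swap, Jp_eq_lintegral_enorm hp]
    simp only [Prod.fst_swap, Prod.snd_swap, enorm_sub_rev]
  exact (key _ _).antisymm (key _ _)

theorem IsMp.restrict_compl_zero {p : ℝ} {μ : Measure (Euc d)} (h : IsMp p μ) :
    μ.restrict {0}ᶜ = μ :=
  Measure.restrict_eq_self_of_ae_mem (measure_eq_zero_iff_ae_notMem.1 h.1.1)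

theorem dLpPow_self {p : ℝ} (hp : 0 < p) {μ : Measure (Euc d)} (h : IsMp p μ) :
    dLpPow p μ μ = 0 := by
  have hm : Measurable fun x : Euc d => (x, x) := by fun_prop
  refine le_antisymm ((dLpPow_le_of_marginals hp (γ := μ.map fun x => (x, x)) ?_ ?_).trans_eq ?_)
    zero_le
  · rw [Measure.map_map measurable_fst hm]
    exact (congrArg (Measure.restrict · _) Measure.map_id).trans h.restrict_compl_zero
  · rw [Measure.map_map measurable_snd hm]
    exact (congrArg (Measure.restrict · _) Measure.map_id).trans h.restrict_compl_zero
  · simp [Jp_map hp.le _ hm, hp]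

theorem restrict_map_zero {X Y : Type*} [MeasurableSpace X] [MeasurableSpace Y] [Zero Y]
    [MeasurableSingletonClass Y] (μ : Measure X) :
    (μ.map fun _ => (0 : Y)).restrict {0}ᶜ = 0 := by
  rw [Measure.restrict_eq_zero, Measure.map_apply measurable_const
    (measurableSet_singleton 0).compl]
  simp

/-- Sending all the mass to the origin shows that the transport cost is finite. -/
theorem dLpPow_lt_top_s5 {p : ℝ} (hp : 0 < p) {μ₁ μ₂ : Measure (Euc d)}
    (h₁ : IsMp p μ₁) (h₂ : IsMp p μ₂) : dLpPow p μ₁ μ₂ < ⊤ := by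
  have hm₁ : Measurable fun x : Euc d => (x, (0 : Euc d)) := by fun_prop
  have hm₂ : Measurable fun y : Euc d => ((0 : Euc d), y) := by fun_prop
  refine (dLpPow_le_of_marginals hp
    (γ := μ₁.map (fun x => (x, 0)) + μ₂.map (fun y => (0, y))) ?_ ?_).trans_lt ?_
  · rw [Measure.map_add _ _ measurable_fst, Measure.map_map measurable_fst hm₁,
      Measure.map_map measurable_fst hm₂, Measure.restrict_add]
    simp only [Function.comp_def, Measure.map_id', h₁.restrict_compl_zero, restrict_map_zero,
      add_zero]
  · rw [Measure.map_add _ _ measurable_snd, Measure.map_map measurable_snd hm₁,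
      Measure.map_map measurable_snd hm₂, Measure.restrict_add]
    simp only [Function.comp_def, Measure.map_id', h₂.restrict_compl_zero, restrict_map_zero,
      zero_add]
  · have hJ : Jp p (μ₁.map (fun x => (x, 0)) + μ₂.map (fun y => (0, y))) =
        Jp p (μ₁.map fun x => (x, 0)) + Jp p (μ₂.map fun y => (0, y)) :=
      lintegral_add_measure _ _ _
    rw [hJ, Jp_map hp.le _ hm₁, Jp_map hp.le _ hm₂]
    simpa [← ofReal_norm_rpow hp.le] using ⟨h₁.2, h₂.2⟩

/-! ### The distance separates points -/

theorem IsMp.measure_norm_ge_lt_top {p : ℝ} (hp : 0 < p) {μ : Measure (Euc d)} (h : IsMp p μ)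
    {r : ℝ} (hr : 0 < r) : μ {x | r ≤ ‖x‖} < ⊤ := by
  have hε : ENNReal.ofReal (r ^ p) ≠ 0 := by simpa using Real.rpow_pos_of_pos hr p
  refine (measure_mono fun x hx => ?_).trans_lt
    ((meas_ge_le_lintegral_div (f := fun x : Euc d => ENNReal.ofReal (‖x‖ ^ p)) (by fun_prop) hε
      ENNReal.ofReal_ne_top).trans_lt (ENNReal.div_lt_top h.2.ne hε))
  exact ENNReal.ofReal_le_ofReal (Real.rpow_le_rpow hr.le hx hp.le)

theorem AdmPlan.measure_eq_fst {μ₁ μ₂ : Measure (Euc d)} {γ : Measure (Euc d × Euc d)}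
    (h : γ ∈ AdmPlan μ₁ μ₂) {s : Set (Euc d)} (hs : MeasurableSet s) (h0 : (0 : Euc d) ∉ s) :
    μ₁ s = γ (Prod.fst ⁻¹' s) := by
  rw [← h.2.1, Measure.restrict_apply hs, inter_eq_left.2 (by simpa using h0),
    Measure.map_apply measurable_fst hs]

theorem AdmPlan.measure_eq_snd {μ₁ μ₂ : Measure (Euc d)} {γ : Measure (Euc d × Euc d)}
    (h : γ ∈ AdmPlan μ₁ μ₂) {s : Set (Euc d)} (hs : MeasurableSet s) (h0 : (0 : Euc d) ∉ s) :
    μ₂ s = γ (Prod.snd ⁻¹' s) := by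
  rw [← h.2.2, Measure.restrict_apply hs, inter_eq_left.2 (by simpa using h0),
    Measure.map_apply measurable_snd hs]

theorem measure_le_measure_cthickening {p : ℝ} (hp : 0 < p) {μ₁ μ₂ : Measure (Euc d)}
    (h : dLpPow p μ₁ μ₂ = 0) {F : Set (Euc d)} (hF : IsClosed F) {δ : ℝ} (hδ : 0 < δ)
    (h0 : (0 : Euc d) ∉ cthickening δ F) : μ₁ F ≤ μ₂ (cthickening δ F) := by
  set ε := ENNReal.ofReal (δ ^ p)
  have hε : ε ≠ 0 := by simpa [ε] using Real.rpow_pos_of_pos hδ p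
  have hcost (γ) (hγ : γ ∈ AdmPlan μ₁ μ₂) : μ₁ F ≤ μ₂ (cthickening δ F) + Jp p γ / ε := by
    rw [AdmPlan.measure_eq_fst hγ hF.measurableSet fun hx => h0 (self_subset_cthickening F hx),
      AdmPlan.measure_eq_snd hγ isClosed_cthickening.measurableSet h0]
    refine (measure_mono (t := Prod.snd ⁻¹' cthickening δ F ∪
      {q | ε ≤ ENNReal.ofReal (‖q.1 - q.2‖ ^ p)}) ?_).trans ((measure_union_le _ _).trans ?_)
    · rintro ⟨x, y⟩ hx
      by_cases hxy : ‖x - y‖ ≤ δ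
      · exact Or.inl (mem_cthickening_of_dist_le y x δ F hx (by rwa [dist_comm, dist_eq_norm]))
      · exact Or.inr (ENNReal.ofReal_le_ofReal
          (Real.rpow_le_rpow hδ.le (not_le.1 hxy).le hp.le))
    · gcongr
      exact meas_ge_le_lintegral_div (by fun_prop) hε ENNReal.ofReal_ne_top
  have : μ₁ F ≤ μ₂ (cthickening δ F) + dLpPow p μ₁ μ₂ / ε := by
    simp only [dLpPow, div_eq_mul_inv]
    rw [ENNReal.iInf_mul_of_ne (ENNReal.inv_ne_zero.2 ENNReal.ofReal_ne_top)
      (ENNReal.inv_ne_top.2 hε), ENNReal.add_iInf]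
    refine le_iInf fun γ => ?_
    rw [ENNReal.iInf_mul_of_ne (ENNReal.inv_ne_zero.2 ENNReal.ofReal_ne_top)
      (ENNReal.inv_ne_top.2 hε), ENNReal.add_iInf]
    exact le_iInf fun hγ => hcost γ hγ
  simpa [h] using this

theorem measure_le_of_dLpPow_eq_zero {p : ℝ} (hp : 0 < p) {μ₁ μ₂ : Measure (Euc d)}
    (h₂ : IsMp p μ₂) (h : dLpPow p μ₁ μ₂ = 0) {F : Set (Euc d)} (hF : IsClosed F)
    {r : ℝ} (hr : 0 < r) (hFr : F ⊆ {x | r ≤ ‖x‖}) : μ₁ F ≤ μ₂ F := by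
  have hthick {δ : ℝ} (hδ : δ ≤ r / 2) : cthickening δ F ⊆ {x | r / 2 ≤ ‖x‖} := by
    intro x hx
    have hball : cthickening δ F ⊆ cthickening (r / 2) {x : Euc d | r ≤ ‖x‖} :=
      (cthickening_mono hδ F).trans (cthickening_subset_of_subset _ hFr)
    have hle : infDist x {x : Euc d | r ≤ ‖x‖} ≤ r / 2 := by
      refine ENNReal.toReal_le_of_le_ofReal (by positivity) (hball hx)
    have hne : ({x : Euc d | r ≤ ‖x‖}).Nonempty := by
      rcases F.eq_empty_or_nonempty with rfl | hne
      · simp at hx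
      · exact hne.mono hFr
    change r / 2 ≤ ‖x‖
    refine le_of_forall_pos_le_add fun ε hε => ?_
    obtain ⟨y, hy, hxy⟩ := (infDist_lt_iff hne).1 (hle.trans_lt (lt_add_of_pos_right (r / 2) hε))
    have h1 : r ≤ ‖y‖ := hy
    have h2 : ‖y‖ ≤ ‖x‖ + dist x y := by
      rw [dist_comm, dist_eq_norm]
      simpa using norm_add_le x (y - x)
    linarith
  have hlim : Tendsto (fun δ => μ₂ (cthickening δ F)) (nhdsWithin 0 (Ioi 0)) (nhds (μ₂ F)) :=
    (tendsto_measure_cthickening_of_isClosed ⟨r / 2, by positivity,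
      ((measure_mono (hthick le_rfl)).trans_lt
        (h₂.measure_norm_ge_lt_top hp (by positivity))).ne⟩ hF).mono_left nhdsWithin_le_nhds
  refine ge_of_tendsto hlim ?_
  filter_upwards [Ioc_mem_nhdsGT (half_pos hr)] with δ hδ
  refine measure_le_measure_cthickening hp h hF hδ.1 fun h0 => ?_
  have : r / 2 ≤ ‖(0 : Euc d)‖ := hthick hδ.2 h0
  rw [norm_zero] at this
  linarith

theorem eq_of_dLpPow_eq_zero {p : ℝ} (hp : 0 < p) {μ₁ μ₂ : Measure (Euc d)}
    (h₁ : IsMp p μ₁) (h₂ : IsMp p μ₂) (h : dLpPow p μ₁ μ₂ = 0) : μ₁ = μ₂ := by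
  have hclosed {F : Set (Euc d)} (hF : IsClosed F) {r : ℝ} (hr : 0 < r)
      (hFr : F ⊆ {x | r ≤ ‖x‖}) : μ₁ F = μ₂ F :=
    (measure_le_of_dLpPow_eq_zero hp h₂ h hF hr hFr).antisymm
      (measure_le_of_dLpPow_eq_zero hp h₁ (dLpPow_comm hp.le μ₁ μ₂ ▸ h) hF hr hFr)
  have hann {r : ℝ} (hr : 0 < r) :
      μ₁.restrict {x | r ≤ ‖x‖} = μ₂.restrict {x | r ≤ ‖x‖} := by
    have hc : IsClosed {x : Euc d | r ≤ ‖x‖} := isClosed_le continuous_const continuous_norm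
    have : IsFiniteMeasure (μ₁.restrict {x | r ≤ ‖x‖}) :=
      isFiniteMeasure_restrict.2 (h₁.measure_norm_ge_lt_top hp hr).ne
    refine ext_of_generate_finite _
      ((BorelSpace.measurable_eq).trans borel_eq_generateFrom_isClosed) isPiSystem_isClosed
      (fun F hF => ?_) ?_
    · rw [Measure.restrict_apply (IsClosed.measurableSet hF),
        Measure.restrict_apply (IsClosed.measurableSet hF)]
      exact hclosed (IsClosed.inter hF hc) hr inter_subset_right
    · simpa using hclosed hc hr Subset.rfl
  rw [← h₁.restrict_compl_zero, ← h₂.restrict_compl_zero]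
  have hU : ({0}ᶜ : Set (Euc d)) = ⋃ n : ℕ, {x | 1 / ((n : ℝ) + 1) ≤ ‖x‖} := by
    ext x
    simp only [mem_compl_iff, mem_singleton_iff, mem_iUnion, mem_ofPred_eq]
    constructor
    · intro hx
      obtain ⟨n, hn⟩ := exists_nat_one_div_lt (norm_pos_iff.2 hx)
      exact ⟨n, hn.le⟩
    · rintro ⟨n, hn⟩
      exact norm_pos_iff.1 ((by positivity : (0 : ℝ) < 1 / ((n : ℝ) + 1)).trans_le hn)
  rw [hU, Measure.restrict_iUnion_congr]
  exact fun n => hann (by positivity)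

/-! ### The triangle inequality -/

/-- Gluing of transport plans; the first coordinate is the intermediate point. -/
theorem exists_glued_plan {p : ℝ} {μ₁ μ₂ μ₃ : Measure (Euc d)} (h₂ : IsMp p μ₂)
    {γ η : Measure (Euc d × Euc d)} (hγ : γ ∈ AdmPlan μ₁ μ₂) (hη : η ∈ AdmPlan μ₂ μ₃) :
    ∃ π : Measure (Euc d × Euc d × Euc d),
      (π.map fun q => (q.2.1, q.1)).restrict {0}ᶜ = γ ∧
      (π.map fun q => (q.1, q.2.2)).restrict {0}ᶜ = η := by
  have hs : MeasurableSet ({0}ᶜ : Set (Euc d)) := (measurableSet_singleton 0).compl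
  have hS : MeasurableSet (Prod.snd ⁻¹' {0}ᶜ : Set (Euc d × Euc d)) := measurable_snd hs
  have hF : MeasurableSet (Prod.fst ⁻¹' {0}ᶜ : Set (Euc d × Euc d)) := measurable_fst hs
  set γ₁ := γ.restrict (Prod.snd ⁻¹' {0}ᶜ)
  set γ₀ := γ.restrict (Prod.snd ⁻¹' {0}ᶜ)ᶜ
  set η₁ := η.restrict (Prod.fst ⁻¹' {0}ᶜ)
  set η₀ := η.restrict (Prod.fst ⁻¹' {0}ᶜ)ᶜ
  have hρ : (γ₁.map Prod.swap).fst = μ₂ := by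
    rw [Measure.fst_map_swap, Measure.snd, ← Measure.restrict_map measurable_snd hs, hγ.2.2]
  have hσ : η₁.fst = μ₂ := by
    rw [Measure.fst, ← Measure.restrict_map measurable_fst hs, hη.2.1]
  have hw0 : ∀ᵐ y ∂μ₂, ENNReal.ofReal (‖y‖ ^ p) ≠ 0 := by
    filter_upwards [measure_eq_zero_iff_ae_notMem.1 h₂.1.1] with y hy
    simpa using Real.rpow_pos_of_pos (norm_pos_iff.2 hy) p
  obtain ⟨π, hπ₁, hπ₂⟩ := exists_gluing (γ₁.map Prod.swap) η₁ (hρ.trans hσ.symm)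
    (w := fun y => ENNReal.ofReal (‖y‖ ^ p)) (by fun_prop) (by rwa [hρ])
    (fun _ => ENNReal.ofReal_ne_top) (by rw [hρ]; exact h₂.2.ne)
  have hm₁₂ : Measurable fun q : Euc d × Euc d × Euc d => (q.2.1, q.1) := by fun_prop
  have hm₂₃ : Measurable fun q : Euc d × Euc d × Euc d => (q.1, q.2.2) := by fun_prop
  have hmγ : Measurable fun q : Euc d × Euc d => ((0 : Euc d), q.1, (0 : Euc d)) := by fun_prop
  have hmη : Measurable fun q : Euc d × Euc d => ((0 : Euc d), (0 : Euc d), q.2) := by fun_prop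
  have hγ₀ : γ₀.map (fun q => (q.1, (0 : Euc d))) = γ₀ := by
    refine (Measure.map_congr ?_).trans Measure.map_id
    filter_upwards [ae_restrict_mem hS.compl] with q hq
    exact Prod.ext rfl (not_not.1 hq).symm
  have hη₀ : η₀.map (fun q => ((0 : Euc d), q.2)) = η₀ := by
    refine (Measure.map_congr ?_).trans Measure.map_id
    filter_upwards [ae_restrict_mem hF.compl] with q hq
    exact Prod.ext (not_not.1 hq).symm rfl
  have hπγ : π.map (fun q => (q.2.1, q.1)) = γ₁ := by
    have := congrArg (Measure.map Prod.swap) hπ₁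
    rwa [Measure.map_map measurable_swap (by fun_prop),
      Measure.map_map measurable_swap measurable_swap, Prod.swap_swap_eq, Measure.map_id] at this
  have hdiag {τ : Measure (Euc d × Euc d)} (hτ : τ {((0 : Euc d), (0 : Euc d))} = 0) :
      τ.restrict {0}ᶜ = τ :=
    Measure.restrict_eq_self_of_ae_mem (measure_eq_zero_iff_ae_notMem.1 hτ)
  refine ⟨π + γ₀.map (fun q => (0, q.1, 0)) + η₀.map (fun q => (0, 0, q.2)), ?_, ?_⟩
  · rw [Measure.map_add _ _ hm₁₂, Measure.map_add _ _ hm₁₂, Measure.map_map hm₁₂ hmγ,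
      Measure.map_map hm₁₂ hmη, hπγ]
    simp only [Function.comp_def]
    rw [hγ₀, Measure.restrict_add_restrict_compl hS, Measure.restrict_add, hdiag hγ.1]
    exact (congrArg (γ + ·) (restrict_map_zero η₀)).trans (add_zero γ)
  · rw [Measure.map_add _ _ hm₂₃, Measure.map_add _ _ hm₂₃, Measure.map_map hm₂₃ hmγ,
      Measure.map_map hm₂₃ hmη, hπ₂]
    simp only [Function.comp_def]
    rw [hη₀, add_right_comm, Measure.restrict_add_restrict_compl hF, Measure.restrict_add,
      hdiag hη.1]
    exact (congrArg (η + ·) (restrict_map_zero γ₀)).trans (add_zero η)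

theorem dLpPow_triangle {p : ℝ} (hp : 1 ≤ p) {μ₁ μ₂ μ₃ : Measure (Euc d)} (h₂ : IsMp p μ₂) :
    dLpPow p μ₁ μ₃ ^ (1 / p) ≤ dLpPow p μ₁ μ₂ ^ (1 / p) + dLpPow p μ₂ μ₃ ^ (1 / p) := by
  have hp0 : 0 < p := zero_lt_one.trans_le hp
  have hpow (μ ν : Measure (Euc d)) :
      dLpPow p μ ν ^ (1 / p) = ⨅ γ ∈ AdmPlan μ ν, Jp p γ ^ (1 / p) := by
    have := (ENNReal.orderIsoRpow (1 / p) (by positivity)).map_iInf₂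
      fun γ (_ : γ ∈ AdmPlan μ ν) => Jp p γ
    simpa only [dLpPow, ENNReal.orderIsoRpow_apply] using this
  rw [hpow μ₁ μ₂, hpow μ₂ μ₃]
  refine ENNReal.le_iInf₂_add_iInf₂ fun γ hγ η hη => ?_
  obtain ⟨π, hπγ, hπη⟩ := exists_glued_plan h₂ hγ hη
  have hm₁₂ : Measurable fun q : Euc d × Euc d × Euc d => (q.2.1, q.1) := by fun_prop
  have hm₂₃ : Measurable fun q : Euc d × Euc d × Euc d => (q.1, q.2.2) := by fun_prop
  have hm₁₃ : Measurable fun q : Euc d × Euc d × Euc d => (q.2.1, q.2.2) := by fun_prop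
  have hle : dLpPow p μ₁ μ₃ ≤ Jp p (π.map fun q => (q.2.1, q.2.2)) := by
    refine dLpPow_le_of_marginals hp0 ?_ ?_
    · rw [← hγ.2.1, ← hπγ, restrict_map_restrict_compl_zero measurable_fst rfl,
        Measure.map_map measurable_fst hm₁₂, Measure.map_map measurable_fst hm₁₃]
      rfl
    · rw [← hη.2.2, ← hπη, restrict_map_restrict_compl_zero measurable_snd rfl,
        Measure.map_map measurable_snd hm₂₃, Measure.map_map measurable_snd hm₁₃]
      rfl
  have hJγ : Jp p γ = ∫⁻ q, ‖q.2.1 - q.1‖ₑ ^ p ∂π := by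
    rw [← hπγ, Jp_restrict_compl_zero hp0, Jp_map hp0.le _ hm₁₂]
  have hJη : Jp p η = ∫⁻ q, ‖q.1 - q.2.2‖ₑ ^ p ∂π := by
    rw [← hπη, Jp_restrict_compl_zero hp0, Jp_map hp0.le _ hm₂₃]
  rw [hJγ, hJη]
  rw [Jp_map hp0.le _ hm₁₃] at hle
  refine (ENNReal.rpow_le_rpow (hle.trans (lintegral_mono fun q => ?_)) (by positivity)).trans
    (ENNReal.lintegral_Lp_add_le (f := fun q : Euc d × Euc d × Euc d => ‖q.2.1 - q.1‖ₑ)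
      (g := fun q => ‖q.1 - q.2.2‖ₑ) (by fun_prop) (by fun_prop) hp)
  refine ENNReal.rpow_le_rpow ?_ hp0.le
  simpa using enorm_add_le (q.2.1 - q.1) (q.1 - q.2.2)

/-- Theorem A.9: for every `p ∈ [1,2]`, `d_{𝕃_p}` defines a metric on `M_p(ℝ^d)`:
nonnegativity, vanishing exactly on the diagonal, symmetry, and the triangle inequality. -/
theorem dLp_is_metric
    {d : ℕ} (p : ℝ) (hp1 : 1 ≤ p) (hp2 : p ≤ 2)
    (μ₁ μ₂ μ₃ : Measure (Euc d))
    (h₁ : IsMp p μ₁) (h₂ : IsMp p μ₂) (h₃ : IsMp p μ₃) :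
    0 ≤ dLp p μ₁ μ₂ ∧
    (dLp p μ₁ μ₂ = 0 ↔ μ₁ = μ₂) ∧
    dLp p μ₁ μ₂ = dLp p μ₂ μ₁ ∧
    dLp p μ₁ μ₃ ≤ dLp p μ₁ μ₂ + dLp p μ₂ μ₃ := by
  have hp0 : 0 < p := zero_lt_one.trans_le hp1
  have h12 := (dLpPow_lt_top_s5 hp0 h₁ h₂).ne
  have h23 := (dLpPow_lt_top_s5 hp0 h₂ h₃).ne
  refine ⟨by unfold dLp; positivity, ⟨fun h => ?_, ?_⟩, ?_, ?_⟩
  · rw [dLp, Real.rpow_eq_zero ENNReal.toReal_nonneg (by positivity),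
      ENNReal.toReal_eq_zero_iff, or_iff_left h12] at h
    exact eq_of_dLpPow_eq_zero hp0 h₁ h₂ h
  · rintro rfl
    rw [dLp, dLpPow_self hp0 h₁, ENNReal.toReal_zero, Real.zero_rpow (by positivity)]
  · rw [dLp, dLp, dLpPow_comm hp0.le]
  · have hq : 0 ≤ 1 / p := by positivity
    simp only [dLp, ENNReal.toReal_rpow]
    rw [← ENNReal.toReal_add (ENNReal.rpow_ne_top_of_nonneg hq h12)
      (ENNReal.rpow_ne_top_of_nonneg hq h23)]
    exact ENNReal.toReal_mono (ENNReal.add_ne_top.2 ⟨ENNReal.rpow_ne_top_of_nonneg hq h12,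
      ENNReal.rpow_ne_top_of_nonneg hq h23⟩) (dLpPow_triangle hp1 h₂)
end
end

section
/- Let 1 ≤ p ≤ 2 and μ₁, μ₂ ∈ M_p(ℝ^d). Then there is at least one γ* ∈ Adm(μ₁,μ₂) with J_p(γ*) := ∫ |x−y|^p dγ*(x,y) < ∞, and there exists at least one γ ∈ Adm(μ₁,μ₂) that achieves the minimum value of J_p over Adm(μ₁,μ₂). -/
open MeasureTheory Set Metric Filter
open scoped ENNReal NNReal

noncomputable section

variable {d : ℕ} {A B : Type*}

/-- The weight `min(1, |z|^p)`, as a nonnegative real. -/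
def levyWeight (p : ℝ) (z : Euc d) : ℝ≥0 := min 1 (‖z‖₊ ^ p)

/-- The weight `min(1, |x|^p) + min(1, |y|^p)` on the product space. -/
def planWeight (p : ℝ) (q : Euc d × Euc d) : ℝ≥0 := levyWeight p q.1 + levyWeight p q.2

lemma continuous_levyWeight {p : ℝ} (hp : 0 < p) : Continuous (levyWeight (d := d) p) :=
  continuous_const.min ((NNReal.continuous_rpow_const hp.le).comp continuous_nnnorm)

lemma continuous_planWeight {p : ℝ} (hp : 0 < p) : Continuous (planWeight (d := d) p) :=
  ((continuous_levyWeight hp).comp continuous_fst).add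
    ((continuous_levyWeight hp).comp continuous_snd)

lemma levyWeight_le_one (p : ℝ) (z : Euc d) : levyWeight p z ≤ 1 := min_le_left _ _

lemma levyWeight_eq_zero {p : ℝ} (hp : 0 < p) {z : Euc d} : levyWeight p z = 0 ↔ z = 0 := by
  rw [levyWeight, ← bot_eq_zero, min_eq_bot]
  simp [hp.ne']

lemma levyWeight_zero {p : ℝ} (hp : 0 < p) : levyWeight p (0 : Euc d) = 0 :=
  (levyWeight_eq_zero hp).2 rfl

lemma planWeight_eq_zero {p : ℝ} (hp : 0 < p) {q : Euc d × Euc d} :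
    planWeight p q = 0 ↔ q = 0 := by
  simp [planWeight, levyWeight_eq_zero hp, Prod.ext_iff]

lemma levyWeight_eq_one {p : ℝ} (hp : 0 < p) {z : Euc d} (hz : 1 ≤ ‖z‖) : levyWeight p z = 1 :=
  min_eq_left (NNReal.one_le_rpow hz hp.le)

lemma IsLevyLp.lintegral_levyWeight_lt_top {p : ℝ} {μ : Measure (Euc d)} (h : IsLevyLp p μ) :
    ∫⁻ z, levyWeight p z ∂μ < ⊤ := by
  refine lt_of_eq_of_lt (lintegral_congr fun z => ?_) h.2
  rw [← ENNReal.ofReal_coe_nnreal]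
  simp [levyWeight]

/-- A continuous function dominated by `planWeight` times a bounded continuous function vanishing
at the origin is the product of `planWeight` and such a function. -/
lemma exists_planWeight_mul_eq {p : ℝ} (hp : 0 < p) {g h : Euc d × Euc d → ℝ≥0}
    (hg : Continuous g) (hh : Continuous h) (h0 : h 0 = 0) {C : ℝ≥0} (hC : ∀ q, h q ≤ C)
    (hgh : ∀ q, g q ≤ planWeight p q * h q) :
    ∃ k : BoundedContinuousFunction (Euc d × Euc d) ℝ≥0,
      k 0 = 0 ∧ ∀ q, planWeight p q * k q = g q := by
  have hw0 : planWeight p (0 : Euc d × Euc d) = 0 := (planWeight_eq_zero hp).2 rfl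
  have hle : ∀ q, g q / planWeight p q ≤ h q := fun q => by
    rcases eq_or_ne (planWeight p q) 0 with hq | hq
    · simp [hq]
    · rw [div_le_iff₀ (pos_iff_ne_zero.2 hq), mul_comm]
      exact hgh q
  have hcont : Continuous fun q => g q / planWeight p q := by
    rw [continuous_iff_continuousAt]
    intro q
    rcases eq_or_ne q 0 with rfl | hq
    · have hh' : Tendsto h (nhds 0) (nhds 0) := by
        simpa [h0] using hh.tendsto 0
      simpa [ContinuousAt, hw0] using
        tendsto_of_tendsto_of_tendsto_of_le_of_le tendsto_const_nhds hh'
          (fun q => zero_le (a := g q / planWeight p q)) hle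
    · exact hg.continuousAt.div (continuous_planWeight hp).continuousAt
        (mt (planWeight_eq_zero hp).1 hq)
  refine ⟨.mkOfBound ⟨_, hcont⟩ C fun x y => ?_, by simp [hw0], fun q => ?_⟩
  · have hx : ((g x / planWeight p x : ℝ≥0) : ℝ) ≤ C := by exact_mod_cast (hle x).trans (hC x)
    have hy : ((g y / planWeight p y : ℝ≥0) : ℝ) ≤ C := by exact_mod_cast (hle y).trans (hC y)
    rw [NNReal.dist_eq, abs_sub_le_iff]
    constructor
    · exact (sub_le_self _ (NNReal.coe_nonneg _)).trans hx
    · exact (sub_le_self _ (NNReal.coe_nonneg _)).trans hy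
  · rcases eq_or_ne (planWeight p q) 0 with hq | hq
    · have := hgh q
      simp_all
    · exact mul_div_cancel₀ _ hq

lemma lintegral_restrict_compl_zero (ν : Measure (Euc d)) {f : Euc d → ℝ≥0∞} (h0 : f 0 = 0) :
    ∫⁻ x, f x ∂(ν.restrict {0}ᶜ) = ∫⁻ x, f x ∂ν :=
  setLIntegral_eq_of_support_subset fun x hx => by
    rintro rfl
    exact hx h0

lemma lintegral_fst_of_mem_admPlan {μ₁ μ₂ : Measure (Euc d)} {γ : Measure (Euc d × Euc d)}
    (hγ : γ ∈ AdmPlan μ₁ μ₂) {f : Euc d → ℝ≥0∞} (hf : Measurable f) (h0 : f 0 = 0) :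
    ∫⁻ q, f q.1 ∂γ = ∫⁻ x, f x ∂μ₁ := by
  rw [← hγ.2.1, lintegral_restrict_compl_zero _ h0, lintegral_map hf measurable_fst]

lemma lintegral_snd_of_mem_admPlan {μ₁ μ₂ : Measure (Euc d)} {γ : Measure (Euc d × Euc d)}
    (hγ : γ ∈ AdmPlan μ₁ μ₂) {f : Euc d → ℝ≥0∞} (hf : Measurable f) (h0 : f 0 = 0) :
    ∫⁻ q, f q.2 ∂γ = ∫⁻ x, f x ∂μ₂ := by
  rw [← hγ.2.2, lintegral_restrict_compl_zero _ h0, lintegral_map hf measurable_snd]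

/-- A Lévy measure is determined away from the origin by its integrals against the functions
`f * levyWeight p ^ 2` with `f` bounded and continuous. -/
lemma IsLevyLp.restrict_eq_of_forall_lintegral_eq {p : ℝ} (hp : 0 < p) {μ ν : Measure (Euc d)}
    (hμ : IsLevyLp p μ)
    (h : ∀ f : BoundedContinuousFunction (Euc d) ℝ≥0,
      ∫⁻ x, (f x * levyWeight p x ^ 2 : ℝ≥0) ∂ν = ∫⁻ x, (f x * levyWeight p x ^ 2 : ℝ≥0) ∂μ) :
    ν.restrict {0}ᶜ = μ := by
  set ρ : Euc d → ℝ≥0∞ := fun x => (levyWeight p x ^ 2 : ℝ≥0)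
  have hρ : Measurable ρ := ((continuous_levyWeight hp).pow 2).measurable.coe_nnreal_ennreal
  have hμr : μ.restrict {0}ᶜ = μ := Measure.restrict_eq_self_of_ae_mem <| by
    rw [ae_iff]; simpa using hμ.1
  have hρ1 : ∀ x, ρ x ≤ levyWeight p x := fun x => by
    have := mul_le_of_le_one_left (zero_le (a := levyWeight p x)) (levyWeight_le_one p x)
    exact ENNReal.coe_le_coe.2 ((sq (levyWeight p x)).trans_le this)
  have : IsFiniteMeasure (μ.withDensity ρ) := isFiniteMeasure_withDensity
    ((lintegral_mono hρ1).trans_lt hμ.lintegral_levyWeight_lt_top).ne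
  have hdens : μ.withDensity ρ = ν.withDensity ρ := by
    refine ext_of_forall_lintegral_eq_of_IsFiniteMeasure fun f => ?_
    have hf : Measurable fun x => (f x : ℝ≥0∞) := f.continuous.measurable.coe_nnreal_ennreal
    rw [lintegral_withDensity_eq_lintegral_mul _ hρ hf,
      lintegral_withDensity_eq_lintegral_mul _ hρ hf]
    simpa [ρ, mul_comm] using (h f).symm
  have hinv : ∀ κ : Measure (Euc d),
      ((κ.restrict {0}ᶜ).withDensity ρ).withDensity (fun x => (ρ x)⁻¹) = κ.restrict {0}ᶜ :=
    fun κ => withDensity_inv_same hρ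
      ((ae_restrict_mem (measurableSet_singleton _).compl).mono fun x hx => by
        simpa [ρ, levyWeight_eq_zero hp] using hx)
      (ae_of_all _ fun x => ENNReal.coe_ne_top)
  rw [← hinv ν, ← restrict_withDensity (measurableSet_singleton _).compl, ← hdens,
    restrict_withDensity (measurableSet_singleton _).compl, hinv μ, hμr]

/-- The image of an admissible plan under multiplication by `planWeight`. -/
def weightedPlan (p : ℝ) (γ : Measure (Euc d × Euc d)) : Measure (Euc d × Euc d) :=
  γ.withDensity fun q => (planWeight p q : ℝ≥0∞)

lemma lintegral_weightedPlan {p : ℝ} (hp : 0 < p) (γ : Measure (Euc d × Euc d))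
    (k : BoundedContinuousFunction (Euc d × Euc d) ℝ≥0) :
    ∫⁻ q, k q ∂(weightedPlan p γ) = ∫⁻ q, (planWeight p q * k q : ℝ≥0) ∂γ := by
  rw [weightedPlan, lintegral_withDensity_eq_lintegral_mul _
    (continuous_planWeight hp).measurable.coe_nnreal_ennreal
    k.continuous.measurable.coe_nnreal_ennreal]
  simp

lemma weightedPlan_univ {p : ℝ} (hp : 0 < p) {μ₁ μ₂ : Measure (Euc d)}
    {γ : Measure (Euc d × Euc d)} (hγ : γ ∈ AdmPlan μ₁ μ₂) :
    weightedPlan p γ univ = ∫⁻ x, levyWeight p x ∂μ₁ + ∫⁻ x, levyWeight p x ∂μ₂ := by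
  have hm : Measurable fun x : Euc d => (levyWeight p x : ℝ≥0∞) :=
    (continuous_levyWeight hp).measurable.coe_nnreal_ennreal
  have h0 : (levyWeight p (0 : Euc d) : ℝ≥0∞) = 0 := by simp [levyWeight_zero hp]
  rw [weightedPlan, withDensity_apply _ .univ, Measure.restrict_univ,
    ← lintegral_fst_of_mem_admPlan hγ hm h0, ← lintegral_snd_of_mem_admPlan hγ hm h0,
    ← lintegral_add_left (hm.fun_comp measurable_fst)]
  simp [planWeight]

lemma weightedPlan_compl_closedBall_le {p : ℝ} {μ₁ μ₂ : Measure (Euc d)}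
    {γ : Measure (Euc d × Euc d)} (hγ : γ ∈ AdmPlan μ₁ μ₂) {R : ℝ} (hR : 0 ≤ R) :
    weightedPlan p γ (closedBall 0 R ×ˢ closedBall 0 R)ᶜ ≤
      2 * (μ₁ (closedBall 0 R)ᶜ + μ₂ (closedBall 0 R)ᶜ) := by
  have hB : MeasurableSet (closedBall (0 : Euc d) R)ᶜ := measurableSet_closedBall.compl
  have hf : Measurable ((closedBall (0 : Euc d) R)ᶜ.indicator (1 : Euc d → ℝ≥0∞)) :=
    measurable_one.indicator hB
  have hf0 : (closedBall (0 : Euc d) R)ᶜ.indicator (1 : Euc d → ℝ≥0∞) 0 = 0 := by simp [hR]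
  rw [weightedPlan,
    withDensity_apply _ (measurableSet_closedBall.prod measurableSet_closedBall).compl,
    ← lintegral_indicator_one hB, ← lintegral_indicator_one hB,
    ← lintegral_fst_of_mem_admPlan hγ hf hf0, ← lintegral_snd_of_mem_admPlan hγ hf hf0,
    ← lintegral_add_left (by fun_prop), ← lintegral_const_mul' _ _ (by simp),
    ← lintegral_indicator (measurableSet_closedBall.prod measurableSet_closedBall).compl]
  refine lintegral_mono fun q => ?_
  have hw : (planWeight p q : ℝ≥0∞) ≤ 2 := by
    have := add_le_add (levyWeight_le_one p q.1) (levyWeight_le_one p q.2)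
    rw [one_add_one_eq_two] at this
    exact_mod_cast this
  by_cases h1 : q.1 ∈ closedBall (0 : Euc d) R
  · by_cases h2 : q.2 ∈ closedBall (0 : Euc d) R
    · have : q ∉ (closedBall (0 : Euc d) R ×ˢ closedBall (0 : Euc d) R)ᶜ := fun h => h ⟨h1, h2⟩
      simp [indicator_of_notMem this]
    · refine (indicator_le_self _ _ q).trans (hw.trans ?_)
      simp [indicator_of_mem (mem_compl h2), mul_add]
  · refine (indicator_le_self _ _ q).trans (hw.trans ?_)
    simp [indicator_of_mem (mem_compl h1), mul_add]

lemma IsLevyLp.tendsto_measure_compl_closedBall {p : ℝ} (hp : 0 < p) {μ : Measure (Euc d)}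
    (h : IsLevyLp p μ) :
    Tendsto (fun n : ℕ => μ (closedBall 0 ((n : ℝ) + 1))ᶜ) atTop (nhds 0) := by
  have : IsFiniteMeasure (μ.withDensity fun z => (levyWeight p z : ℝ≥0∞)) :=
    isFiniteMeasure_withDensity h.lintegral_levyWeight_lt_top.ne
  have ht := tendsto_measure_compl_closedBall_of_isTightMeasureSet
    (isTightMeasureSet_singleton (μ := μ.withDensity fun z => (levyWeight p z : ℝ≥0∞))) 0
  simp only [mem_singleton_iff, iSup_iSup_eq_left] at ht
  refine (ht.comp (tendsto_natCast_atTop_atTop.atTop_add (tendsto_const_nhds (x := 1)))).congr fun n => ?_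
  rw [Function.comp_apply, withDensity_apply _ measurableSet_closedBall.compl,
    setLIntegral_congr_fun measurableSet_closedBall.compl (g := fun _ => 1), setLIntegral_one]
  intro z hz
  simp only [mem_compl_iff, mem_closedBall, dist_zero_right, not_le] at hz
  have : (0 : ℝ) ≤ n := n.cast_nonneg
  simp [levyWeight_eq_one hp (z := z) (by linarith)]

/-- Multiplied by `planWeight`, the admissible plans stay in a compact set of finite measures. -/
lemma exists_isCompact_weightedPlan_mem {p : ℝ} (hp : 0 < p) {μ₁ μ₂ : Measure (Euc d)}
    (h₁ : IsLevyLp p μ₁) (h₂ : IsLevyLp p μ₂) :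
    ∃ S : Set (FiniteMeasure (Euc d × Euc d)), IsCompact S ∧
      ∀ γ ∈ AdmPlan μ₁ μ₂, ∃ η ∈ S, (η : Measure (Euc d × Euc d)) = weightedPlan p γ := by
  set C : ℝ≥0∞ := ∫⁻ x, levyWeight p x ∂μ₁ + ∫⁻ x, levyWeight p x ∂μ₂
  have hC : C ≠ ⊤ := (ENNReal.add_lt_top.2
    ⟨h₁.lintegral_levyWeight_lt_top, h₂.lintegral_levyWeight_lt_top⟩).ne
  set K : ℕ → Set (Euc d × Euc d) :=
    fun n => closedBall 0 ((n : ℝ) + 1) ×ˢ closedBall 0 ((n : ℝ) + 1)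
  set u : ℕ → ℝ≥0∞ := fun n => min C
    (2 * (μ₁ (closedBall 0 ((n : ℝ) + 1))ᶜ + μ₂ (closedBall 0 ((n : ℝ) + 1))ᶜ))
  have hu_top : ∀ n, u n ≠ ⊤ := fun n => ne_top_of_le_ne_top hC (min_le_left _ _)
  have hu : Tendsto u atTop (nhds 0) := by
    have := (ENNReal.Tendsto.const_mul (a := 2) ((h₁.tendsto_measure_compl_closedBall hp).add
      (h₂.tendsto_measure_compl_closedBall hp)) (Or.inr (by simp)))
    simpa using (tendsto_const_nhds (x := C)).min this
  have huN : Tendsto (fun n => (u n).toNNReal) atTop (nhds 0) :=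
    (ENNReal.tendsto_toNNReal ENNReal.zero_ne_top).comp hu
  refine ⟨_, isCompact_setOfPred_finiteMeasure_mass_le_compl_isCompact_le C.toNNReal huN
    (K := K) (fun n => (isCompact_closedBall _ _).prod (isCompact_closedBall _ _))
    (Or.inl inferInstance), fun γ hγ => ?_⟩
  have huniv : weightedPlan p γ univ = C := weightedPlan_univ hp hγ
  have hfin : IsFiniteMeasure (weightedPlan p γ) := ⟨huniv ▸ hC.lt_top⟩
  refine ⟨⟨weightedPlan p γ, hfin⟩, ⟨ENNReal.toNNReal_mono hC huniv.le, fun n => ?_⟩, rfl⟩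
  exact ENNReal.toNNReal_mono (hu_top n) (le_min ((measure_mono (subset_univ _)).trans huniv.le)
    (weightedPlan_compl_closedBall_le hγ (by positivity)))

/-- The inverse of `weightedPlan`, discarding the mass at the origin. -/
def unweightedPlan (p : ℝ) (η : Measure (Euc d × Euc d)) : Measure (Euc d × Euc d) :=
  (η.restrict {0}ᶜ).withDensity fun q => (planWeight p q : ℝ≥0∞)⁻¹

lemma unweightedPlan_singleton_zero (p : ℝ) (η : Measure (Euc d × Euc d)) :
    unweightedPlan p η {0} = 0 :=
  withDensity_absolutelyContinuous _ _ <| by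
    rw [Measure.restrict_apply (measurableSet_singleton _)]
    simp

lemma lintegral_unweightedPlan {p : ℝ} (hp : 0 < p) (η : Measure (Euc d × Euc d))
    {k : BoundedContinuousFunction (Euc d × Euc d) ℝ≥0} (h0 : k 0 = 0) :
    ∫⁻ q, (planWeight p q * k q : ℝ≥0) ∂(unweightedPlan p η) = ∫⁻ q, k q ∂η := by
  have hw : Measurable fun q : Euc d × Euc d => (planWeight p q : ℝ≥0∞) :=
    (continuous_planWeight hp).measurable.coe_nnreal_ennreal
  have hk : Measurable fun q : Euc d × Euc d => ((planWeight p q * k q : ℝ≥0) : ℝ≥0∞) :=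
    ((continuous_planWeight hp).mul k.continuous).measurable.coe_nnreal_ennreal
  rw [unweightedPlan, lintegral_withDensity_eq_lintegral_mul _ hw.fun_inv hk]
  have hcompl : MeasurableSet ({0}ᶜ : Set (Euc d × Euc d)) := (measurableSet_singleton _).compl
  have hsupp : (Function.support fun q => (k q : ℝ≥0∞)) ⊆ {0}ᶜ := fun q hq => by
    rintro rfl
    exact hq (by simp [h0])
  rw [← setLIntegral_eq_of_support_subset hsupp]
  refine setLIntegral_congr_fun hcompl fun q hq => ?_
  have hq0 : (planWeight p q : ℝ≥0∞) ≠ 0 := by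
    simpa [planWeight_eq_zero hp] using hq
  simp only [Pi.mul_apply, ENNReal.coe_mul, ← mul_assoc]
  rw [ENNReal.inv_mul_cancel hq0 ENNReal.coe_ne_top, one_mul]

/-- A marginal condition against the functions `planWeight p * k` identifies the marginal. -/
lemma IsLevyLp.restrict_map_eq_of_forall_lintegral_eq {p : ℝ} (hp : 0 < p) {μ : Measure (Euc d)}
    (hμ : IsLevyLp p μ) {π : Euc d × Euc d → Euc d} (hπ : Continuous π) (hπ0 : π 0 = 0)
    (hπw : ∀ q, levyWeight p (π q) ≤ planWeight p q) {γ : Measure (Euc d × Euc d)}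
    (h : ∀ k : BoundedContinuousFunction (Euc d × Euc d) ℝ≥0, k 0 = 0 →
      ∀ f : Euc d → ℝ≥0, Measurable f → f 0 = 0 → (∀ q, planWeight p q * k q = f (π q)) →
        ∫⁻ q, (planWeight p q * k q : ℝ≥0) ∂γ = ∫⁻ x, f x ∂μ) :
    (γ.map π).restrict {0}ᶜ = μ := by
  refine hμ.restrict_eq_of_forall_lintegral_eq hp fun f => ?_
  have hm := continuous_levyWeight (d := d) hp
  have hf : Continuous fun x => f x * levyWeight p x ^ 2 := f.continuous.mul (hm.pow 2)
  obtain ⟨k, hk0, hk⟩ := exists_planWeight_mul_eq hp (hf.comp hπ)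
    (h := fun q => f (π q) * levyWeight p (π q)) (C := nndist f 0)
    ((f.continuous.mul hm).comp hπ) (by simp [hπ0, levyWeight_zero hp])
    (fun q => (mul_le_of_le_one_right zero_le (levyWeight_le_one p _)).trans
      (BoundedContinuousFunction.NNReal.upper_bound f _))
    (fun q => by
      calc f (π q) * levyWeight p (π q) ^ 2
          = levyWeight p (π q) * (f (π q) * levyWeight p (π q)) := by ring
        _ ≤ planWeight p q * (f (π q) * levyWeight p (π q)) := by gcongr; exact hπw q)
  rw [lintegral_map hf.measurable.coe_nnreal_ennreal hπ.measurable,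
    ← h k hk0 _ hf.measurable (by simp [levyWeight_zero hp]) hk]
  exact lintegral_congr fun q => by rw [hk]; rfl

/-- Sequential compactness, along an ultrafilter, of the set of admissible plans. -/
lemma exists_admPlan_tendsto {p : ℝ} (hp : 0 < p) {μ₁ μ₂ : Measure (Euc d)}
    (h₁ : IsLevyLp p μ₁) (h₂ : IsLevyLp p μ₂) {γ : ℕ → Measure (Euc d × Euc d)}
    (hγ : ∀ n, γ n ∈ AdmPlan μ₁ μ₂) :
    ∃ γ' ∈ AdmPlan μ₁ μ₂, ∃ F : Ultrafilter ℕ, (F : Filter ℕ) ≤ atTop ∧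
      ∀ k : BoundedContinuousFunction (Euc d × Euc d) ℝ≥0, k 0 = 0 →
        Tendsto (fun n => ∫⁻ q, (planWeight p q * k q : ℝ≥0) ∂(γ n)) F
          (nhds (∫⁻ q, (planWeight p q * k q : ℝ≥0) ∂γ')) := by
  obtain ⟨S, hS, hmem⟩ := exists_isCompact_weightedPlan_mem hp h₁ h₂
  choose η hηS hη using fun n => hmem (γ n) (hγ n)
  obtain ⟨η', -, hη'⟩ := hS.ultrafilter_le_nhds ((Ultrafilter.of atTop).map η)
    (tendsto_principal.2 (Eventually.of_forall hηS))
  have hlim : ∀ k : BoundedContinuousFunction (Euc d × Euc d) ℝ≥0, k 0 = 0 →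
      Tendsto (fun n => ∫⁻ q, (planWeight p q * k q : ℝ≥0) ∂(γ n))
        (Ultrafilter.of (atTop : Filter ℕ))
        (nhds (∫⁻ q, (planWeight p q * k q : ℝ≥0) ∂(unweightedPlan p (η' : Measure _)))) := by
    intro k hk
    rw [lintegral_unweightedPlan hp _ hk]
    refine (FiniteMeasure.tendsto_iff_forall_lintegral_tendsto.1 hη' k).congr fun n => ?_
    rw [hη, lintegral_weightedPlan hp]
  refine ⟨unweightedPlan p η', ⟨unweightedPlan_singleton_zero p _, ?_, ?_⟩,
    Ultrafilter.of atTop, Ultrafilter.of_le _, hlim⟩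
  · refine h₁.restrict_map_eq_of_forall_lintegral_eq hp continuous_fst rfl
      (fun q => le_self_add) fun k hk0 f hf hf0 hk => ?_
    refine tendsto_nhds_unique (hlim k hk0) (tendsto_const_nhds.congr fun n => ?_)
    simp_rw [hk]
    exact (lintegral_fst_of_mem_admPlan (hγ n) hf.coe_nnreal_ennreal (by simp [hf0])).symm
  · refine h₂.restrict_map_eq_of_forall_lintegral_eq hp continuous_snd rfl
      (fun q => le_add_self) fun k hk0 f hf hf0 hk => ?_
    refine tendsto_nhds_unique (hlim k hk0) (tendsto_const_nhds.congr fun n => ?_)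
    simp_rw [hk]
    exact (lintegral_snd_of_mem_admPlan (hγ n) hf.coe_nnreal_ennreal (by simp [hf0])).symm

/-- The transport cost `|x - y|^p`, as a nonnegative real. -/
def transportCost (p : ℝ) (q : Euc d × Euc d) : ℝ≥0 := ‖q.1 - q.2‖₊ ^ p

lemma continuous_transportCost {p : ℝ} (hp : 0 < p) : Continuous (transportCost (d := d) p) :=
  (NNReal.continuous_rpow_const hp.le).comp (continuous_fst.sub continuous_snd).nnnorm

lemma transportCost_zero {p : ℝ} (hp : 0 < p) : transportCost p (0 : Euc d × Euc d) = 0 := by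
  simp [transportCost, hp.ne']

lemma Jp_eq_lintegral_transportCost (p : ℝ) (γ : Measure (Euc d × Euc d)) :
    Jp p γ = ∫⁻ q, transportCost p q ∂γ :=
  lintegral_congr fun q => by
    rw [← ENNReal.ofReal_coe_nnreal]
    simp [transportCost]

/-- The transport cost truncated at height `j`, and cut off near the origin. -/
def truncatedCost (p : ℝ) (j : ℕ) (q : Euc d × Euc d) : ℝ≥0 :=
  min (transportCost p q) j * min 1 (j * planWeight p q)

lemma truncatedCost_le (p : ℝ) (j : ℕ) (q : Euc d × Euc d) :
    truncatedCost p j q ≤ transportCost p q :=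
  (mul_le_of_le_one_right zero_le (min_le_left _ _)).trans (min_le_left _ _)

lemma continuous_truncatedCost {p : ℝ} (hp : 0 < p) (j : ℕ) :
    Continuous (truncatedCost (d := d) p j) :=
  ((continuous_transportCost hp).min continuous_const).mul
    (continuous_const.min (continuous_const.mul (continuous_planWeight hp)))

lemma monotone_truncatedCost (p : ℝ) (q : Euc d × Euc d) :
    Monotone fun j => truncatedCost p j q := fun i j hij => by
  simp only [truncatedCost]
  gcongr

lemma tendsto_truncatedCost {p : ℝ} (hp : 0 < p) (q : Euc d × Euc d) :
    Tendsto (fun j => truncatedCost p j q) atTop (nhds (transportCost p q)) := by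
  refine tendsto_const_nhds.congr' ?_
  rcases eq_or_ne q 0 with rfl | hq
  · simp [truncatedCost, transportCost_zero hp]
  · have hw : 0 < planWeight p q := pos_iff_ne_zero.2 (mt (planWeight_eq_zero hp).1 hq)
    filter_upwards [tendsto_natCast_atTop_atTop.eventually_ge_atTop (transportCost p q),
      tendsto_natCast_atTop_atTop.eventually_ge_atTop (planWeight p q)⁻¹] with j h1 h2
    rw [truncatedCost, min_eq_left h1, min_eq_left, mul_one]
    calc (1 : ℝ≥0) = (planWeight p q)⁻¹ * planWeight p q := (inv_mul_cancel₀ hw.ne').symm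
      _ ≤ j * planWeight p q := by gcongr

lemma exists_planWeight_mul_eq_truncatedCost {p : ℝ} (hp : 0 < p) (j : ℕ) :
    ∃ k : BoundedContinuousFunction (Euc d × Euc d) ℝ≥0,
      k 0 = 0 ∧ ∀ q, planWeight p q * k q = truncatedCost p j q := by
  refine exists_planWeight_mul_eq hp (continuous_truncatedCost hp j)
    (h := fun q => min (transportCost p q) j * j) (C := j * j)
    (((continuous_transportCost hp).min continuous_const).mul continuous_const)
    (by simp [transportCost_zero hp]) (fun q => by gcongr; exact min_le_right _ _) fun q => ?_
  calc truncatedCost p j q ≤ min (transportCost p q) j * (j * planWeight p q) := by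
        unfold truncatedCost
        gcongr
        exact min_le_right _ _
    _ = planWeight p q * (min (transportCost p q) j * j) := by ring

/-- The transport cost attains its minimum on the admissible plans. -/
lemma exists_admPlan_isMin_Jp {p : ℝ} (hp : 0 < p) {μ₁ μ₂ : Measure (Euc d)}
    (h₁ : IsLevyLp p μ₁) (h₂ : IsLevyLp p μ₂) (hne : (AdmPlan μ₁ μ₂).Nonempty) :
    ∃ γ ∈ AdmPlan μ₁ μ₂, ∀ γ' ∈ AdmPlan μ₁ μ₂, Jp p γ ≤ Jp p γ' := by
  obtain ⟨v, -, hv, hvmem⟩ := exists_seq_tendsto_sInf (hne.image (Jp p)) (OrderBot.bddBelow _)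
  choose γ hγ hγv using hvmem
  obtain ⟨γ', hγ', F, hF, hlim⟩ := exists_admPlan_tendsto hp h₁ h₂ hγ
  have hbound : ∀ j, ∫⁻ q, truncatedCost p j q ∂γ' ≤ sInf (Jp p '' AdmPlan μ₁ μ₂) := by
    intro j
    obtain ⟨k, hk0, hk⟩ := exists_planWeight_mul_eq_truncatedCost (d := d) hp j
    have := hlim k hk0
    simp_rw [hk] at this
    refine le_of_tendsto_of_tendsto' this (hv.mono_left hF) fun n => ?_
    rw [← hγv, Jp_eq_lintegral_transportCost]
    exact lintegral_mono fun q => ENNReal.coe_le_coe.2 (truncatedCost_le p j q)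
  refine ⟨γ', hγ', fun γ'' hγ'' => le_trans ?_ (sInf_le (mem_image_of_mem _ hγ''))⟩
  rw [Jp_eq_lintegral_transportCost]
  refine le_of_tendsto' (lintegral_tendsto_of_tendsto_of_monotone
    (fun j => (continuous_truncatedCost hp j).measurable.coe_nnreal_ennreal.aemeasurable)
    (ae_of_all _ fun q i j hij => ENNReal.coe_le_coe.2 (monotone_truncatedCost p q hij))
    (ae_of_all _ fun q => ENNReal.tendsto_coe.2 (tendsto_truncatedCost hp q))) hbound

/-- The plan moving all the mass to and from the origin. -/
def originPlan (μ₁ μ₂ : Measure (Euc d)) : Measure (Euc d × Euc d) :=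
  μ₁.map (fun x => (x, 0)) + μ₂.map (fun y => (0, y))

lemma originPlan_mem_admPlan {μ₁ μ₂ : Measure (Euc d)} (h₁ : μ₁ {0} = 0) (h₂ : μ₂ {0} = 0) :
    originPlan μ₁ μ₂ ∈ AdmPlan μ₁ μ₂ := by
  have hl : Measurable fun x : Euc d => (x, (0 : Euc d)) := by fun_prop
  have hr : Measurable fun y : Euc d => ((0 : Euc d), y) := by fun_prop
  have hself : ∀ μ : Measure (Euc d), μ {0} = 0 → μ.restrict {0}ᶜ = μ := fun μ hμ =>
    Measure.restrict_eq_self_of_ae_mem <| by rw [ae_iff]; simpa using hμ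
  have hconst : ∀ μ : Measure (Euc d), (μ.map fun _ => (0 : Euc d)).restrict {0}ᶜ = 0 := fun μ => by
    rw [Measure.map_const, Measure.restrict_smul, Measure.restrict_eq_zero.2 (by simp), smul_zero]
  refine ⟨?_, ?_, ?_⟩
  · rw [originPlan, Measure.add_apply, Measure.map_apply hl (measurableSet_singleton _),
      Measure.map_apply hr (measurableSet_singleton _)]
    have e1 : (fun x : Euc d => (x, (0 : Euc d))) ⁻¹' {(0, 0)} = {0} := by ext; simp
    have e2 : (fun y : Euc d => ((0 : Euc d), y)) ⁻¹' {(0, 0)} = {0} := by ext; simp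
    rw [e1, e2, h₁, h₂, add_zero]
  · rw [originPlan, Measure.map_add _ _ measurable_fst, Measure.map_map measurable_fst hl,
      Measure.map_map measurable_fst hr, Measure.restrict_add]
    exact (congrArg₂ _ (by simpa [Function.comp_def] using hself _ h₁) (hconst μ₂)).trans
      (add_zero _)
  · rw [originPlan, Measure.map_add _ _ measurable_snd, Measure.map_map measurable_snd hl,
      Measure.map_map measurable_snd hr, Measure.restrict_add]
    exact (congrArg₂ _ (hconst μ₁) (by simpa [Function.comp_def] using hself _ h₂)).trans
      (zero_add _)

lemma Jp_originPlan {p : ℝ} (hp : 0 < p) (μ₁ μ₂ : Measure (Euc d)) :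
    Jp p (originPlan μ₁ μ₂) =
      ∫⁻ z, ENNReal.ofReal (‖z‖ ^ p) ∂μ₁ + ∫⁻ z, ENNReal.ofReal (‖z‖ ^ p) ∂μ₂ := by
  have hm : Measurable fun q : Euc d × Euc d => (transportCost p q : ℝ≥0∞) :=
    (continuous_transportCost hp).measurable.coe_nnreal_ennreal
  rw [Jp_eq_lintegral_transportCost, originPlan, lintegral_add_measure,
    lintegral_map hm (by fun_prop), lintegral_map hm (by fun_prop)]
  congr 1 <;> refine lintegral_congr fun z => ?_ <;> rw [← ENNReal.ofReal_coe_nnreal] <;>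
    simp [transportCost]

/-- Theorem 3.5: for `μ₁, μ₂ ∈ M_p(ℝ^d)` there is an admissible plan of finite cost, and
there is at least one admissible plan achieving the minimum value of `J_p`. -/
theorem exists_optimal_plan
    {d : ℕ} (p : ℝ) (hp1 : 1 ≤ p) (hp2 : p ≤ 2)
    (μ₁ μ₂ : Measure (Euc d)) (h₁ : IsMp p μ₁) (h₂ : IsMp p μ₂) :
    (∃ γ ∈ AdmPlan μ₁ μ₂, Jp p γ < ⊤) ∧
    (∃ γ ∈ AdmPlan μ₁ μ₂, ∀ γ' ∈ AdmPlan μ₁ μ₂, Jp p γ ≤ Jp p γ') := by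
  have hp : 0 < p := by linarith
  have hmem := originPlan_mem_admPlan h₁.1.1 h₂.1.1
  refine ⟨⟨_, hmem, ?_⟩, exists_admPlan_isMin_Jp hp h₁.1 h₂.1 ⟨_, hmem⟩⟩
  rw [Jp_originPlan hp]
  exact ENNReal.add_lt_top.2 ⟨h₁.2, h₂.2⟩
end
end
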